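/- Let u₀ : ℝ → ℝ be a smooth 2π-periodic function with u₀ > 0, ∫_0^{2π} u₀(θ)^{−2} dθ = 2π, and satisfying the orthogonality condition ∫_0^{2π} u₀(θ)^{−3} cos θ dθ = ∫_0^{2π} u₀(θ)^{−3} sin θ dθ = 0. Then there exists a unique smooth function u : ℝ × [0,∞) → ℝ, 2π-periodic in θ and positive, with u(·,0) = u₀, satisfying the normalized affine flow ∂_t u = (1/4)(κ − κ̄)·u for all t ∈ [0,∞), where κ(θ,t) = u³·(∂²_θ u + u) and κ̄(t) = (∫_0^{2π} κ u^{−2} dθ)/(∫_0^{2π} u^{−2} dθ). Moreover there exist a smooth positive 2π-periodic function u_∞ : ℝ → ℝ and constants C > 0, a > 0 such that sup_θ |u(θ,t) − u_∞(θ)| ≤ C·e^{−at} for all t ≥ 0, and the 1-scalar curvature of u_∞ is constant: u_∞³·(u_∞'' + u_∞) ≡ const. -/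

import Mathlib

open Real MeasureTheory

/-- The α-scalar curvature `R^α = u³(α u_θθ + u)` of the metric `u⁻⁴ dθ⊗dθ`. -/
noncomputable def scalCurv (α : ℝ) (u : ℝ → ℝ → ℝ) (θ t : ℝ) : ℝ :=
  (u θ t) ^ 3 * (α * deriv (deriv (fun x => u x t)) θ + u θ t)

/-- The average of the α-scalar curvature with respect to arc length `dσ = u⁻²dθ`. -/
noncomputable def scalCurvAvg (α : ℝ) (u : ℝ → ℝ → ℝ) (t : ℝ) : ℝ :=
  (∫ θ in (0:ℝ)..(2 * π), scalCurv α u θ t * ((u θ t) ^ 2)⁻¹) /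
    ∫ θ in (0:ℝ)..(2 * π), ((u θ t) ^ 2)⁻¹

/-- `u` solves the normalized α-scalar-curvature flow `∂ₜu = ¼(R − R̄)u`
on `S¹ × [0,∞)` with initial data `u₀`. -/
def IsNormalizedFlow (α : ℝ) (u₀ : ℝ → ℝ) (u : ℝ → ℝ → ℝ) : Prop :=
  ContDiff ℝ (⊤ : ℕ∞) (fun p : ℝ × ℝ => u p.1 p.2)
  ∧ (∀ θ t, u (θ + 2 * π) t = u θ t)
  ∧ (∀ θ t, 0 < u θ t)
  ∧ (∀ θ, u θ 0 = u₀ θ)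
  ∧ ∀ θ t, 0 ≤ t →
      deriv (fun s => u θ s) t
        = (1 / 4) * (scalCurv α u θ t - scalCurvAvg α u t) * u θ t

namespace AffineFlow

/-- The weight `1 + |k|`. -/
noncomputable def wt (k : ℤ) : ℝ := 1 + |(k : ℝ)|

lemma one_le_wt (k : ℤ) : 1 ≤ wt k := by simp [wt]

lemma wt_pos (k : ℤ) : 0 < wt k := by linarith [one_le_wt k]

lemma wt_neg (k : ℤ) : wt (-k) = wt k := by simp [wt]

lemma wt_le_mul (k j : ℤ) : wt k ≤ wt j * wt (k - j) := by
  unfold wt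
  push_cast
  have h : |(k : ℝ)| ≤ |(j : ℝ)| + |(k : ℝ) - j| := by
    calc |(k : ℝ)| = |(j : ℝ) + (k - j)| := by ring_nf
      _ ≤ _ := abs_add_le _ _
  nlinarith [abs_nonneg (j : ℝ), abs_nonneg ((k : ℝ) - j)]

/-- The coefficients `(k + j) / (2 j)` of the quadratic nonlinearity (zero for `j = 0`). -/
noncomputable def bco (k j : ℤ) : ℝ := ((k : ℝ) + j) / (2 * j)

lemma abs_bco_le (k j : ℤ) :
    |bco k j| ≤ 2 * (1 / wt j ^ 2 + 1 / wt (k - j) ^ 2) * (wt j * wt (k - j)) := by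
  have hx := wt_pos j
  have hy := wt_pos (k - j)
  by_cases hj : j = 0
  · subst hj
    simp only [bco, Int.cast_zero, mul_zero, div_zero, abs_zero]
    positivity
  have hj1 : 1 ≤ |(j : ℝ)| := by exact_mod_cast Int.one_le_abs hj
  have h1 : |bco k j| ≤ 1 + wt (k - j) / wt j := by
    unfold bco
    rw [abs_div, abs_mul, abs_two, div_le_iff₀ (by positivity)]
    have h2 : |(k : ℝ) + j| ≤ |(k : ℝ) - j| + 2 * |(j : ℝ)| := by
      calc |(k : ℝ) + j| = |((k : ℝ) - j) + 2 * j| := by ring_nf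
        _ ≤ |(k : ℝ) - j| + |2 * (j : ℝ)| := abs_add_le _ _
        _ = _ := by rw [abs_mul, abs_two]
    have h3 : |(k : ℝ) - j| ≤ wt (k - j) := by simp [wt]
    have h4 : wt (k - j) ≤ wt (k - j) / wt j * (2 * |(j : ℝ)|) := by
      rw [div_mul_eq_mul_div, le_div_iff₀ hx]
      apply mul_le_mul_of_nonneg_left _ hy.le
      unfold wt; linarith
    nlinarith
  have h2 : 2 * (1 / wt j ^ 2 + 1 / wt (k - j) ^ 2) * (wt j * wt (k - j))
      = 2 * (wt (k - j) / wt j) + 2 * (wt j / wt (k - j)) := by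
    field_simp
  rw [h2]
  refine h1.trans ?_
  have h3 : 2 ≤ wt (k - j) / wt j + wt j / wt (k - j) := by
    rw [div_add_div _ _ hx.ne' hy.ne', le_div_iff₀ (by positivity)]
    nlinarith [sq_nonneg (wt j - wt (k - j))]
  have : 0 < wt j / wt (k - j) := by positivity
  linarith

lemma abs_bco_le_wt (k j : ℤ) : |bco k j| ≤ wt k := by
  by_cases hj : j = 0
  · subst hj
    simp only [bco, Int.cast_zero, mul_zero, div_zero, abs_zero]
    exact (wt_pos k).le
  have hj1 : 1 ≤ |(j : ℝ)| := by exact_mod_cast Int.one_le_abs hj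
  unfold bco wt
  rw [abs_div, abs_mul, abs_two, div_le_iff₀ (by positivity)]
  nlinarith [abs_add_le (k : ℝ) j, abs_nonneg (k : ℝ)]

lemma summable_wt : Summable fun j : ℤ => 1 / wt j ^ 2 := by
  have h : Summable fun j : ℤ => 1 / (j : ℝ) ^ 2 :=
    Real.summable_one_div_int_pow.mpr one_lt_two
  refine Summable.of_norm_bounded_eventually h ?_
  have : ({0} : Set ℤ)ᶜ ∈ (Filter.cofinite : Filter ℤ) :=
    (Set.finite_singleton 0).compl_mem_cofinite
  filter_upwards [this] with j hj
  have hj : j ≠ 0 := by simpa using hj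
  have hj1 : 1 ≤ |(j : ℝ)| := by exact_mod_cast Int.one_le_abs hj
  rw [Real.norm_of_nonneg (by have := wt_pos j; positivity), ← sq_abs (j : ℝ)]
  apply one_div_le_one_div_of_le (by positivity)
  unfold wt
  gcongr
  linarith

lemma summable_wt_sub (k : ℤ) : Summable fun j : ℤ => 1 / wt (k - j) ^ 2 :=
  summable_wt.comp_injective (i := fun j => k - j) (fun a b h => by simpa using h)

lemma tsum_wt_sub (k : ℤ) : ∑' j : ℤ, 1 / wt (k - j) ^ 2 = ∑' j : ℤ, 1 / wt j ^ 2 :=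
  (Equiv.subLeft k).tsum_eq (fun j => 1 / wt j ^ 2)

/-- The constant in the basic convolution estimate. -/
noncomputable def convK : ℝ := 4 * ∑' j : ℤ, 1 / wt j ^ 2

lemma convK_nonneg : 0 ≤ convK := by
  unfold convK
  have : 0 ≤ ∑' j : ℤ, 1 / wt j ^ 2 :=
    tsum_nonneg fun j => by have := wt_pos j; positivity
  positivity

/-- Majorant of the convolution kernel. -/
noncomputable def convM (k j : ℤ) : ℝ := 2 * (1 / wt j ^ 2 + 1 / wt (k - j) ^ 2)

lemma summable_convM (k : ℤ) : Summable (convM k) :=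
  (summable_wt.add (summable_wt_sub k)).mul_left 2

lemma tsum_convM (k : ℤ) : ∑' j, convM k j = convK := by
  unfold convM convK
  rw [tsum_mul_left, summable_wt.tsum_add (summable_wt_sub k), tsum_wt_sub]
  ring

/-- The quadratic nonlinearity in Fourier space. -/
noncomputable def Bq (c d : ℤ → ℂ) (k : ℤ) : ℂ := ∑' j, (bco k j : ℂ) * c j * d (k - j)

lemma norm_Bq_term_le {c d : ℤ → ℂ} {C D : ℝ} {n : ℕ}
    (hc : ∀ k, ‖c k‖ ≤ C / wt k ^ (n + 1)) (hd : ∀ k, ‖d k‖ ≤ D / wt k ^ (n + 1)) (k j : ℤ) :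
    ‖(bco k j : ℂ) * c j * d (k - j)‖ ≤ C * D / wt k ^ n * convM k j := by
  have hx := wt_pos j
  have hy := wt_pos (k - j)
  have hk := wt_pos k
  have hC : 0 ≤ C := by
    have := (norm_nonneg _).trans (hc 0)
    simpa [wt] using this
  have hD : 0 ≤ D := by
    have := (norm_nonneg _).trans (hd 0)
    simpa [wt] using this
  have hM : 0 ≤ convM k j := by unfold convM; positivity
  rw [norm_mul, norm_mul, Complex.norm_real, Real.norm_eq_abs]
  calc |bco k j| * ‖c j‖ * ‖d (k - j)‖
      ≤ (convM k j * (wt j * wt (k - j))) * (C / wt j ^ (n + 1)) * (D / wt (k - j) ^ (n + 1)) := by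
        gcongr
        · exact abs_bco_le k j
        · exact hc j
        · exact hd (k - j)
    _ = C * D / (wt j * wt (k - j)) ^ n * convM k j := by
        field_simp
        ring
    _ ≤ _ := by
        gcongr
        exact wt_le_mul k j

lemma summable_Bq {c d : ℤ → ℂ} {C D : ℝ} {n : ℕ}
    (hc : ∀ k, ‖c k‖ ≤ C / wt k ^ (n + 1)) (hd : ∀ k, ‖d k‖ ≤ D / wt k ^ (n + 1)) (k : ℤ) :
    Summable fun j => (bco k j : ℂ) * c j * d (k - j) :=
  Summable.of_norm_bounded ((summable_convM k).mul_left _) (norm_Bq_term_le hc hd k)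

lemma norm_Bq_le {c d : ℤ → ℂ} {C D : ℝ} {n : ℕ}
    (hc : ∀ k, ‖c k‖ ≤ C / wt k ^ (n + 1)) (hd : ∀ k, ‖d k‖ ≤ D / wt k ^ (n + 1)) (k : ℤ) :
    ‖Bq c d k‖ ≤ convK * C * D / wt k ^ n := by
  unfold Bq
  refine (tsum_of_norm_bounded ((summable_convM k).mul_left _).hasSum
    (norm_Bq_term_le hc hd k)).trans (le_of_eq ?_)
  rw [tsum_mul_left, tsum_convM]
  ring

lemma summable_div_wt_pow (C : ℝ) (n : ℕ) : Summable fun k : ℤ => C / wt k ^ (n + 2) := by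
  have : Summable fun k : ℤ => |C| * (1 / wt k ^ 2) := summable_wt.mul_left _
  refine Summable.of_norm_bounded this fun k => ?_
  have h1 := one_le_wt k
  rw [Real.norm_eq_abs, abs_div, mul_one_div, abs_of_pos (a := wt k ^ (n + 2)) (by positivity)]
  gcongr
  omega

lemma norm_Bq_le_of_summable_sq {c : ℤ → ℂ} (hc : Summable fun j => ‖c j‖ ^ 2) (k : ℤ) :
    ‖Bq c c k‖ ≤ wt k * ∑' j, ‖c j‖ ^ 2 := by
  have hk := wt_pos k
  have h2 : Summable fun j => ‖c (k - j)‖ ^ 2 :=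
    hc.comp_injective (i := fun j => k - j) (fun a b h => by simpa using h)
  have h3 : ∑' j, ‖c (k - j)‖ ^ 2 = ∑' j, ‖c j‖ ^ 2 :=
    (Equiv.subLeft k).tsum_eq (fun j => ‖c j‖ ^ 2)
  have hs := (hc.add h2).mul_left (wt k / 2)
  unfold Bq
  refine (tsum_of_norm_bounded hs.hasSum fun j => ?_).trans (le_of_eq ?_)
  · rw [norm_mul, norm_mul, Complex.norm_real, Real.norm_eq_abs]
    have h1 := abs_bco_le_wt k j
    have h4 : ‖c j‖ * ‖c (k - j)‖ ≤ (‖c j‖ ^ 2 + ‖c (k - j)‖ ^ 2) / 2 := by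
      nlinarith [sq_nonneg (‖c j‖ - ‖c (k - j)‖)]
    calc |bco k j| * ‖c j‖ * ‖c (k - j)‖ = |bco k j| * (‖c j‖ * ‖c (k - j)‖) := by ring
      _ ≤ wt k * ((‖c j‖ ^ 2 + ‖c (k - j)‖ ^ 2) / 2) := by gcongr
      _ = _ := by ring
  · rw [tsum_mul_left, hc.tsum_add h2, h3]
    ring

/-- A smooth odd function that is the identity on `[-1, 1]` and has compact support. -/
noncomputable def clip1 (x : ℝ) : ℝ := x * Real.smoothTransition (2 - x ^ 2)

lemma contDiff_smoothTransition_inf : ContDiff ℝ (⊤ : ℕ∞) Real.smoothTransition :=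
  Real.smoothTransition.contDiff

lemma contDiff_clip1 : ContDiff ℝ (⊤ : ℕ∞) clip1 :=
  contDiff_id.mul (contDiff_smoothTransition_inf.comp (contDiff_const.sub (contDiff_id.pow 2)))

lemma clip1_eq_zero {x : ℝ} (h : 2 ≤ |x|) : clip1 x = 0 := by
  unfold clip1
  rw [Real.smoothTransition.zero_of_nonpos, mul_zero]
  rw [← sq_abs]; nlinarith

lemma abs_clip1_le (x : ℝ) : |clip1 x| ≤ |x| := by
  unfold clip1
  rw [abs_mul, abs_of_nonneg (Real.smoothTransition.nonneg _)]
  exact mul_le_of_le_one_right (abs_nonneg _) (Real.smoothTransition.le_one _)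

lemma abs_clip1_le_two (x : ℝ) : |clip1 x| ≤ 2 := by
  rcases le_total 2 |x| with h | h
  · simp [clip1_eq_zero h]
  · exact (abs_clip1_le x).trans h

lemma clip1_eq_self {x : ℝ} (h : |x| ≤ 1) : clip1 x = x := by
  unfold clip1
  rw [Real.smoothTransition.one_of_one_le, mul_one]
  rw [← sq_abs]; nlinarith [abs_nonneg x]

lemma clip1_neg (x : ℝ) : clip1 (-x) = -clip1 x := by simp [clip1]

lemma hasCompactSupport_clip1 : HasCompactSupport clip1 := by
  refine HasCompactSupport.of_support_subset_isCompact (isCompact_Icc (a := (-2 : ℝ)) (b := 2)) ?_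
  intro x hx
  by_contra h
  apply hx
  apply clip1_eq_zero
  rw [Set.mem_Icc, ← abs_le] at h
  exact (not_le.mp h).le

lemma exists_lipschitz_clip1 : ∃ L : ℝ, 0 < L ∧ ∀ x y, |clip1 x - clip1 y| ≤ L * |x - y| := by
  obtain ⟨C, hC⟩ := (contDiff_clip1.of_le (by exact_mod_cast le_top)).lipschitzWith_of_hasCompactSupport
    hasCompactSupport_clip1 (n := 1) one_ne_zero
  refine ⟨C + 1, by positivity, fun x y => ?_⟩
  have := hC.dist_le_mul x y
  rw [Real.dist_eq, Real.dist_eq] at this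
  nlinarith [abs_nonneg (x - y)]

/-- The smooth truncation at scale `r`, applied to real and imaginary parts. -/
noncomputable def clipC (r : ℝ) (z : ℂ) : ℂ := ⟨r * clip1 (z.re / r), r * clip1 (z.im / r)⟩

lemma clipC_eq (r : ℝ) (z : ℂ) :
    clipC r z = ((r * clip1 (z.re / r) : ℝ) : ℂ) + ((r * clip1 (z.im / r) : ℝ) : ℂ) * Complex.I := by
  apply Complex.ext <;> simp [clipC]

lemma norm_clipC_le_four {r : ℝ} (hr : 0 < r) (z : ℂ) : ‖clipC r z‖ ≤ 4 * r := by
  refine (Complex.norm_le_abs_re_add_abs_im _).trans ?_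
  simp only [clipC, abs_mul, abs_of_pos hr]
  nlinarith [abs_clip1_le_two (z.re / r), abs_clip1_le_two (z.im / r)]

lemma norm_clipC_le {r : ℝ} (hr : 0 < r) (z : ℂ) : ‖clipC r z‖ ≤ 2 * ‖z‖ := by
  refine (Complex.norm_le_abs_re_add_abs_im _).trans ?_
  simp only [clipC, abs_mul, abs_of_pos hr]
  have h1 := abs_clip1_le (z.re / r)
  have h2 := abs_clip1_le (z.im / r)
  rw [abs_div, abs_of_pos hr, le_div_iff₀ hr] at h1 h2
  linarith [Complex.abs_re_le_norm z, Complex.abs_im_le_norm z]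

lemma clipC_eq_self {r : ℝ} (hr : 0 < r) {z : ℂ} (hz : ‖z‖ ≤ r) : clipC r z = z := by
  have h1 := (Complex.abs_re_le_norm z).trans hz
  have h2 := (Complex.abs_im_le_norm z).trans hz
  apply Complex.ext
  · simp only [clipC]
    rw [clip1_eq_self, mul_div_cancel₀ _ hr.ne']
    rw [abs_div, abs_of_pos hr, div_le_one hr]; exact h1
  · simp only [clipC]
    rw [clip1_eq_self, mul_div_cancel₀ _ hr.ne']
    rw [abs_div, abs_of_pos hr, div_le_one hr]; exact h2

lemma clipC_conj (r : ℝ) (z : ℂ) :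
    clipC r (starRingEnd ℂ z) = starRingEnd ℂ (clipC r z) := by
  apply Complex.ext
  · simp [clipC]
  · simp [clipC, neg_div, clip1_neg]

lemma norm_clipC_sub_le {L : ℝ} (hL0 : 0 < L) (hL : ∀ x y, |clip1 x - clip1 y| ≤ L * |x - y|)
    {r : ℝ} (hr : 0 < r) (z w : ℂ) : ‖clipC r z - clipC r w‖ ≤ 2 * L * ‖z - w‖ := by
  refine (Complex.norm_le_abs_re_add_abs_im _).trans ?_
  simp only [clipC, Complex.sub_re, Complex.sub_im, ← mul_sub, abs_mul, abs_of_pos hr]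
  have h1 := hL (z.re / r) (w.re / r)
  have h2 := hL (z.im / r) (w.im / r)
  rw [← sub_div, abs_div, abs_of_pos hr, mul_div_assoc', le_div_iff₀ hr] at h1 h2
  have h3 : |z.re - w.re| ≤ ‖z - w‖ := by simpa using Complex.abs_re_le_norm (z - w)
  have h4 : |z.im - w.im| ≤ ‖z - w‖ := by simpa using Complex.abs_im_le_norm (z - w)
  nlinarith

lemma continuous_clipC (r : ℝ) : Continuous (clipC r) := by
  have h : Continuous clip1 := contDiff_clip1.continuous
  have : clipC r = fun z => ((r * clip1 (z.re / r) : ℝ) : ℂ)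
      + ((r * clip1 (z.im / r) : ℝ) : ℂ) * Complex.I := funext (clipC_eq r)
  rw [this]
  fun_prop

/-- The time cutoff for the `k`-th mode: `1` for `t ≥ 0`, `0` for `t ≤ -1 / (1 + k²)`. -/
noncomputable def tcut (k : ℤ) (t : ℝ) : ℝ := Real.smoothTransition (1 + (1 + (k : ℝ) ^ 2) * t)

lemma tcut_nonneg (k : ℤ) (t : ℝ) : 0 ≤ tcut k t := Real.smoothTransition.nonneg _

lemma tcut_le_one (k : ℤ) (t : ℝ) : tcut k t ≤ 1 := Real.smoothTransition.le_one _

lemma tcut_eq_one (k : ℤ) {t : ℝ} (ht : 0 ≤ t) : tcut k t = 1 :=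
  Real.smoothTransition.one_of_one_le (by nlinarith [sq_nonneg (k : ℝ)])

lemma continuous_tcut (k : ℤ) : Continuous (tcut k) :=
  Real.smoothTransition.continuous.comp (by fun_prop)

lemma tcut_neg (k : ℤ) : tcut (-k) = tcut k := by
  funext t; simp [tcut]

lemma tcut_le_exp (k : ℤ) (t : ℝ) : tcut k t ≤ Real.exp (1 + (1 + (k : ℝ) ^ 2) * t) := by
  rcases le_total (1 + (1 + (k : ℝ) ^ 2) * t) 0 with h | h
  · unfold tcut
    rw [Real.smoothTransition.zero_of_nonpos h]
    exact (Real.exp_pos _).le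
  · exact (tcut_le_one k t).trans (Real.one_le_exp h)

/-- The integrated decay rate of the `k`-th mode. -/
noncomputable def arate (k : ℤ) (t : ℝ) : ℝ := ∫ s in (0 : ℝ)..t, tcut k s * ((k : ℝ) ^ 2 / 4)

lemma hasDerivAt_arate (k : ℤ) (t : ℝ) :
    HasDerivAt (arate k) (tcut k t * ((k : ℝ) ^ 2 / 4)) t :=
  have h : Continuous fun s => tcut k s * ((k : ℝ) ^ 2 / 4) := (continuous_tcut k).mul_const _
  intervalIntegral.integral_hasDerivAt_right (h.intervalIntegrable _ _)
    (h.stronglyMeasurableAtFilter _ _) h.continuousAt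

lemma continuous_arate (k : ℤ) : Continuous (arate k) :=
  continuous_iff_continuousAt.mpr fun t => (hasDerivAt_arate k t).continuousAt

lemma arate_zero (k : ℤ) : arate k 0 = 0 := by simp [arate]

lemma arate_neg (k : ℤ) : arate (-k) = arate k := by
  funext t; simp [arate, tcut_neg]

lemma arate_mono (k : ℤ) : Monotone (arate k) :=
  monotone_of_hasDerivAt_nonneg (hasDerivAt_arate k)
    (fun t => mul_nonneg (tcut_nonneg k t) (by positivity))

lemma arate_ge (k : ℤ) (t : ℝ) : -1 ≤ arate k t := by
  rcases le_total 0 t with ht | ht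
  · have := arate_mono k ht
    rw [arate_zero] at this; linarith
  have hanti : Antitone fun t => arate k t
      - (k : ℝ) ^ 2 / 4 * (1 / (1 + (k : ℝ) ^ 2)) * Real.exp (1 + (1 + (k : ℝ) ^ 2) * t) := by
    apply antitone_of_hasDerivAt_nonpos (f' := fun t => tcut k t * ((k : ℝ) ^ 2 / 4)
      - (k : ℝ) ^ 2 / 4 * (1 / (1 + (k : ℝ) ^ 2)) * (Real.exp (1 + (1 + (k : ℝ) ^ 2) * t)
        * (1 + (k : ℝ) ^ 2)))
    · intro x
      refine (hasDerivAt_arate k x).sub (HasDerivAt.const_mul _ (HasDerivAt.exp ?_))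
      simpa using ((hasDerivAt_id x).const_mul (1 + (k : ℝ) ^ 2)).const_add 1
    · intro x
      have h1 := tcut_le_exp k x
      have h2 : (k : ℝ) ^ 2 / 4 * (1 / (1 + (k : ℝ) ^ 2)) * (Real.exp (1 + (1 + (k : ℝ) ^ 2) * x)
        * (1 + (k : ℝ) ^ 2)) = Real.exp (1 + (1 + (k : ℝ) ^ 2) * x) * ((k : ℝ) ^ 2 / 4) := by
        field_simp
      change tcut k x * ((k : ℝ) ^ 2 / 4) - (k : ℝ) ^ 2 / 4 * (1 / (1 + (k : ℝ) ^ 2)) *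
        (Real.exp (1 + (1 + (k : ℝ) ^ 2) * x) * (1 + (k : ℝ) ^ 2)) ≤ 0
      rw [h2, ← sub_mul]
      exact mul_nonpos_of_nonpos_of_nonneg (by linarith) (by positivity)
  have h := hanti ht
  simp only [arate_zero, mul_zero, add_zero] at h
  have he := Real.exp_pos (1 + (1 + (k : ℝ) ^ 2) * t)
  have hfac : (k : ℝ) ^ 2 / 4 * (1 / (1 + (k : ℝ) ^ 2)) ≤ 1 / 4 := by
    rw [mul_one_div, div_le_iff₀ (by positivity)]
    nlinarith [sq_nonneg (k : ℝ)]
  have hfac0 : 0 ≤ (k : ℝ) ^ 2 / 4 * (1 / (1 + (k : ℝ) ^ 2)) := by positivity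
  nlinarith [Real.exp_one_lt_d9, Real.exp_pos 1, mul_nonneg hfac0 he.le]

lemma exp_neg_arate_le (k : ℤ) (t : ℝ) : Real.exp (-arate k t) ≤ 3 :=
  (Real.exp_le_exp.mpr (by linarith [arate_ge k t])).trans (by linarith [Real.exp_one_lt_d9] :
    Real.exp 1 ≤ 3)

/-- The Duhamel integral of the `k`-th mode. -/
noncomputable def duh (k : ℤ) (g : ℝ → ℂ) (t : ℝ) : ℂ :=
  (Real.exp (-arate k t) : ℂ) * ∫ s in (0 : ℝ)..t, ((Real.exp (arate k s) * tcut k s : ℝ) : ℂ) * g s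

lemma continuous_duh_integrand (k : ℤ) {g : ℝ → ℂ} (hg : Continuous g) :
    Continuous fun s => ((Real.exp (arate k s) * tcut k s : ℝ) : ℂ) * g s := by
  have h1 := continuous_arate k
  have h2 := continuous_tcut k
  fun_prop

lemma hasDerivAt_duh (k : ℤ) {g : ℝ → ℂ} (hg : Continuous g) (c : ℂ) (t : ℝ) :
    HasDerivAt (fun t => (Real.exp (-arate k t) : ℂ) * c + duh k g t)
      ((tcut k t : ℂ) * (-((k : ℂ) ^ 2 / 4) * ((Real.exp (-arate k t) : ℂ) * c + duh k g t) + g t))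
      t := by
  have h := continuous_duh_integrand k hg
  have h1 : HasDerivAt (fun t => ∫ s in (0 : ℝ)..t, ((Real.exp (arate k s) * tcut k s : ℝ) : ℂ) * g s)
      (((Real.exp (arate k t) * tcut k t : ℝ) : ℂ) * g t) t :=
    intervalIntegral.integral_hasDerivAt_right (h.intervalIntegrable _ _)
      (h.stronglyMeasurableAtFilter _ _) h.continuousAt
  have h2 : HasDerivAt (fun t => (Real.exp (-arate k t) : ℂ))
      ((Real.exp (-arate k t) * -(tcut k t * ((k : ℝ) ^ 2 / 4)) : ℝ) : ℂ) t :=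
    ((hasDerivAt_arate k t).neg.exp).ofReal_comp
  have h3 := (h2.mul_const c).add (h2.mul h1)
  refine h3.congr_deriv ?_
  have h4 : (Real.exp (-arate k t) : ℂ) * (Real.exp (arate k t) : ℂ) = 1 := by
    rw [← Complex.ofReal_mul, ← Real.exp_add]; simp
  unfold duh
  push_cast at h4 ⊢
  linear_combination ((tcut k t : ℂ) * g t) * h4

lemma continuous_duh (k : ℤ) {g : ℝ → ℂ} (hg : Continuous g) : Continuous (duh k g) := by
  have := fun t => (hasDerivAt_duh k hg 0 t).continuousAt
  simpa [← continuous_iff_continuousAt] using this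

lemma duh_sub (k : ℤ) {g h : ℝ → ℂ} (hg : Continuous g) (hh : Continuous h) (t : ℝ) :
    duh k g t - duh k h t = duh k (fun s => g s - h s) t := by
  unfold duh
  rw [← mul_sub, ← intervalIntegral.integral_sub
    ((continuous_duh_integrand k hg).intervalIntegrable _ _)
    ((continuous_duh_integrand k hh).intervalIntegrable _ _)]
  simp only [mul_sub]

lemma abs_le_of_mem_uIoc {s t : ℝ} (h : s ∈ Set.uIoc 0 t) : |s| ≤ |t| := by
  rcases le_total 0 t with ht | ht
  · rw [Set.uIoc_of_le ht] at h
    rw [abs_of_nonneg ht, abs_of_pos h.1]; exact h.2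
  · rw [Set.uIoc_of_ge ht] at h
    rw [abs_of_nonpos ht, abs_of_nonpos h.2]; linarith [h.1]

lemma norm_duh_le_sq (k : ℤ) (hk : k ≠ 0) {g : ℝ → ℂ} {G t : ℝ}
    (hG : ∀ s, |s| ≤ |t| → ‖g s‖ ≤ G) :
    ‖duh k g t‖ ≤ G * (8 / (k : ℝ) ^ 2) := by
  have hk' : (0 : ℝ) < (k : ℝ) ^ 2 := by positivity
  have hG0 : 0 ≤ G := (norm_nonneg _).trans (hG t le_rfl)
  have hcont : Continuous fun s => Real.exp (arate k s) * tcut k s := by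
    have h1 := continuous_arate k
    have h2 := continuous_tcut k
    fun_prop
  have h1 : ‖∫ s in (0 : ℝ)..t, ((Real.exp (arate k s) * tcut k s : ℝ) : ℂ) * g s‖
      ≤ |∫ s in (0 : ℝ)..t, Real.exp (arate k s) * tcut k s * G| := by
    apply intervalIntegral.norm_integral_le_abs_of_norm_le
    · refine (ae_restrict_iff' measurableSet_uIoc).mpr <| Filter.Eventually.of_forall fun s hs => ?_
      rw [norm_mul, Complex.norm_real, Real.norm_of_nonneg
        (mul_nonneg (Real.exp_pos _).le (tcut_nonneg k s))]
      exact mul_le_mul_of_nonneg_left (hG s (abs_le_of_mem_uIoc hs))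
        (mul_nonneg (Real.exp_pos _).le (tcut_nonneg k s))
    · exact (hcont.mul_const _).intervalIntegrable _ _
  have h2 : ∫ s in (0 : ℝ)..t, Real.exp (arate k s) * tcut k s
      = (Real.exp (arate k t) - 1) * (4 / (k : ℝ) ^ 2) := by
    have := intervalIntegral.integral_eq_sub_of_hasDerivAt
      (f := fun s => Real.exp (arate k s) * (4 / (k : ℝ) ^ 2))
      (f' := fun s => Real.exp (arate k s) * tcut k s) (a := 0) (b := t)
      (fun s _ => by
        refine ((hasDerivAt_arate k s).exp.mul_const _).congr_deriv ?_
        field_simp) (hcont.intervalIntegrable _ _)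
    rw [this, arate_zero, Real.exp_zero]; ring
  rw [intervalIntegral.integral_mul_const, h2] at h1
  unfold duh
  rw [norm_mul, Complex.norm_real, Real.norm_of_nonneg (Real.exp_pos _).le]
  have h3 := exp_neg_arate_le k t
  have h4 : Real.exp (-arate k t) * Real.exp (arate k t) = 1 := by
    rw [← Real.exp_add]; simp
  calc _ ≤ Real.exp (-arate k t) * |(Real.exp (arate k t) - 1) * (4 / (k : ℝ) ^ 2) * G| := by gcongr
    _ = |1 - Real.exp (-arate k t)| * (4 / (k : ℝ) ^ 2) * G := by
      rw [abs_mul, abs_mul, abs_of_nonneg hG0, abs_of_pos (a := 4 / (k : ℝ) ^ 2) (by positivity),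
        ← mul_assoc, ← mul_assoc]
      congr 2
      rw [← abs_of_pos (Real.exp_pos (-arate k t)), ← abs_mul, mul_sub,
        abs_of_pos (Real.exp_pos (-arate k t)), h4, mul_one]
    _ ≤ 2 * (4 / (k : ℝ) ^ 2) * G := by
      gcongr
      rw [abs_le]; constructor <;> linarith [Real.exp_pos (-arate k t)]
    _ = _ := by ring

lemma norm_duh_le_lam (k : ℤ) {g : ℝ → ℂ} {G t lam : ℝ} (hlam : 0 < lam) (hG0 : 0 ≤ G)
    (hG : ∀ s, |s| ≤ |t| → ‖g s‖ ≤ G * Real.exp (lam * |s|)) :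
    ‖duh k g t‖ ≤ G * Real.exp (lam * |t|) * (3 / lam) := by
  have hexp : ∀ s ∈ Set.uIoc 0 t, Real.exp (-arate k t) * Real.exp (arate k s) ≤ 3 := by
    intro s hs
    rw [← Real.exp_add]
    refine le_trans (Real.exp_le_exp.mpr ?_) (by linarith [Real.exp_one_lt_d9] : Real.exp 1 ≤ 3)
    rcases le_total 0 t with ht | ht
    · rw [Set.uIoc_of_le ht] at hs
      linarith [arate_mono k hs.2]
    · rw [Set.uIoc_of_ge ht] at hs
      have := arate_mono k hs.2
      rw [arate_zero] at this
      linarith [arate_ge k t]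
  have h0 : duh k g t = ∫ s in (0 : ℝ)..t,
      ((Real.exp (-arate k t) * Real.exp (arate k s) * tcut k s : ℝ) : ℂ) * g s := by
    unfold duh
    rw [← intervalIntegral.integral_const_mul]
    congr 1; ext s; push_cast; ring
  have h1 : ‖duh k g t‖ ≤ |∫ s in (0 : ℝ)..t, 3 * (G * Real.exp (lam * |s|))| := by
    rw [h0]
    apply intervalIntegral.norm_integral_le_abs_of_norm_le
    · refine (ae_restrict_iff' measurableSet_uIoc).mpr <| Filter.Eventually.of_forall fun s hs => ?_
      have hnn : 0 ≤ Real.exp (-arate k t) * Real.exp (arate k s) * tcut k s :=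
        mul_nonneg (mul_pos (Real.exp_pos _) (Real.exp_pos _)).le (tcut_nonneg k s)
      rw [norm_mul, Complex.norm_real, Real.norm_of_nonneg hnn]
      have h3 : Real.exp (-arate k t) * Real.exp (arate k s) * tcut k s ≤ 3 := by
        nlinarith [hexp s hs, tcut_nonneg k s, tcut_le_one k s,
          mul_pos (Real.exp_pos (-arate k t)) (Real.exp_pos (arate k s))]
      exact mul_le_mul h3 (hG s (abs_le_of_mem_uIoc hs)) (norm_nonneg _) (by norm_num)
    · exact (by fun_prop : Continuous fun s => 3 * (G * Real.exp (lam * |s|))).intervalIntegrable _ _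
  have h2 : |∫ s in (0 : ℝ)..t, Real.exp (lam * |s|)| = (Real.exp (lam * |t|) - 1) / lam := by
    rcases le_total 0 t with ht | ht
    · have : ∫ s in (0 : ℝ)..t, Real.exp (lam * |s|) = ∫ s in (0 : ℝ)..t, Real.exp (lam * s) := by
        apply intervalIntegral.integral_congr
        intro s hs
        rw [Set.uIcc_of_le ht] at hs
        simp only [abs_of_nonneg hs.1]
      rw [this, abs_of_nonneg ht, intervalIntegral.integral_comp_mul_left _ hlam.ne', integral_exp,
        abs_of_nonneg]
      · simp [div_eq_inv_mul]
      · have : 1 ≤ Real.exp (lam * t) := Real.one_le_exp (by positivity)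
        simp only [mul_zero, Real.exp_zero, smul_eq_mul]
        have := inv_pos.mpr hlam
        nlinarith
    · have : ∫ s in (0 : ℝ)..t, Real.exp (lam * |s|) = ∫ s in (0 : ℝ)..t, Real.exp (-lam * s) := by
        apply intervalIntegral.integral_congr
        intro s hs
        rw [Set.uIcc_of_ge ht] at hs
        simp only [abs_of_nonpos hs.2]
        congr 1; ring
      rw [this, abs_of_nonpos ht, intervalIntegral.integral_comp_mul_left _ (neg_ne_zero.mpr hlam.ne'),
        integral_exp, abs_of_nonpos]
      · simp [div_eq_inv_mul]
      · have : 1 ≤ Real.exp (-lam * t) := Real.one_le_exp (by nlinarith)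
        simp only [mul_zero, Real.exp_zero, smul_eq_mul, inv_neg]
        have := inv_pos.mpr hlam
        nlinarith
  rw [intervalIntegral.integral_const_mul, intervalIntegral.integral_const_mul, abs_mul, abs_mul, h2,
    abs_of_nonneg hG0, abs_of_pos (by norm_num : (0 : ℝ) < 3)] at h1
  refine h1.trans ?_
  have : (Real.exp (lam * |t|) - 1) / lam ≤ Real.exp (lam * |t|) / lam := by
    gcongr; linarith
  calc 3 * (G * ((Real.exp (lam * |t|) - 1) / lam)) ≤ 3 * (G * (Real.exp (lam * |t|) / lam)) := by
        gcongr
    _ = _ := by ring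

lemma norm_duh_le (k : ℤ) {g : ℝ → ℂ} {G t lam : ℝ} (hlam : 1 ≤ lam) (hG0 : 0 ≤ G)
    (hG : ∀ s, |s| ≤ |t| → ‖g s‖ ≤ G * Real.exp (lam * |s|)) :
    ‖duh k g t‖ ≤ G * Real.exp (lam * |t|) * (16 / (√lam * wt k)) := by
  have hl0 : 0 < lam := by linarith
  have h1 := norm_duh_le_lam k hl0 hG0 hG
  have hsq : √lam * √lam = lam := Real.mul_self_sqrt hl0.le
  have hs1 : 1 ≤ √lam := Real.one_le_sqrt.mpr hlam
  have hA : 0 ≤ G * Real.exp (lam * |t|) := by positivity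
  have hwt := wt_pos k
  by_cases hk : k = 0
  · refine h1.trans (mul_le_mul_of_nonneg_left ?_ hA)
    rw [div_le_div_iff₀ hl0 (by positivity)]
    simp only [hk, wt, Int.cast_zero, abs_zero]
    nlinarith
  have h2 : ‖duh k g t‖ ≤ G * Real.exp (lam * |t|) * (8 / (k : ℝ) ^ 2) :=
    norm_duh_le_sq k hk fun s hs => (hG s hs).trans (by gcongr)
  have hk1 : 1 ≤ |(k : ℝ)| := by exact_mod_cast Int.one_le_abs hk
  rw [← sq_abs] at h2
  rcases le_total |(k : ℝ)| (√lam) with h | h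
  · refine h1.trans (mul_le_mul_of_nonneg_left ?_ hA)
    rw [div_le_div_iff₀ hl0 (by positivity)]
    unfold wt
    nlinarith
  · refine h2.trans (mul_le_mul_of_nonneg_left ?_ hA)
    rw [div_le_div_iff₀ (by positivity) (by positivity)]
    unfold wt
    nlinarith

lemma norm_duh_le_wt_sq (k : ℤ) {g : ℝ → ℂ} {G t : ℝ}
    (hG : ∀ s, |s| ≤ |t| → ‖g s‖ ≤ G) :
    ‖duh k g t‖ ≤ G * Real.exp |t| * (32 / wt k ^ 2) := by
  have hwt := wt_pos k
  have hG0 : 0 ≤ G := (norm_nonneg _).trans (hG t le_rfl)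
  by_cases hk : k = 0
  · have := norm_duh_le_lam k (g := g) (t := t) one_pos hG0 (fun s hs => (hG s hs).trans
      (le_mul_of_one_le_right hG0 (Real.one_le_exp (by positivity))))
    refine this.trans ?_
    rw [one_mul]
    refine mul_le_mul_of_nonneg_left ?_ (by positivity)
    subst hk
    norm_num [wt]
  · have h := norm_duh_le_sq k hk hG
    have hk1 : 1 ≤ |(k : ℝ)| := by exact_mod_cast Int.one_le_abs hk
    refine h.trans ?_
    have : 8 / (k : ℝ) ^ 2 ≤ 32 / wt k ^ 2 := by
      rw [← sq_abs, div_le_div_iff₀ (by positivity) (by positivity)]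
      unfold wt
      nlinarith
    calc G * (8 / (k : ℝ) ^ 2) ≤ G * (32 / wt k ^ 2) := by gcongr
      _ ≤ G * Real.exp |t| * (32 / wt k ^ 2) := by
        gcongr
        exact le_mul_of_one_le_right hG0 (Real.one_le_exp (by positivity))

section
open scoped BoundedContinuousFunction

lemma bco_neg (k j : ℤ) : bco (-k) (-j) = bco k j := by
  unfold bco
  push_cast
  rw [show (-(k : ℝ) + -j) = -((k : ℝ) + j) by ring, show 2 * -(j : ℝ) = -(2 * j) by ring, neg_div_neg_eq]

lemma Bq_conj_neg (c d : ℤ → ℂ) (k : ℤ) :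
    Bq (fun j => starRingEnd ℂ (c (-j))) (fun j => starRingEnd ℂ (d (-j))) k
      = starRingEnd ℂ (Bq c d (-k)) := by
  unfold Bq
  rw [Complex.conj_tsum, ← (Equiv.neg ℤ).tsum_eq]
  refine tsum_congr fun j => ?_
  simp only [Equiv.neg_apply, map_mul, Complex.conj_ofReal, neg_neg]
  rw [← bco_neg k (-j), neg_neg]
  congr 3
  ring

/-- The truncated nonlinearity. -/
noncomputable def Bclip (R : ℝ) (c : ℤ → ℂ) (k : ℤ) : ℂ :=
  Bq (fun j => clipC (R / wt j) (c j)) (fun j => clipC (R / wt j) (c j)) k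

lemma clip_bound {R : ℝ} (hR : 0 < R) (c : ℤ → ℂ) (j : ℤ) :
    ‖clipC (R / wt j) (c j)‖ ≤ 4 * R / wt j ^ (0 + 1) := by
  refine (norm_clipC_le_four (div_pos hR (wt_pos j)) _).trans (le_of_eq ?_)
  ring

lemma norm_Bclip_le {R : ℝ} (hR : 0 < R) (c : ℤ → ℂ) (k : ℤ) :
    ‖Bclip R c k‖ ≤ convK * (4 * R) * (4 * R) := by
  have := norm_Bq_le (clip_bound hR c) (clip_bound hR c) k
  simpa [Bclip] using this

lemma Bclip_sub_le {L : ℝ} (hL0 : 0 < L) (hL : ∀ x y, |clip1 x - clip1 y| ≤ L * |x - y|)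
    {R : ℝ} (hR : 0 < R) {c d : ℤ → ℂ} {D : ℝ} (hD : ∀ j, ‖c j - d j‖ ≤ D / wt j) (k : ℤ) :
    ‖Bclip R c k - Bclip R d k‖ ≤ (convK * (4 * R) * (2 * L) * 2) * D := by
  set x := fun j => clipC (R / wt j) (c j) with hx
  set y := fun j => clipC (R / wt j) (d j) with hy
  have hxb := clip_bound hR c
  have hyb := clip_bound hR d
  have hxy : ∀ j, ‖x j - y j‖ ≤ 2 * L * D / wt j ^ (0 + 1) := fun j => by
    refine (norm_clipC_sub_le hL0 hL (div_pos hR (wt_pos j)) _ _).trans ?_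
    calc 2 * L * ‖c j - d j‖ ≤ 2 * L * (D / wt j) := by gcongr; exact hD j
      _ = _ := by ring
  have h : Bclip R c k - Bclip R d k = Bq (fun j => x j - y j) x k + Bq y (fun j => x j - y j) k := by
    unfold Bclip Bq
    rw [← (summable_Bq hxb hxb k).tsum_sub (summable_Bq hyb hyb k),
      ← (summable_Bq hxy hxb k).tsum_add (summable_Bq hyb hxy k)]
    refine tsum_congr fun j => ?_
    simp only [hx, hy]
    ring
  rw [h]
  refine (norm_add_le _ _).trans ?_
  have h1 := norm_Bq_le hxy hxb k
  have h2 := norm_Bq_le hyb hxy k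
  simp only [pow_zero, div_one] at h1 h2
  linarith

lemma continuous_Bclip {R : ℝ} (hR : 0 < R) {c : ℤ → ℝ → ℂ} (hc : ∀ k, Continuous (c k)) (k : ℤ) :
    Continuous fun t => Bclip R (fun j => c j t) k := by
  unfold Bclip Bq
  refine continuous_tsum (u := fun j => 4 * R * (4 * R) / wt k ^ 0 * convM k j) (fun j => ?_)
    ((summable_convM k).mul_left _)
    (fun j t => norm_Bq_term_le (clip_bound hR fun j => c j t) (clip_bound hR fun j => c j t) k j)
  exact (continuous_const.mul ((continuous_clipC _).comp (hc j))).mul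
    ((continuous_clipC _).comp (hc (k - j)))

lemma Bclip_conj_neg (R : ℝ) (c : ℤ → ℂ) (k : ℤ) :
    Bclip R (fun j => starRingEnd ℂ (c (-j))) k = starRingEnd ℂ (Bclip R c (-k)) := by
  unfold Bclip
  rw [← Bq_conj_neg]
  simp only [clipC_conj, wt_neg]

lemma duh_conj (k : ℤ) (g : ℝ → ℂ) (t : ℝ) :
    duh k (fun s => starRingEnd ℂ (g s)) t = starRingEnd ℂ (duh k g t) := by
  unfold duh
  rw [map_mul, Complex.conj_ofReal, intervalIntegral, intervalIntegral, map_sub, ← integral_conj,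
    ← integral_conj]
  simp only [map_mul, Complex.conj_ofReal]

lemma duh_neg_index (k : ℤ) (g : ℝ → ℂ) (t : ℝ) : duh (-k) g t = duh k g t := by
  unfold duh
  rw [arate_neg, tcut_neg]

/-- Sequences of functions of time with weight `e^{λ|t|} / (1 + |k|)`. -/
noncomputable def wseq (lam : ℝ) (f : ℤ × ℝ →ᵇ ℂ) (k : ℤ) (t : ℝ) : ℂ :=
  (Real.exp (lam * |t|) / wt k : ℝ) * f (k, t)

lemma continuous_wseq (lam : ℝ) (f : ℤ × ℝ →ᵇ ℂ) (k : ℤ) : Continuous (wseq lam f k) := by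
  unfold wseq
  have : Continuous fun t : ℝ => f (k, t) := f.continuous.comp (by fun_prop)
  fun_prop

lemma mild_bound (lam : ℝ) (hlam : 1 ≤ lam) {R C0 : ℝ} (hR : 0 < R) {c0 : ℤ → ℂ}
    (hc0 : ∀ k, ‖c0 k‖ ≤ C0 / wt k) (f : ℤ × ℝ →ᵇ ℂ) (k : ℤ) (t : ℝ) :
    ‖((wt k * Real.exp (-(lam * |t|)) : ℝ) : ℂ) * ((Real.exp (-arate k t) : ℂ) * c0 k
      + duh k (fun s => Bclip R (fun j => wseq lam f j s) k) t)‖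
      ≤ 3 * C0 + convK * (4 * R) * (4 * R) * 16 := by
  have hw := wt_pos k
  have hC0 : 0 ≤ C0 := by
    have := (norm_nonneg _).trans (hc0 0)
    simpa [wt] using this
  have hK := convK_nonneg
  rw [norm_mul, Complex.norm_real, Real.norm_of_nonneg (by positivity)]
  have h1 : ‖(Real.exp (-arate k t) : ℂ) * c0 k‖ ≤ 3 * (C0 / wt k) := by
    rw [norm_mul, Complex.norm_real, Real.norm_of_nonneg (Real.exp_pos _).le]
    exact mul_le_mul (exp_neg_arate_le k t) (hc0 k) (norm_nonneg _) (by norm_num)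
  have h2 := norm_duh_le k (g := fun s => Bclip R (fun j => wseq lam f j s) k) (t := t)
    (G := convK * (4 * R) * (4 * R)) hlam (by positivity) (fun s _ =>
      (norm_Bclip_le hR _ k).trans (le_mul_of_one_le_right (by positivity)
        (Real.one_le_exp (by positivity))))
  have hs1 : 1 ≤ √lam := Real.one_le_sqrt.mpr hlam
  have hE : Real.exp (-(lam * |t|)) * Real.exp (lam * |t|) = 1 := by rw [← Real.exp_add]; simp
  have hE1 : Real.exp (-(lam * |t|)) ≤ 1 := by
    rw [Real.exp_le_one_iff]; have : 0 ≤ lam * |t| := by positivity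
    linarith
  calc _ ≤ wt k * Real.exp (-(lam * |t|)) * (3 * (C0 / wt k) + convK * (4 * R) * (4 * R)
        * Real.exp (lam * |t|) * (16 / (√lam * wt k))) := by
        gcongr
        exact (norm_add_le _ _).trans (add_le_add h1 h2)
    _ = Real.exp (-(lam * |t|)) * (3 * C0) + (Real.exp (-(lam * |t|)) * Real.exp (lam * |t|)) *
        (convK * (4 * R) * (4 * R) * (16 / √lam)) := by
        field_simp
    _ ≤ 1 * (3 * C0) + 1 * (convK * (4 * R) * (4 * R) * (16 / 1)) := by
        rw [hE]
        gcongr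
    _ = _ := by ring

/-- The fixed point map for the mild formulation. -/
noncomputable def mildMap (lam : ℝ) (hlam : 1 ≤ lam) {R C0 : ℝ} (hR : 0 < R) {c0 : ℤ → ℂ}
    (hc0 : ∀ k, ‖c0 k‖ ≤ C0 / wt k) (f : ℤ × ℝ →ᵇ ℂ) : ℤ × ℝ →ᵇ ℂ :=
  BoundedContinuousFunction.ofNormedAddCommGroup
    (fun p => ((wt p.1 * Real.exp (-(lam * |p.2|)) : ℝ) : ℂ) * ((Real.exp (-arate p.1 p.2) : ℂ) * c0 p.1
      + duh p.1 (fun s => Bclip R (fun j => wseq lam f j s) p.1) p.2))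
    (by
      rw [continuous_prod_of_discrete_left]
      intro k
      have h1 := continuous_duh k (continuous_Bclip hR (continuous_wseq lam f) k)
      have h2 := continuous_arate k
      dsimp only
      fun_prop)
    (3 * C0 + convK * (4 * R) * (4 * R) * 16)
    (fun p => mild_bound lam hlam hR hc0 f p.1 p.2)

lemma mildMap_apply (lam : ℝ) (hlam : 1 ≤ lam) {R C0 : ℝ} (hR : 0 < R) {c0 : ℤ → ℂ}
    (hc0 : ∀ k, ‖c0 k‖ ≤ C0 / wt k) (f : ℤ × ℝ →ᵇ ℂ) (k : ℤ) (t : ℝ) :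
    mildMap lam hlam hR hc0 f (k, t) = ((wt k * Real.exp (-(lam * |t|)) : ℝ) : ℂ) *
      ((Real.exp (-arate k t) : ℂ) * c0 k
      + duh k (fun s => Bclip R (fun j => wseq lam f j s) k) t) := rfl

lemma mildMap_dist_le {L : ℝ} (hL0 : 0 < L) (hL : ∀ x y, |clip1 x - clip1 y| ≤ L * |x - y|)
    (lam : ℝ) (hlam : 1 ≤ lam) {R C0 : ℝ} (hR : 0 < R) {c0 : ℤ → ℂ}
    (hc0 : ∀ k, ‖c0 k‖ ≤ C0 / wt k) (f g : ℤ × ℝ →ᵇ ℂ) :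
    dist (mildMap lam hlam hR hc0 f) (mildMap lam hlam hR hc0 g)
      ≤ (convK * (4 * R) * (2 * L) * 2 * 16 / √lam) * dist f g := by
  have hK := convK_nonneg
  have hs1 : 1 ≤ √lam := Real.one_le_sqrt.mpr hlam
  refine (BoundedContinuousFunction.dist_le (by positivity)).mpr ?_
  rintro ⟨k, t⟩
  have hw := wt_pos k
  rw [mildMap_apply, mildMap_apply, dist_eq_norm, ← mul_sub, add_sub_add_left_eq_sub,
    duh_sub k (continuous_Bclip hR (continuous_wseq lam f) k)
      (continuous_Bclip hR (continuous_wseq lam g) k),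
    norm_mul, Complex.norm_real, Real.norm_of_nonneg (by positivity)]
  have h2 := norm_duh_le k (g := fun s => Bclip R (fun j => wseq lam f j s) k
      - Bclip R (fun j => wseq lam g j s) k) (t := t)
    (G := (convK * (4 * R) * (2 * L) * 2) * dist f g) hlam (by positivity) (fun s _ => by
      rw [mul_assoc _ (dist f g)]
      refine Bclip_sub_le hL0 hL hR (fun j => ?_) k
      unfold wseq
      rw [← mul_sub, norm_mul, Complex.norm_real, Real.norm_of_nonneg
        (div_pos (Real.exp_pos _) (wt_pos j)).le, ← dist_eq_norm, div_mul_eq_mul_div, mul_comm]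
      have := BoundedContinuousFunction.dist_coe_le_dist (f := f) (g := g) (j, s)
      have hwj := wt_pos j
      gcongr)
  have hE : Real.exp (-(lam * |t|)) * Real.exp (lam * |t|) = 1 := by rw [← Real.exp_add]; simp
  calc _ ≤ wt k * Real.exp (-(lam * |t|)) * ((convK * (4 * R) * (2 * L) * 2) * dist f g
        * Real.exp (lam * |t|) * (16 / (√lam * wt k))) := by
        gcongr
    _ = (Real.exp (-(lam * |t|)) * Real.exp (lam * |t|)) * ((convK * (4 * R) * (2 * L) * 2 * 16 / √lam)
        * dist f g) := by
        field_simp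
    _ = _ := by rw [hE, one_mul]

/-- Existence of a mild solution of the truncated system, for all real times. -/
lemma exists_mild {R C0 : ℝ} (hR : 0 < R) {c0 : ℤ → ℂ} (hc0 : ∀ k, ‖c0 k‖ ≤ C0 / wt k)
    (hconj : ∀ k, c0 (-k) = starRingEnd ℂ (c0 k)) :
    ∃ c : ℤ → ℝ → ℂ, (∀ k, Continuous (c k)) ∧ (∀ k t, c (-k) t = starRingEnd ℂ (c k t)) ∧
      (∀ T, ∃ C, ∀ k t, |t| ≤ T → ‖c k t‖ ≤ C / wt k) ∧
      ∀ k t, c k t = (Real.exp (-arate k t) : ℂ) * c0 k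
        + duh k (fun s => Bclip R (fun j => c j s) k) t := by
  obtain ⟨L, hL0, hL⟩ := exists_lipschitz_clip1
  have hK := convK_nonneg
  set Q := convK * (4 * R) * (2 * L) * 2 * 16 with hQ
  have hQ0 : 0 ≤ Q := by positivity
  set lam := (2 * Q + 1) ^ 2 with hlamdef
  have hlam : 1 ≤ lam := by rw [hlamdef]; nlinarith
  have hsq : √lam = 2 * Q + 1 := Real.sqrt_sq (by positivity)
  have hq : Q / √lam ≤ 1 / 2 := by
    rw [hsq, div_le_div_iff₀ (by positivity) (by norm_num)]; linarith
  have hcontr : ContractingWith (1 / 2) (mildMap lam hlam hR hc0) := by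
    refine ⟨by
      rw [← NNReal.coe_lt_coe]; norm_num, LipschitzWith.of_dist_le_mul fun f g => ?_⟩
    refine (mildMap_dist_le hL0 hL lam hlam hR hc0 f g).trans ?_
    rw [← hQ]
    push_cast
    gcongr
  set f := hcontr.fixedPoint (mildMap lam hlam hR hc0) with hf
  have hfix : mildMap lam hlam hR hc0 f = f := hcontr.fixedPoint_isFixedPt
  have hmild : ∀ k t, wseq lam f k t = (Real.exp (-arate k t) : ℂ) * c0 k
        + duh k (fun s => Bclip R (fun j => wseq lam f j s) k) t := by
    intro k t
    have h1 : f (k, t) = _ := (congrArg (fun F => F (k, t)) hfix).symm.trans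
      (mildMap_apply lam hlam hR hc0 f k t)
    have hE : Real.exp (lam * |t|) / wt k * (wt k * Real.exp (-(lam * |t|))) = 1 := by
      have := wt_pos k
      rw [div_mul_eq_mul_div, mul_left_comm, ← Real.exp_add]
      simp [this.ne']
    conv_lhs => unfold wseq
    rw [h1, ← mul_assoc, ← Complex.ofReal_mul, hE, Complex.ofReal_one, one_mul]
  refine ⟨wseq lam f, continuous_wseq lam f, ?_, ?_, hmild⟩
  · set f' : ℤ × ℝ →ᵇ ℂ := BoundedContinuousFunction.ofNormedAddCommGroup
      (fun p => starRingEnd ℂ (f (-p.1, p.2))) (by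
        have := f.continuous
        rw [continuous_prod_of_discrete_left]
        intro k
        exact Complex.continuous_conj.comp (this.comp (by fun_prop))) ‖f‖ (fun p => by
          rw [Complex.norm_conj]; exact f.norm_coe_le_norm _) with hf'
    have hf'a : ∀ k t, f' (k, t) = starRingEnd ℂ (f (-k, t)) := fun k t => rfl
    have hw' : ∀ k t, wseq lam f' k t = starRingEnd ℂ (wseq lam f (-k) t) := by
      intro k t
      unfold wseq
      rw [hf'a, map_mul, Complex.conj_ofReal, wt_neg]
    have hfix' : mildMap lam hlam hR hc0 f' = f' := by
      ext ⟨k, t⟩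
      rw [mildMap_apply, hf'a]
      have h1 : f (-k, t) = _ := (congrArg (fun F => F (-k, t)) hfix).symm.trans
        (mildMap_apply lam hlam hR hc0 f (-k) t)
      rw [h1, map_mul, Complex.conj_ofReal, map_add, map_mul, Complex.conj_ofReal, wt_neg, arate_neg,
        hconj k, Complex.conj_conj, duh_neg_index, ← duh_conj]
      have hB : (fun s => Bclip R (fun j => wseq lam f' j s) k)
          = fun s => starRingEnd ℂ (Bclip R (fun j => wseq lam f j s) (-k)) := by
        funext s
        simp only [hw']
        exact Bclip_conj_neg R (fun j => wseq lam f j s) k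
      rw [hB]
    have heq : f' = f := hcontr.fixedPoint_unique hfix'
    intro k t
    rw [← Complex.conj_conj (wseq lam f (-k) t), ← hw', heq]
  · intro T
    refine ⟨Real.exp (lam * T) * ‖f‖, fun k t ht => ?_⟩
    have hw := wt_pos k
    unfold wseq
    rw [norm_mul, Complex.norm_real, Real.norm_of_nonneg (by positivity), div_mul_eq_mul_div]
    gcongr
    exact f.norm_coe_le_norm _

/-- Mild solutions with rapidly decaying data decay rapidly, locally uniformly in time. -/
lemma mild_decay {R : ℝ} (hR : 0 < R) {c0 : ℤ → ℂ}
    (hc0 : ∀ n : ℕ, ∃ C, ∀ k, ‖c0 k‖ ≤ C / wt k ^ n) {c : ℤ → ℝ → ℂ}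
    (hcb : ∀ T, ∃ C, ∀ k t, |t| ≤ T → ‖c k t‖ ≤ C / wt k)
    (hmild : ∀ k t, c k t = (Real.exp (-arate k t) : ℂ) * c0 k
        + duh k (fun s => Bclip R (fun j => c j s) k) t) (n : ℕ) :
    ∀ T, ∃ C, ∀ k t, |t| ≤ T → ‖c k t‖ ≤ C / wt k ^ (n + 1) := by
  induction n with
  | zero => simpa using hcb
  | succ n ih =>
    intro T
    obtain ⟨C, hC⟩ := ih T
    obtain ⟨C0, hC0⟩ := hc0 (n + 1 + 1)
    refine ⟨3 * C0 + convK * (2 * C) * (2 * C) * Real.exp T * 32, fun k t ht => ?_⟩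
    have hw := wt_pos k
    have hK := convK_nonneg
    have hB : ∀ s, |s| ≤ |t| → ‖Bclip R (fun j => c j s) k‖ ≤ convK * (2 * C) * (2 * C) / wt k ^ n := by
      intro s hs
      have : ∀ j, ‖clipC (R / wt j) (c j s)‖ ≤ 2 * C / wt j ^ (n + 1) := fun j => by
        refine (norm_clipC_le (div_pos hR (wt_pos j)) _).trans ?_
        rw [mul_div_assoc]
        have := hC j s (hs.trans ht)
        linarith
      exact norm_Bq_le this this k
    have h2 := norm_duh_le_wt_sq k hB
    have h1 : ‖(Real.exp (-arate k t) : ℂ) * c0 k‖ ≤ 3 * (C0 / wt k ^ (n + 1 + 1)) := by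
      rw [norm_mul, Complex.norm_real, Real.norm_of_nonneg (Real.exp_pos _).le]
      exact mul_le_mul (exp_neg_arate_le k t) (hC0 k) (norm_nonneg _) (by norm_num)
    have h3 : convK * (2 * C) * (2 * C) / wt k ^ n * Real.exp |t| * (32 / wt k ^ 2)
        ≤ convK * (2 * C) * (2 * C) / wt k ^ n * Real.exp T * (32 / wt k ^ 2) := by
      have : 0 ≤ convK * (2 * C) * (2 * C) := by nlinarith [sq_nonneg C]
      gcongr
    rw [hmild]
    refine (norm_add_le _ _).trans ((add_le_add h1 (h2.trans h3)).trans (le_of_eq ?_))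
    field_simp
    ring

end

section TwoVar
variable {E : Type*} [NormedAddCommGroup E] [NormedSpace ℝ E]

/-- Smoothness of a function of two real variables. -/
def Sm (f : ℝ → ℝ → E) : Prop := ContDiff ℝ (⊤ : ℕ∞) (fun p : ℝ × ℝ => f p.1 p.2)

lemma sm_iff {f : ℝ → ℝ → E} :
    Sm f ↔ ∀ n : ℕ, ContDiff ℝ n (fun p : ℝ × ℝ => f p.1 p.2) := contDiff_infty

lemma hasFDerivAt_of_partials {f fx ft : ℝ → ℝ → E}
    (hx : ∀ x t, HasDerivAt (fun y => f y t) (fx x t) x)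
    (ht : ∀ x t, HasDerivAt (fun s => f x s) (ft x t) t)
    (cx : Continuous fun p : ℝ × ℝ => fx p.1 p.2) (ct : Continuous fun p : ℝ × ℝ => ft p.1 p.2)
    (p : ℝ × ℝ) :
    HasFDerivAt (fun p : ℝ × ℝ => f p.1 p.2)
      ((ContinuousLinearMap.fst ℝ ℝ ℝ).smulRight (fx p.1 p.2)
        + (ContinuousLinearMap.snd ℝ ℝ ℝ).smulRight (ft p.1 p.2)) p := by
  have h := hasStrictFDerivAt_uncurry_coprod (𝕜 := ℝ) (u := p) (f := f)
    (f₁ := fun x t => ContinuousLinearMap.toSpanSingleton ℝ (fx x t))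
    (f₂ := fun x t => ContinuousLinearMap.toSpanSingleton ℝ (ft x t))
    (Filter.Eventually.of_forall fun v => (hx v.1 v.2).hasFDerivAt)
    (Filter.Eventually.of_forall fun v => (ht v.1 v.2).hasFDerivAt)
    ((ContinuousLinearMap.toSpanSingletonCLE (𝕜 := ℝ) (E := E)).continuous.comp cx).continuousAt
    ((ContinuousLinearMap.toSpanSingletonCLE (𝕜 := ℝ) (E := E)).continuous.comp ct).continuousAt
  refine h.hasFDerivAt.congr_fderiv ?_
  ext <;> simp [Function.HasUncurry.uncurry]

lemma contDiff_succ_of_partials {n : ℕ} {f fx ft : ℝ → ℝ → E}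
    (hx : ∀ x t, HasDerivAt (fun y => f y t) (fx x t) x)
    (ht : ∀ x t, HasDerivAt (fun s => f x s) (ft x t) t)
    (cx : ContDiff ℝ n fun p : ℝ × ℝ => fx p.1 p.2)
    (ct : ContDiff ℝ n fun p : ℝ × ℝ => ft p.1 p.2) :
    ContDiff ℝ (n + 1 : ℕ) fun p : ℝ × ℝ => f p.1 p.2 := by
  rw [Nat.cast_succ, contDiff_succ_iff_hasFDerivAt]
  refine ⟨_, ?_, hasFDerivAt_of_partials hx ht cx.continuous ct.continuous⟩
  exact (contDiff_const.smulRight cx).add (contDiff_const.smulRight ct)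

/-- Partial derivative in the first variable. -/
noncomputable def dx (f : ℝ → ℝ → E) (x t : ℝ) : E := deriv (fun y => f y t) x

/-- Partial derivative in the second variable. -/
noncomputable def dt (f : ℝ → ℝ → E) (x t : ℝ) : E := deriv (fun s => f x s) t

variable {f : ℝ → ℝ → E}

lemma Sm.contDiff_left (hf : Sm f) (t : ℝ) : ContDiff ℝ (⊤ : ℕ∞) (fun y => f y t) :=
  ContDiff.comp (g := fun p : ℝ × ℝ => f p.1 p.2) hf (contDiff_id.prodMk contDiff_const)

lemma Sm.contDiff_right (hf : Sm f) (x : ℝ) : ContDiff ℝ (⊤ : ℕ∞) (fun s => f x s) :=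
  ContDiff.comp (g := fun p : ℝ × ℝ => f p.1 p.2) hf (contDiff_const.prodMk contDiff_id)

lemma Sm.hasDerivAt_x (hf : Sm f) (x t : ℝ) : HasDerivAt (fun y => f y t) (dx f x t) x :=
  ((hf.contDiff_left t).differentiable (by simp) x).hasDerivAt

lemma Sm.hasDerivAt_t (hf : Sm f) (x t : ℝ) : HasDerivAt (fun s => f x s) (dt f x t) t :=
  ((hf.contDiff_right x).differentiable (by simp) t).hasDerivAt

lemma Sm.hasFDerivAt (hf : Sm f) (p : ℝ × ℝ) : HasFDerivAt (fun p : ℝ × ℝ => f p.1 p.2)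
    (fderiv ℝ (fun p : ℝ × ℝ => f p.1 p.2) p) p :=
  (ContDiff.differentiable hf (by simp) p).hasFDerivAt

lemma Sm.dx_eq (hf : Sm f) (x t : ℝ) :
    dx f x t = fderiv ℝ (fun p : ℝ × ℝ => f p.1 p.2) (x, t) (1, 0) := by
  have h := (hf.hasFDerivAt (x, t)).comp_hasDerivAt x
    ((hasDerivAt_id x).prodMk (hasDerivAt_const x t))
  exact h.deriv

lemma Sm.dt_eq (hf : Sm f) (x t : ℝ) :
    dt f x t = fderiv ℝ (fun p : ℝ × ℝ => f p.1 p.2) (x, t) (0, 1) := by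
  have h := (hf.hasFDerivAt (x, t)).comp_hasDerivAt t
    ((hasDerivAt_const t x).prodMk (hasDerivAt_id t))
  exact h.deriv

lemma Sm.fderiv (hf : Sm f) : ContDiff ℝ (⊤ : ℕ∞) (_root_.fderiv ℝ (fun p : ℝ × ℝ => f p.1 p.2)) :=
  ContDiff.fderiv_right (m := (⊤ : ℕ∞)) hf (by simp)

lemma Sm.dx (hf : Sm f) : Sm (dx f) := by
  unfold Sm
  simp only [hf.dx_eq]
  exact hf.fderiv.clm_apply contDiff_const

lemma Sm.dt (hf : Sm f) : Sm (dt f) := by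
  unfold Sm
  simp only [hf.dt_eq]
  exact hf.fderiv.clm_apply contDiff_const

lemma Sm.dt_dx (hf : Sm f) (x t : ℝ) :
    AffineFlow.dt (AffineFlow.dx f) x t = AffineFlow.dx (AffineFlow.dt f) x t := by
  set F := fun p : ℝ × ℝ => f p.1 p.2 with hF
  have hd : HasFDerivAt (_root_.fderiv ℝ F) (_root_.fderiv ℝ (_root_.fderiv ℝ F) (x, t)) (x, t) :=
    (hf.fderiv.differentiable (by simp) _).hasFDerivAt
  have h1 : AffineFlow.dt (AffineFlow.dx f) x t
      = _root_.fderiv ℝ (_root_.fderiv ℝ F) (x, t) (0, 1) (1, 0) := by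
    have h : HasDerivAt (fun s => _root_.fderiv ℝ F (x, s))
        (_root_.fderiv ℝ (_root_.fderiv ℝ F) (x, t) (0, 1)) t :=
      hd.comp_hasDerivAt t ((hasDerivAt_const t x).prodMk (hasDerivAt_id t))
    have h2 := ((ContinuousLinearMap.apply ℝ E ((1 : ℝ), (0 : ℝ))).hasFDerivAt.comp_hasDerivAt t h)
    have h3 : (fun s => AffineFlow.dx f x s) = fun s => _root_.fderiv ℝ F (x, s) (1, 0) :=
      funext fun s => hf.dx_eq x s
    unfold AffineFlow.dt
    rw [h3]
    exact h2.deriv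
  have h1' : AffineFlow.dx (AffineFlow.dt f) x t
      = _root_.fderiv ℝ (_root_.fderiv ℝ F) (x, t) (1, 0) (0, 1) := by
    have h : HasDerivAt (fun y => _root_.fderiv ℝ F (y, t))
        (_root_.fderiv ℝ (_root_.fderiv ℝ F) (x, t) (1, 0)) x :=
      hd.comp_hasDerivAt x ((hasDerivAt_id x).prodMk (hasDerivAt_const x t))
    have h2 := ((ContinuousLinearMap.apply ℝ E ((0 : ℝ), (1 : ℝ))).hasFDerivAt.comp_hasDerivAt x h)
    have h3 : (fun y => AffineFlow.dt f y t) = fun y => _root_.fderiv ℝ F (y, t) (0, 1) :=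
      funext fun y => hf.dt_eq y t
    unfold AffineFlow.dx
    rw [h3]
    exact h2.deriv
  rw [h1, h1']
  have hs : IsSymmSndFDerivAt ℝ F (x, t) :=
    ContDiffAt.isSymmSndFDerivAt (ContDiff.contDiffAt hf) (by
      rw [minSmoothness_of_isRCLikeNormedField]; exact WithTop.coe_le_coe.mpr le_top)
  exact hs.eq _ _

lemma Sm.continuous (hf : Sm f) : Continuous fun p : ℝ × ℝ => f p.1 p.2 := ContDiff.continuous hf

lemma Sm.continuous_left (hf : Sm f) (t : ℝ) : Continuous fun x => f x t :=
  (hf.contDiff_left t).continuous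

lemma Sm.continuous_right (hf : Sm f) (x : ℝ) : Continuous fun t => f x t :=
  (hf.contDiff_right x).continuous

lemma Sm.add {g : ℝ → ℝ → E} (hf : Sm f) (hg : Sm g) : Sm (fun x t => f x t + g x t) :=
  ContDiff.add hf hg

lemma Sm.sub {g : ℝ → ℝ → E} (hf : Sm f) (hg : Sm g) : Sm (fun x t => f x t - g x t) :=
  ContDiff.sub hf hg

lemma Sm.mul {f g : ℝ → ℝ → ℝ} (hf : Sm f) (hg : Sm g) : Sm (fun x t => f x t * g x t) :=
  ContDiff.mul hf hg

lemma Sm.pow {f : ℝ → ℝ → ℝ} (hf : Sm f) (n : ℕ) : Sm (fun x t => f x t ^ n) :=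
  ContDiff.pow hf n

lemma Sm.inv {f : ℝ → ℝ → ℝ} (hf : Sm f) (h : ∀ x t, f x t ≠ 0) : Sm (fun x t => (f x t)⁻¹) :=
  ContDiff.inv hf fun p => h p.1 p.2

lemma Sm.of_left {g : ℝ → E} (hg : ContDiff ℝ (⊤ : ℕ∞) g) : Sm (fun x _ => g x) :=
  hg.comp contDiff_fst

lemma Sm.of_right {g : ℝ → E} (hg : ContDiff ℝ (⊤ : ℕ∞) g) : Sm (fun _ t => g t) :=
  hg.comp contDiff_snd

lemma Sm.const (c : E) : Sm (fun _ _ => c) := contDiff_const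

lemma Sm.comp₂ {a b : ℝ → ℝ → ℝ} (hf : Sm f) (ha : Sm a) (hb : Sm b) :
    Sm (fun x t => f (a x t) (b x t)) :=
  ContDiff.comp (g := fun p : ℝ × ℝ => f p.1 p.2) hf (ContDiff.prodMk ha hb)

/-- Chain rule for `f (a s) (b s)`. -/
lemma Sm.hasDerivAt_comp (hf : Sm f) {a b : ℝ → ℝ} {a' b' s : ℝ} (ha : HasDerivAt a a' s)
    (hb : HasDerivAt b b' s) :
    HasDerivAt (fun s => f (a s) (b s))
      (a' • AffineFlow.dx f (a s) (b s) + b' • AffineFlow.dt f (a s) (b s)) s := by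
  refine ((hf.hasFDerivAt (a s, b s)).comp_hasDerivAt s (ha.prodMk hb)).congr_deriv ?_
  rw [hf.dx_eq, hf.dt_eq, ← map_smul, ← map_smul, ← map_add]
  simp

end TwoVar

lemma hasDerivAt_integral_param {f f' : ℝ → ℝ → ℝ} {a b : ℝ}
    (hf : Continuous fun p : ℝ × ℝ => f p.1 p.2)
    (hf' : Continuous fun p : ℝ × ℝ => f' p.1 p.2)
    (hd : ∀ x t, HasDerivAt (fun s => f x s) (f' x t) t) (t : ℝ) :
    HasDerivAt (fun t => ∫ x in a..b, f x t) (∫ x in a..b, f' x t) t := by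
  obtain ⟨C, hC⟩ := (isCompact_uIcc (a := a) (b := b)).prod (isCompact_Icc (a := t - 1) (b := t + 1))
    |>.exists_bound_of_continuousOn hf'.continuousOn
  have hball : Metric.ball t 1 ∈ nhds t := Metric.ball_mem_nhds t one_pos
  refine (intervalIntegral.hasDerivAt_integral_of_dominated_loc_of_deriv_le (μ := volume)
    (F := fun t x => f x t) (F' := fun t x => f' x t) (bound := fun _ => C) hball
    (Filter.Eventually.of_forall fun s => ?_) ?_ ?_ ?_ ?_ ?_).2
  · exact (hf.comp (by fun_prop : Continuous fun x : ℝ => (x, s))).aestronglyMeasurable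
  · exact (hf.comp (by fun_prop : Continuous fun x : ℝ => (x, t))).intervalIntegrable _ _
  · exact (hf'.comp (by fun_prop : Continuous fun x : ℝ => (x, t))).aestronglyMeasurable
  · refine Filter.Eventually.of_forall fun x hx s hs => hC (x, s) ⟨Set.uIoc_subset_uIcc hx, ?_⟩
    rw [Metric.mem_ball, Real.dist_eq, abs_lt] at hs
    constructor <;> linarith [hs.1, hs.2]
  · exact intervalIntegrable_const
  · exact Filter.Eventually.of_forall fun x _ s _ => hd x s

lemma Sm.hasDerivAt_integral {f : ℝ → ℝ → ℝ} (hf : Sm f) (a b t : ℝ) :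
    HasDerivAt (fun t => ∫ x in a..b, f x t) (∫ x in a..b, AffineFlow.dt f x t) t :=
  hasDerivAt_integral_param hf.continuous hf.dt.continuous hf.hasDerivAt_t t

lemma continuous_tsum_loc {ι X E : Type*} [TopologicalSpace X] [NormedAddCommGroup E]
    [CompleteSpace E] {r : X → ℝ} (hr : Continuous r) {F : ι → X → E} (hc : ∀ i, Continuous (F i))
    (hb : ∀ T, ∃ u : ι → ℝ, Summable u ∧ ∀ i x, r x ≤ T → ‖F i x‖ ≤ u i) :
    Continuous fun x => ∑' i, F i x := by
  rw [continuous_iff_continuousAt]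
  intro x
  obtain ⟨u, hu, hF⟩ := hb (r x + 1)
  have hmem : {y | r y < r x + 1} ∈ nhds x :=
    (isOpen_lt hr continuous_const).mem_nhds (by simp)
  exact (continuousOn_tsum (fun i => (hc i).continuousOn) hu
    (fun i y (hy : r y < r x + 1) => hF i y hy.le)).continuousAt hmem

lemma hasDerivAt_tsum_loc {ι E : Type*} [NormedAddCommGroup E] [NormedSpace ℝ E]
    [CompleteSpace E] {F F' : ι → ℝ → E} (hd : ∀ i t, HasDerivAt (F i) (F' i t) t)
    (hs : ∀ t, Summable fun i => F i t)
    (hb : ∀ T, ∃ u : ι → ℝ, Summable u ∧ ∀ i t, |t| ≤ T → ‖F' i t‖ ≤ u i) (t : ℝ) :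
    HasDerivAt (fun t => ∑' i, F i t) (∑' i, F' i t) t := by
  obtain ⟨u, hu, hF⟩ := hb (|t| + 1)
  refine hasDerivAt_tsum_of_isPreconnected (t := Metric.ball 0 (|t| + 1)) hu Metric.isOpen_ball
    (convex_ball _ _).isPreconnected (fun i y _ => hd i y) (fun i y hy => hF i y ?_) (y₀ := t) ?_
    (hs t) ?_
  · rw [Metric.mem_ball, dist_zero_right, Real.norm_eq_abs] at hy
    exact hy.le
  · simp
  · simp

section Classes
variable {E : Type*} [NormedAddCommGroup E] [NormedSpace ℝ E]

/-- Continuous in time and rapidly decaying in the index, locally uniformly in time. -/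
def Rap (f : ℤ → ℝ → E) : Prop :=
  (∀ k, Continuous (f k)) ∧ ∀ (n : ℕ) (T : ℝ), ∃ C, ∀ k t, |t| ≤ T → ‖f k t‖ ≤ C / wt k ^ n

/-- Continuous in time with polynomial growth in the index, locally uniformly in time. -/
def Pol (f : ℤ → ℝ → E) : Prop :=
  (∀ k, Continuous (f k)) ∧ ∀ T : ℝ, ∃ (C : ℝ) (n : ℕ), ∀ k t, |t| ≤ T → ‖f k t‖ ≤ C * wt k ^ n

/-- `n` time derivatives, all rapidly decaying. -/
def SR : ℕ → (ℤ → ℝ → E) → Prop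
  | 0, f => Rap f
  | n + 1, f => Rap f ∧ ∃ df : ℤ → ℝ → E, (∀ k t, HasDerivAt (f k) (df k t) t) ∧ SR n df

/-- `n` time derivatives, all of polynomial growth. -/
def SP : ℕ → (ℤ → ℝ → E) → Prop
  | 0, f => Pol f
  | n + 1, f => Pol f ∧ ∃ f' : ℤ → ℝ → E, (∀ k t, HasDerivAt (f k) (f' k t) t) ∧ SP n f'

lemma SR.rap {n : ℕ} {f : ℤ → ℝ → E} (h : SR n f) : Rap f := by
  cases n with
  | zero => exact h
  | succ n => exact h.1

lemma SR.of_succ {n : ℕ} : ∀ {f : ℤ → ℝ → E}, SR (n + 1) f → SR n f := by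
  induction n with
  | zero => exact fun h => h.1
  | succ n ih => exact fun ⟨h, f', hd, h'⟩ => ⟨h, f', hd, ih h'⟩

lemma SP.of_succ {n : ℕ} : ∀ {f : ℤ → ℝ → E}, SP (n + 1) f → SP n f := by
  induction n with
  | zero => exact fun h => h.1
  | succ n ih => exact fun ⟨h, f', hd, h'⟩ => ⟨h, f', hd, ih h'⟩

omit [NormedSpace ℝ E] in
lemma Rap.pol {f : ℤ → ℝ → E} (h : Rap f) : Pol f :=
  ⟨h.1, fun T => by
    obtain ⟨C, hC⟩ := h.2 0 T
    exact ⟨C, 0, by simpa using hC⟩⟩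

lemma SR.sp {n : ℕ} : ∀ {f : ℤ → ℝ → E}, SR n f → SP n f := by
  induction n with
  | zero => exact fun h => h.pol
  | succ n ih => exact fun ⟨h, f', hd, h'⟩ => ⟨h.pol, f', hd, ih h'⟩

omit [NormedSpace ℝ E] in
lemma Rap.add {f g : ℤ → ℝ → E} (hf : Rap f) (hg : Rap g) : Rap fun k t => f k t + g k t := by
  refine ⟨fun k => (hf.1 k).add (hg.1 k), fun n T => ?_⟩
  obtain ⟨C, hC⟩ := hf.2 n T
  obtain ⟨D, hD⟩ := hg.2 n T
  refine ⟨C + D, fun k t ht => (norm_add_le _ _).trans ?_⟩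
  rw [add_div]
  exact add_le_add (hC k t ht) (hD k t ht)

lemma SR.add {n : ℕ} : ∀ {f g : ℤ → ℝ → E}, SR n f → SR n g → SR n fun k t => f k t + g k t := by
  induction n with
  | zero => exact fun hf hg => Rap.add hf hg
  | succ n ih =>
    rintro f g ⟨hf, f', hfd, hf'⟩ ⟨hg, g', hgd, hg'⟩
    exact ⟨hf.add hg, _, fun k t => (hfd k t).add (hgd k t), ih hf' hg'⟩

omit [NormedSpace ℝ E] in
lemma Pol.add {f g : ℤ → ℝ → E} (hf : Pol f) (hg : Pol g) : Pol fun k t => f k t + g k t := by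
  refine ⟨fun k => (hf.1 k).add (hg.1 k), fun T => ?_⟩
  obtain ⟨C, m, hC⟩ := hf.2 T
  obtain ⟨D, n, hD⟩ := hg.2 T
  refine ⟨|C| + |D|, m + n, fun k t ht => (norm_add_le _ _).trans ?_⟩
  have hw := one_le_wt k
  rw [add_mul]
  refine add_le_add ((hC k t ht).trans ?_) ((hD k t ht).trans ?_)
  · exact mul_le_mul (le_abs_self _) (pow_le_pow_right₀ hw (by omega)) (by positivity) (abs_nonneg _)
  · exact mul_le_mul (le_abs_self _) (pow_le_pow_right₀ hw (by omega)) (by positivity) (abs_nonneg _)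

lemma SP.add {n : ℕ} : ∀ {f g : ℤ → ℝ → E}, SP n f → SP n g → SP n fun k t => f k t + g k t := by
  induction n with
  | zero => exact fun hf hg => Pol.add hf hg
  | succ n ih =>
    rintro f g ⟨hf, f', hfd, hf'⟩ ⟨hg, g', hgd, hg'⟩
    exact ⟨hf.add hg, _, fun k t => (hfd k t).add (hgd k t), ih hf' hg'⟩

lemma SR.map {F : Type*} [NormedAddCommGroup F] [NormedSpace ℝ F] (L : E →L[ℝ] F) {n : ℕ} :
    ∀ {f : ℤ → ℝ → E}, SR n f → SR n fun k t => L (f k t) := by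
  have hrap : ∀ {f : ℤ → ℝ → E}, Rap f → Rap fun k t => L (f k t) := by
    intro f hf
    refine ⟨fun k => L.continuous.comp (hf.1 k), fun n T => ?_⟩
    obtain ⟨C, hC⟩ := hf.2 n T
    refine ⟨‖L‖ * C, fun k t ht => (L.le_opNorm _).trans ?_⟩
    rw [mul_div_assoc]
    exact mul_le_mul_of_nonneg_left (hC k t ht) (norm_nonneg _)
  induction n with
  | zero => exact fun hf => hrap hf
  | succ n ih =>
    rintro f ⟨hf, f', hfd, hf'⟩
    exact ⟨hrap hf, _, fun k t => L.hasFDerivAt.comp_hasDerivAt t (hfd k t), ih hf'⟩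

lemma SP.map {F : Type*} [NormedAddCommGroup F] [NormedSpace ℝ F] (L : E →L[ℝ] F) {n : ℕ} :
    ∀ {f : ℤ → ℝ → E}, SP n f → SP n fun k t => L (f k t) := by
  have hpol : ∀ {f : ℤ → ℝ → E}, Pol f → Pol fun k t => L (f k t) := by
    intro f hf
    refine ⟨fun k => L.continuous.comp (hf.1 k), fun T => ?_⟩
    obtain ⟨C, n, hC⟩ := hf.2 T
    refine ⟨‖L‖ * C, n, fun k t ht => (L.le_opNorm _).trans ?_⟩
    rw [mul_assoc]
    exact mul_le_mul_of_nonneg_left (hC k t ht) (norm_nonneg _)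
  induction n with
  | zero => exact fun hf => hpol hf
  | succ n ih =>
    rintro f ⟨hf, f', hfd, hf'⟩
    exact ⟨hpol hf, _, fun k t => L.hasFDerivAt.comp_hasDerivAt t (hfd k t), ih hf'⟩

lemma SP.zero (n : ℕ) : SP n (fun _ _ => (0 : E)) := by
  have : Pol (fun _ _ => (0 : E)) := ⟨fun k => continuous_const, fun T => ⟨0, 0, by simp⟩⟩
  induction n with
  | zero => exact this
  | succ n ih => exact ⟨this, _, fun k t => hasDerivAt_const t 0, ih⟩

lemma SP.of_const {a : ℤ → E} {C : ℝ} {m : ℕ} (ha : ∀ k, ‖a k‖ ≤ C * wt k ^ m) (n : ℕ) :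
    SP n (fun k _ => a k) := by
  have h : Pol (fun k (_ : ℝ) => a k) := ⟨fun k => continuous_const, fun T => ⟨C, m, fun k t _ => ha k⟩⟩
  cases n with
  | zero => exact h
  | succ n => exact ⟨h, _, fun k t => hasDerivAt_const t (a k), SP.zero n⟩

end Classes

section Mul
variable {A : Type*} [NormedRing A] [NormedAlgebra ℝ A]

omit [NormedAlgebra ℝ A] in
lemma Rap.pol_mul {p f : ℤ → ℝ → A} (hp : Pol p) (hf : Rap f) : Rap fun k t => p k t * f k t := by
  refine ⟨fun k => (hp.1 k).mul (hf.1 k), fun n T => ?_⟩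
  obtain ⟨C, m, hC⟩ := hp.2 T
  obtain ⟨D, hD⟩ := hf.2 (n + m) T
  refine ⟨C * D, fun k t ht => (norm_mul_le _ _).trans ?_⟩
  have hw := wt_pos k
  refine (mul_le_mul (hC k t ht) (hD k t ht) (norm_nonneg _)
    ((norm_nonneg _).trans (hC k t ht))).trans (le_of_eq ?_)
  rw [pow_add]
  field_simp

omit [NormedAlgebra ℝ A] in
lemma Pol.mul {p f : ℤ → ℝ → A} (hp : Pol p) (hf : Pol f) : Pol fun k t => p k t * f k t := by
  refine ⟨fun k => (hp.1 k).mul (hf.1 k), fun T => ?_⟩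
  obtain ⟨C, m, hC⟩ := hp.2 T
  obtain ⟨D, n, hD⟩ := hf.2 T
  refine ⟨C * D, m + n, fun k t ht => (norm_mul_le _ _).trans ?_⟩
  refine (mul_le_mul (hC k t ht) (hD k t ht) (norm_nonneg _)
    ((norm_nonneg _).trans (hC k t ht))).trans (le_of_eq ?_)
  rw [pow_add]
  ring

lemma SR.sp_mul {n : ℕ} : ∀ {p f : ℤ → ℝ → A}, SP n p → SR n f → SR n fun k t => p k t * f k t := by
  induction n with
  | zero => exact fun hp hf => Rap.pol_mul hp hf
  | succ n ih =>
    intro p f hp hf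
    have hp0 := hp.of_succ
    have hf0 := hf.of_succ
    obtain ⟨hp, p', hpd, hp'⟩ := hp
    obtain ⟨hf, f', hfd, hf'⟩ := hf
    exact ⟨hf.pol_mul hp, _, fun k t => (hpd k t).mul (hfd k t), (ih hp' hf0).add (ih hp0 hf')⟩

lemma SP.mul {n : ℕ} : ∀ {p f : ℤ → ℝ → A}, SP n p → SP n f → SP n fun k t => p k t * f k t := by
  induction n with
  | zero => exact fun hp hf => Pol.mul hp hf
  | succ n ih =>
    intro p f hp hf
    have hp0 := hp.of_succ
    have hf0 := hf.of_succ
    obtain ⟨hp, p', hpd, hp'⟩ := hp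
    obtain ⟨hf, f', hfd, hf'⟩ := hf
    exact ⟨hp.mul hf, _, fun k t => (hpd k t).mul (hfd k t), (ih hp' hf0).add (ih hp0 hf')⟩

end Mul

/-- Bounded smooth functions whose derivative has compact support. -/
def BD (ψ : ℝ → ℝ) : Prop :=
  ContDiff ℝ (⊤ : ℕ∞) ψ ∧ HasCompactSupport (deriv ψ) ∧ ∃ C, ∀ x, |ψ x| ≤ C

lemma BD.deriv {ψ : ℝ → ℝ} (h : BD ψ) : BD (deriv ψ) := by
  have h1 : ContDiff ℝ (⊤ : ℕ∞) (_root_.deriv ψ) := (contDiff_infty_iff_deriv.mp h.1).2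
  refine ⟨h1, h.2.1.deriv, ?_⟩
  obtain ⟨C, hC⟩ := h1.continuous.bounded_above_of_compact_support h.2.1
  exact ⟨C, hC⟩

lemma SP.comp_BD {n : ℕ} : ∀ {ψ : ℝ → ℝ} {g : ℤ → ℝ → ℝ}, BD ψ → SP n g →
    SP n fun k t => ψ (g k t) := by
  have hpol : ∀ {ψ : ℝ → ℝ} {g : ℤ → ℝ → ℝ}, BD ψ → Pol g → Pol fun k t => ψ (g k t) := by
    intro ψ g hψ hg
    refine ⟨fun k => hψ.1.continuous.comp (hg.1 k), fun T => ?_⟩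
    obtain ⟨C, hC⟩ := hψ.2.2
    exact ⟨C, 0, fun k t _ => by simpa using hC _⟩
  induction n with
  | zero => exact fun hψ hg => hpol hψ hg
  | succ n ih =>
    intro ψ g hψ hg
    have hg0 := hg.of_succ
    obtain ⟨hg, g', hgd, hg'⟩ := hg
    exact ⟨hpol hψ hg, _, fun k t =>
      ((hψ.1.differentiable (by simp) _).hasDerivAt).comp t (hgd k t), (ih hψ.deriv hg0).mul hg'⟩

lemma BD_smoothTransition : BD Real.smoothTransition := by
  refine ⟨contDiff_smoothTransition_inf, ?_, 1, fun x => ?_⟩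
  · refine HasCompactSupport.of_support_subset_isCompact (isCompact_Icc (a := (0 : ℝ)) (b := 1)) ?_
    intro x hx
    by_contra h
    apply hx
    rw [Set.mem_Icc, not_and_or, not_le, not_le] at h
    rcases h with h | h
    · have : Real.smoothTransition =ᶠ[nhds x] fun _ => 0 := by
        filter_upwards [gt_mem_nhds h] with y hy
        exact Real.smoothTransition.zero_of_nonpos (le_of_lt hy)
      rw [this.deriv_eq]; simp
    · have : Real.smoothTransition =ᶠ[nhds x] fun _ => 1 := by
        filter_upwards [lt_mem_nhds h] with y hy
        exact Real.smoothTransition.one_of_one_le (le_of_lt hy)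
      rw [this.deriv_eq]; simp
  · rw [abs_of_nonneg (Real.smoothTransition.nonneg _)]
    exact Real.smoothTransition.le_one _

lemma BD_clipFactor : BD fun x => Real.smoothTransition (2 - x ^ 2) := by
  have hs : HasCompactSupport fun x => Real.smoothTransition (2 - x ^ 2) := by
    refine HasCompactSupport.of_support_subset_isCompact (isCompact_Icc (a := (-2 : ℝ)) (b := 2)) ?_
    intro x hx
    by_contra h
    apply hx
    rw [Set.mem_Icc, ← abs_le, not_le] at h
    apply Real.smoothTransition.zero_of_nonpos
    rw [← sq_abs]; nlinarith
  refine ⟨contDiff_smoothTransition_inf.comp (contDiff_const.sub (contDiff_id.pow 2)),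
    hs.deriv, 1, fun x => ?_⟩
  rw [abs_of_nonneg (Real.smoothTransition.nonneg _)]
  exact Real.smoothTransition.le_one _

lemma SP_tcut (n : ℕ) : SP n tcut := by
  have hc : ∀ m, SP m fun (k : ℤ) (_ : ℝ) => 1 + (k : ℝ) ^ 2 := fun m => by
    refine SP.of_const (C := 1) (m := 2) (fun k => ?_) m
    rw [Real.norm_of_nonneg (by positivity), ← sq_abs]
    unfold wt
    nlinarith [abs_nonneg (k : ℝ)]
  have hpol : Pol fun (k : ℤ) (t : ℝ) => 1 + (1 + (k : ℝ) ^ 2) * t := by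
    refine ⟨fun k => by fun_prop, fun T => ⟨1 + T, 2, fun k t ht => ?_⟩⟩
    refine (norm_add_le _ _).trans ?_
    rw [norm_one, norm_mul, Real.norm_of_nonneg (show (0 : ℝ) ≤ 1 + (k : ℝ) ^ 2 by positivity), ← sq_abs,
      Real.norm_eq_abs]
    have : 1 + |(k : ℝ)| ^ 2 ≤ wt k ^ 2 := by unfold wt; nlinarith [abs_nonneg (k : ℝ)]
    have h1 : 1 ≤ wt k ^ 2 := one_le_pow₀ (one_le_wt k)
    nlinarith [abs_nonneg t, mul_le_mul this ht (abs_nonneg t) (by positivity)]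
  have hg : SP n fun (k : ℤ) (t : ℝ) => 1 + (1 + (k : ℝ) ^ 2) * t := by
    cases n with
    | zero => exact hpol
    | succ n =>
      refine ⟨hpol, fun k _ => 1 + (k : ℝ) ^ 2, fun k t => ?_, hc n⟩
      simpa using ((hasDerivAt_id t).const_mul (1 + (k : ℝ) ^ 2)).const_add 1
  exact SP.comp_BD BD_smoothTransition hg

lemma SR_clip {n : ℕ} {R : ℝ} (hR : 0 < R) {f : ℤ → ℝ → ℂ} (hf : SR n f) :
    SR n fun k t => clipC (R / wt k) (f k t) := by
  have key : ∀ g : ℤ → ℝ → ℝ, SR n g → SR n fun k t => (R / wt k) * clip1 (g k t / (R / wt k)) := by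
    intro g hg
    have h1 : SP n fun k t => (wt k / R) * g k t := by
      refine SP.mul (SP.of_const (C := 1 / R) (m := 1) (fun k => ?_) n) hg.sp
      have := wt_pos k
      rw [Real.norm_of_nonneg (by positivity)]
      exact le_of_eq (by ring)
    have h2 := SR.sp_mul (SP.comp_BD BD_clipFactor h1) hg
    have heq : (fun k t => (R / wt k) * clip1 (g k t / (R / wt k))) = fun k t =>
        Real.smoothTransition (2 - (wt k / R * g k t) ^ 2) * g k t := by
      funext k t
      have := wt_pos k
      unfold clip1
      rw [show g k t / (R / wt k) = wt k / R * g k t by field_simp]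
      field_simp
    rw [heq]
    exact h2
  have h1 := (key _ (hf.map Complex.reCLM)).map Complex.ofRealCLM
  have h2 := ((key _ (hf.map Complex.imCLM)).map Complex.ofRealCLM)
  have h3 := SR.sp_mul (SP.of_const (a := fun _ => Complex.I) (C := 1) (m := 0)
    (fun k => by simp) n) h2
  have heq : (fun k t => clipC (R / wt k) (f k t)) = fun k t =>
      Complex.ofRealCLM ((R / wt k) * clip1 (Complex.reCLM (f k t) / (R / wt k))) +
      Complex.I * Complex.ofRealCLM ((R / wt k) * clip1 (Complex.imCLM (f k t) / (R / wt k))) := by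
    funext k t
    rw [clipC_eq]
    simp [mul_comm]
  rw [heq]
  exact h1.add h3

lemma Rap.Bq {f g : ℤ → ℝ → ℂ} (hf : Rap f) (hg : Rap g) :
    Rap fun k t => Bq (fun j => f j t) (fun j => g j t) k := by
  refine ⟨fun k => ?_, fun n T => ?_⟩
  · unfold AffineFlow.Bq
    refine continuous_tsum_loc (r := fun t : ℝ => |t|) continuous_abs (fun j => ?_) fun T => ?_
    · exact (continuous_const.mul (hf.1 j)).mul (hg.1 (k - j))
    · obtain ⟨C, hC⟩ := hf.2 (0 + 1) T
      obtain ⟨D, hD⟩ := hg.2 (0 + 1) T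
      exact ⟨_, (summable_convM k).mul_left (C * D / wt k ^ 0), fun j t ht =>
        norm_Bq_term_le (fun i => hC i t ht) (fun i => hD i t ht) k j⟩
  · obtain ⟨C, hC⟩ := hf.2 (n + 1) T
    obtain ⟨D, hD⟩ := hg.2 (n + 1) T
    exact ⟨_, fun k t ht => norm_Bq_le (fun i => hC i t ht) (fun i => hD i t ht) k⟩

lemma Rap.summable_Bq {f g : ℤ → ℝ → ℂ} (hf : Rap f) (hg : Rap g) (k : ℤ) (t : ℝ) :
    Summable fun j => (bco k j : ℂ) * f j t * g (k - j) t := by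
  obtain ⟨C, hC⟩ := hf.2 (0 + 1) |t|
  obtain ⟨D, hD⟩ := hg.2 (0 + 1) |t|
  exact AffineFlow.summable_Bq (fun i => hC i t le_rfl) (fun i => hD i t le_rfl) k

lemma SR.Bq {n : ℕ} : ∀ {f g : ℤ → ℝ → ℂ}, SR n f → SR n g →
    SR n fun k t => Bq (fun j => f j t) (fun j => g j t) k := by
  induction n with
  | zero => exact fun hf hg => Rap.Bq hf hg
  | succ n ih =>
    intro f g hf hg
    have hf0 := hf.of_succ
    have hg0 := hg.of_succ
    obtain ⟨hf, f', hfd, hf'⟩ := hf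
    obtain ⟨hg, g', hgd, hg'⟩ := hg
    refine ⟨hf.Bq hg, _, fun k t => ?_, (ih hf' hg0).add (ih hf0 hg')⟩
    have h := hasDerivAt_tsum_loc
      (F := fun j t => (bco k j : ℂ) * f j t * g (k - j) t)
      (F' := fun j t => (bco k j : ℂ) * f' j t * g (k - j) t + (bco k j : ℂ) * f j t * g' (k - j) t)
      (fun j t => ((hfd j t).const_mul _).mul (hgd (k - j) t)) (fun t => hf.summable_Bq hg k t)
      (fun T => by
        obtain ⟨C, hC⟩ := hf.2 (0 + 1) T
        obtain ⟨D, hD⟩ := hg.2 (0 + 1) T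
        obtain ⟨C', hC'⟩ := hf'.rap.2 (0 + 1) T
        obtain ⟨D', hD'⟩ := hg'.rap.2 (0 + 1) T
        refine ⟨_, ((summable_convM k).mul_left (C' * D / wt k ^ 0)).add
          ((summable_convM k).mul_left (C * D' / wt k ^ 0)), fun j t ht =>
          (norm_add_le _ _).trans (add_le_add ?_ ?_)⟩
        · exact norm_Bq_term_le (fun i => hC' i t ht) (fun i => hD i t ht) k j
        · exact norm_Bq_term_le (fun i => hC i t ht) (fun i => hD' i t ht) k j) t
    rw [(hf'.rap.summable_Bq hg k t).tsum_add (hf.summable_Bq hg'.rap k t)] at h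
    exact h

/-- The solution of the truncated system is smooth in time with rapidly decaying derivatives. -/
lemma exists_smooth_mild {R : ℝ} (hR : 0 < R) {c0 : ℤ → ℂ}
    (hc0 : ∀ n : ℕ, ∃ C, ∀ k, ‖c0 k‖ ≤ C / wt k ^ n)
    (hconj : ∀ k, c0 (-k) = starRingEnd ℂ (c0 k)) :
    ∃ c : ℤ → ℝ → ℂ, (∀ n, SR n c) ∧ (∀ k t, c (-k) t = starRingEnd ℂ (c k t)) ∧
      (∀ k, c k 0 = c0 k) ∧
      ∀ k t, HasDerivAt (c k)
        ((tcut k t : ℂ) * (-((k : ℂ) ^ 2 / 4) * c k t + Bclip R (fun j => c j t) k)) t := by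
  obtain ⟨C0, hC0⟩ := hc0 1
  simp only [pow_one] at hC0
  obtain ⟨c, hcont, hcc, hcb, hmild⟩ := exists_mild hR hC0 hconj
  have hd : ∀ k t, HasDerivAt (c k)
        ((tcut k t : ℂ) * (-((k : ℂ) ^ 2 / 4) * c k t + Bclip R (fun j => c j t) k)) t := by
    intro k t
    have h := hasDerivAt_duh k (continuous_Bclip hR hcont k) (c0 k) t
    rw [← hmild k t] at h
    rwa [← (funext (hmild k) : c k = _)] at h
  have hrap : Rap c := by
    refine ⟨hcont, fun n T => ?_⟩
    obtain ⟨C, hC⟩ := mild_decay hR hc0 hcb hmild n T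
    refine ⟨C, fun k t ht => (hC k t ht).trans ?_⟩
    have hw := one_le_wt k
    have hw0 := wt_pos k
    have hC0 : 0 ≤ C / wt k ^ (n + 1) := (norm_nonneg _).trans (hC k t ht)
    have hC1 : 0 ≤ C := by
      have := mul_nonneg hC0 (pow_pos hw0 (n + 1)).le
      rwa [div_mul_cancel₀ _ (by positivity)] at this
    gcongr
    omega
  refine ⟨c, fun n => ?_, hcc, fun k => ?_, hd⟩
  · induction n with
    | zero => exact hrap
    | succ n ih =>
      refine ⟨hrap, _, hd, ?_⟩
      have h1 : SP n fun k t => (tcut k t : ℂ) := (SP_tcut n).map Complex.ofRealCLM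
      have h2 : SP n fun (k : ℤ) (_ : ℝ) => -((k : ℂ) ^ 2 / 4) := by
        refine SP.of_const (C := 1) (m := 2) (fun k => ?_) n
        rw [norm_neg, norm_div, norm_pow, Complex.norm_intCast]
        unfold wt
        norm_num
        nlinarith [abs_nonneg (k : ℝ), sq_abs (k : ℝ)]
      have h3 := (SR_clip hR ih).Bq (SR_clip hR ih)
      exact SR.sp_mul h1 ((SR.sp_mul h2 ih).add h3)
  · rw [hmild, arate_zero]
    simp [duh]

/-- `2π`-periodicity. -/
def Per {E : Type*} (f : ℝ → E) : Prop := ∀ x, f (x + 2 * π) = f x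

lemma Per.zero_eq {E : Type*} {f : ℝ → E} (h : Per f) : f (2 * π) = f 0 := by
  simpa using h 0

lemma Per.deriv {E : Type*} [NormedAddCommGroup E] [NormedSpace ℝ E] {f f' : ℝ → E} (h : Per f)
    (hd : ∀ x, HasDerivAt f (f' x) x) : Per f' := by
  intro x
  have h1 : HasDerivAt (fun y => f (y + 2 * π)) (f' (x + 2 * π)) x := by
    simpa using (hd (x + 2 * π)).comp_add_const x (2 * π)
  rw [show (fun y => f (y + 2 * π)) = f from funext h] at h1
  exact h1.unique (hd x)

lemma Per.exists_bound {E : Type*} [NormedAddCommGroup E] {f : ℝ → E} (h : Per f)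
    (hc : Continuous f) : ∃ M, ∀ x, ‖f x‖ ≤ M := by
  obtain ⟨M, hM⟩ := (isCompact_Icc (a := (0 : ℝ)) (b := 2 * π)).exists_bound_of_continuousOn
    hc.continuousOn
  refine ⟨M, fun x => ?_⟩
  obtain ⟨y, hy, hxy⟩ := (show Function.Periodic f (2 * π) from h).exists_mem_Ico₀ two_pi_pos x
  rw [hxy]
  exact hM y ⟨hy.1, hy.2.le⟩

lemma integral_deriv_per {E : Type*} [NormedAddCommGroup E] [NormedSpace ℝ E] [CompleteSpace E]
    {f f' : ℝ → E} (h : Per f) (hd : ∀ x, HasDerivAt f (f' x) x) (hc : Continuous f') :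
    ∫ x in (0 : ℝ)..2 * π, f' x = 0 := by
  rw [intervalIntegral.integral_eq_sub_of_hasDerivAt (fun x _ => hd x)
    (hc.intervalIntegrable _ _), h.zero_eq, sub_self]

lemma integral_parts_per {A : Type*} [NormedRing A] [NormedAlgebra ℝ A] [CompleteSpace A]
    {f f' g g' : ℝ → A} (hf : Per f) (hg : Per g) (hfd : ∀ x, HasDerivAt f (f' x) x)
    (hgd : ∀ x, HasDerivAt g (g' x) x) (hf' : Continuous f') (hg' : Continuous g') :
    ∫ x in (0 : ℝ)..2 * π, f x * g' x = -∫ x in (0 : ℝ)..2 * π, f' x * g x := by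
  rw [intervalIntegral.integral_mul_deriv_eq_deriv_mul (fun x _ => hfd x) (fun x _ => hgd x)
    (hf'.intervalIntegrable _ _) (hg'.intervalIntegrable _ _), hf.zero_eq, hg.zero_eq, sub_self,
    zero_sub]

/-- The character `e^{ikx}`. -/
noncomputable def ek (k : ℤ) (x : ℝ) : ℂ := Complex.exp (k * x * Complex.I)

lemma ek_eq (k : ℤ) (x : ℝ) : ek k x = Complex.exp (((k * x : ℝ) : ℂ) * Complex.I) := by
  simp [ek]

@[simp] lemma norm_ek (k : ℤ) (x : ℝ) : ‖ek k x‖ = 1 := by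
  rw [ek_eq, Complex.norm_exp_ofReal_mul_I]

@[simp] lemma ek_zero (x : ℝ) : ek 0 x = 1 := by simp [ek]

lemma ek_add (k l : ℤ) (x : ℝ) : ek (k + l) x = ek k x * ek l x := by
  simp only [ek]; rw [← Complex.exp_add]; push_cast; ring_nf

lemma ek_neg (k : ℤ) (x : ℝ) : ek (-k) x = starRingEnd ℂ (ek k x) := by
  simp only [ek]
  rw [← Complex.exp_conj]
  congr 1
  simp

lemma ek_per (k : ℤ) : Per (ek k) := by
  intro x
  simp only [ek]
  rw [show (k : ℂ) * ((x + 2 * π : ℝ) : ℂ) * Complex.I = k * x * Complex.I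
    + k * (2 * π * Complex.I) by push_cast; ring, Complex.exp_add, Complex.exp_int_mul_two_pi_mul_I,
    mul_one]

lemma hasDerivAt_ek (k : ℤ) (x : ℝ) : HasDerivAt (ek k) (Complex.I * k * ek k x) x := by
  have h : HasDerivAt (fun y : ℝ => (k : ℂ) * y * Complex.I) ((k : ℂ) * 1 * Complex.I) x :=
    ((Complex.ofRealCLM.hasDerivAt (x := x)).const_mul (k : ℂ)).mul_const _
  convert h.cexp using 1
  · rfl
  · simp only [ek]; ring

lemma continuous_ek (k : ℤ) : Continuous (ek k) := by
  unfold ek; fun_prop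

lemma integral_ek (k : ℤ) : ∫ x in (0 : ℝ)..2 * π, ek k x = if k = 0 then 2 * π else 0 := by
  split_ifs with h
  · subst h; simp
  · have h1 := integral_deriv_per (ek_per k) (hasDerivAt_ek k)
      (continuous_const.mul (continuous_ek k))
    rw [intervalIntegral.integral_const_mul] at h1
    exact (mul_eq_zero.mp h1).resolve_left (by simp [h])

/-- Fourier coefficients of a `2π`-periodic function. -/
noncomputable def fc (f : ℝ → ℂ) (k : ℤ) : ℂ :=
  (2 * π : ℂ)⁻¹ * ∫ x in (0 : ℝ)..2 * π, f x * ek (-k) x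

lemma two_pi_ne_zero_complex : (2 * π : ℂ) ≠ 0 := by
  exact_mod_cast two_pi_pos.ne'

lemma norm_fc_le {f : ℝ → ℂ} {M : ℝ} (h : ∀ x, ‖f x‖ ≤ M) (k : ℤ) : ‖fc f k‖ ≤ M := by
  have h1 := intervalIntegral.norm_integral_le_of_norm_le_const (a := 0) (b := 2 * π)
    (f := fun x => f x * ek (-k) x) (C := M) (fun x _ => by simpa using h x)
  rw [sub_zero, abs_of_pos two_pi_pos] at h1
  have h2 := two_pi_pos
  rw [fc, norm_mul]
  have h3 : ‖((2 * π : ℂ))⁻¹‖ = (2 * π)⁻¹ := by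
    rw [norm_inv]; congr 1
    rw [← Complex.ofReal_ofNat, ← Complex.ofReal_mul, Complex.norm_real,
      Real.norm_of_nonneg h2.le]
  rw [h3]
  calc (2 * π)⁻¹ * _ ≤ (2 * π)⁻¹ * (M * (2 * π)) := by gcongr
    _ = M := by field_simp

lemma fc_deriv {f f' : ℝ → ℂ} (hf : Per f) (hd : ∀ x, HasDerivAt f (f' x) x) (hc : Continuous f')
    (k : ℤ) : fc f' k = Complex.I * k * fc f k := by
  have h := integral_parts_per (ek_per (-k)) hf (hasDerivAt_ek (-k)) hd
    (continuous_const.mul (continuous_ek (-k))) hc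
  unfold fc
  simp_rw [mul_comm (f' _), h]
  have : ∀ x, Complex.I * ((-k : ℤ) : ℂ) * ek (-k) x * f x
      = -(Complex.I * k) * (f x * ek (-k) x) := fun x => by push_cast; ring
  simp_rw [this, intervalIntegral.integral_const_mul]
  ring

lemma hasDerivAt_iter {f : ℝ → ℂ} (hf : ContDiff ℝ (⊤ : ℕ∞) f) (x : ℝ) :
    HasDerivAt f (deriv f x) x :=
  (hf.differentiable (by simp) x).hasDerivAt

lemma ContDiff.deriv_top {E : Type*} [NormedAddCommGroup E] [NormedSpace ℝ E] {f : ℝ → E}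
    (hf : ContDiff ℝ (⊤ : ℕ∞) f) : ContDiff ℝ (⊤ : ℕ∞) (deriv f) :=
  ((contDiff_infty_iff_deriv (𝕜 := ℝ) (F := E)).1 hf).2

lemma fc_decay {f : ℝ → ℂ} (hf : ContDiff ℝ (⊤ : ℕ∞) f) (hp : Per f) (n : ℕ) :
    ∃ C, ∀ k, ‖fc f k‖ ≤ C / wt k ^ n := by
  induction n generalizing f with
  | zero =>
    obtain ⟨M, hM⟩ := hp.exists_bound hf.continuous
    exact ⟨M, fun k => by simpa using norm_fc_le hM k⟩
  | succ n ih =>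
    obtain ⟨C, hC⟩ := ih hf hp
    obtain ⟨D, hD⟩ := ih (ContDiff.deriv_top hf) (hp.deriv (hasDerivAt_iter hf))
    refine ⟨C + D, fun k => ?_⟩
    have h1 := hD k
    rw [fc_deriv hp (hasDerivAt_iter hf) (ContDiff.deriv_top hf).continuous, norm_mul, norm_mul,
      Complex.norm_I, Complex.norm_intCast, one_mul] at h1
    have h2 := hC k
    have hw := wt_pos k
    rw [le_div_iff₀ (by positivity)] at h1 h2 ⊢
    rw [pow_succ]
    nth_rewrite 2 [wt]
    linarith

lemma summable_of_decay {a : ℤ → ℂ} (h : ∀ n : ℕ, ∃ C, ∀ k, ‖a k‖ ≤ C / wt k ^ n) :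
    Summable fun k => ‖a k‖ := by
  obtain ⟨C, hC⟩ := h 2
  exact Summable.of_nonneg_of_le (fun _ => norm_nonneg _) hC (summable_div_wt_pow C 0)

lemma hasSum_integral_of_norm {F : ℤ → ℝ → ℂ} {f : ℝ → ℂ} {u : ℤ → ℝ} (hF : ∀ k, Continuous (F k))
    (hb : ∀ k x, ‖F k x‖ ≤ u k) (hu : Summable u) (hs : ∀ x, HasSum (fun k => F k x) (f x))
    (a b : ℝ) : HasSum (fun k => ∫ x in a..b, F k x) (∫ x in a..b, f x) :=
  intervalIntegral.hasSum_integral_of_dominated_convergence (fun k _ => u k)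
    (fun k => (hF k).aestronglyMeasurable) (fun k => .of_forall fun x _ => hb k x)
    (.of_forall fun _ _ => hu) intervalIntegrable_const (.of_forall fun x _ => hs x)

/-- Fourier coefficients of an absolutely convergent trigonometric series. -/
lemma fc_of_hasSum {a : ℤ → ℂ} {f : ℝ → ℂ} (ha : Summable fun k => ‖a k‖)
    (hs : ∀ x, HasSum (fun k => a k * ek k x) (f x)) (k : ℤ) : fc f k = a k := by
  have h := hasSum_integral_of_norm (F := fun j x => a j * ek j x * ek (-k) x)
    (f := fun x => f x * ek (-k) x) (u := fun j => ‖a j‖)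
    (fun j => (continuous_const.mul (continuous_ek j)).mul (continuous_ek _))
    (fun j x => by simp) ha (fun x => (hs x).mul_right _) 0 (2 * π)
  have h2 : ∀ j, ∫ x in (0 : ℝ)..2 * π, a j * ek j x * ek (-k) x
      = if j = k then a k * (2 * π) else 0 := by
    intro j
    simp_rw [mul_assoc, ← ek_add]
    rw [intervalIntegral.integral_const_mul, integral_ek]
    by_cases hj : j = k
    · subst hj; simp
    · simp [hj, show ¬ (j + -k = 0) by omega]
  simp_rw [h2] at h
  rw [fc, h.unique (hasSum_ite_eq k _)]
  have := two_pi_ne_zero_complex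
  field_simp

lemma hasSum_fc {f : ℝ → ℂ} (hf : ContDiff ℝ (⊤ : ℕ∞) f) (hp : Per f) (x : ℝ) :
    HasSum (fun k => fc f k * ek k x) (f x) := by
  have : Fact (0 < 2 * π) := ⟨two_pi_pos⟩
  have hp' : Function.Periodic f (2 * π) := hp
  have hc : Continuous (hp'.lift : AddCircle (2 * π) → ℂ) :=
    continuous_coinduced_dom.mpr hf.continuous
  let g : C(AddCircle (2 * π), ℂ) := ⟨hp'.lift, hc⟩
  have hfour : ∀ (k : ℤ) (y : ℝ), fourier k (y : AddCircle (2 * π)) = ek k y := by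
    intro k y
    rw [fourier_coe_apply, ek]
    congr 1
    have := two_pi_ne_zero_complex
    push_cast
    field_simp
  have hco : ∀ k, fourierCoeff g k = fc f k := by
    intro k
    rw [fourierCoeff_eq_intervalIntegral g k 0, zero_add, fc, Complex.real_smul]
    simp_rw [hfour, smul_eq_mul]
    have : ∀ y : ℝ, g (y : AddCircle (2 * π)) = f y := fun y => rfl
    simp_rw [this, mul_comm (ek _ _)]
    push_cast
    rw [one_div]
  have hs : Summable (fourierCoeff g) := by
    rw [show fourierCoeff g = fc f from funext hco]
    exact (summable_of_decay (fc_decay hf hp)).of_norm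
  have h := has_pointwise_sum_fourier_series_of_summable hs (x : AddCircle (2 * π))
  simp_rw [hco, hfour, smul_eq_mul] at h
  exact h

lemma hasSum_parseval {f : ℝ → ℂ} (hf : ContDiff ℝ (⊤ : ℕ∞) f) (hp : Per f) :
    HasSum (fun k => ‖fc f k‖ ^ 2) ((2 * π)⁻¹ * ∫ x in (0 : ℝ)..2 * π, ‖f x‖ ^ 2) := by
  obtain ⟨M, hM⟩ := hp.exists_bound hf.continuous
  have ha := summable_of_decay (fc_decay hf hp)
  have hcc : Continuous fun x => starRingEnd ℂ (f x) := Complex.continuous_conj.comp hf.continuous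
  have h := hasSum_integral_of_norm (F := fun j x => fc f j * ek j x * starRingEnd ℂ (f x))
    (f := fun x => f x * starRingEnd ℂ (f x)) (u := fun j => ‖fc f j‖ * M)
    (fun j => (continuous_const.mul (continuous_ek j)).mul hcc)
    (fun j x => by
      rw [norm_mul, norm_mul, norm_ek, mul_one, RCLike.norm_conj]
      exact mul_le_mul_of_nonneg_left (hM x) (norm_nonneg _)) (ha.mul_right M)
    (fun x => (hasSum_fc hf hp x).mul_right _) 0 (2 * π)
  have h2 : ∀ j, ∫ x in (0 : ℝ)..2 * π, fc f j * ek j x * starRingEnd ℂ (f x)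
      = ((2 * π * ‖fc f j‖ ^ 2 : ℝ) : ℂ) := by
    intro j
    simp_rw [mul_assoc]
    rw [intervalIntegral.integral_const_mul]
    have : ∀ x, ek j x * starRingEnd ℂ (f x) = starRingEnd ℂ (f x * ek (-j) x) := fun x => by
      rw [map_mul, ek_neg, Complex.conj_conj, mul_comm]
    simp_rw [this]
    have hcj : ∫ x in (0 : ℝ)..2 * π, starRingEnd ℂ (f x * ek (-j) x)
        = starRingEnd ℂ (∫ x in (0 : ℝ)..2 * π, f x * ek (-j) x) :=
      Complex.conjCLE.toContinuousLinearMap.intervalIntegral_comp_comm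
        ((hf.continuous.mul (continuous_ek (-j))).intervalIntegrable _ _)
    have hI : ∫ x in (0 : ℝ)..2 * π, f x * ek (-j) x = 2 * π * fc f j := by
      rw [fc, mul_inv_cancel_left₀ two_pi_ne_zero_complex]
    rw [hcj, hI, map_mul, mul_left_comm, Complex.mul_conj, Complex.normSq_eq_norm_sq]
    simp [Complex.conj_ofReal, Complex.conj_ofNat, mul_assoc]
  simp_rw [h2, Complex.mul_conj, Complex.normSq_eq_norm_sq] at h
  rw [intervalIntegral.integral_ofReal, Complex.hasSum_ofReal] at h
  have h3 := h.mul_left (2 * π)⁻¹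
  have := two_pi_pos
  have h4 : (fun k => ‖fc f k‖ ^ 2) = fun k => (2 * π)⁻¹ * (2 * π * ‖fc f k‖ ^ 2) := by
    funext k; field_simp
  rw [h4]
  exact_mod_cast h3

/-- Wirtinger's inequality. -/
lemma wirtinger {f f' : ℝ → ℂ} (hf : ContDiff ℝ (⊤ : ℕ∞) f) (hp : Per f)
    (hd : ∀ x, HasDerivAt f (f' x) x) (h0 : ∫ x in (0 : ℝ)..2 * π, f x = 0) :
    ∫ x in (0 : ℝ)..2 * π, ‖f x‖ ^ 2 ≤ ∫ x in (0 : ℝ)..2 * π, ‖f' x‖ ^ 2 := by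
  have hf' : ContDiff ℝ (⊤ : ℕ∞) f' := by
    rw [show f' = deriv f from funext fun x => (hd x).deriv.symm]
    exact ContDiff.deriv_top hf
  have h1 := hasSum_parseval hf hp
  have h2 := hasSum_parseval hf' (hp.deriv hd)
  have h3 := hasSum_le (fun k => ?_) h1 h2
  · exact le_of_mul_le_mul_left h3 (inv_pos.2 two_pi_pos)
  · rw [fc_deriv hp hd hf'.continuous, norm_mul, norm_mul, Complex.norm_I, Complex.norm_intCast,
      one_mul, mul_pow, sq_abs]
    rcases eq_or_ne k 0 with rfl | hk
    · simp [fc, h0]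
    · have : (1 : ℝ) ≤ (k : ℝ) ^ 2 := by
        have : (1 : ℤ) ≤ k ^ 2 := by have := sq_pos_of_ne_zero hk; omega
        exact_mod_cast this
      nlinarith [sq_nonneg ‖fc f k‖]

lemma HasSum.congr_fun' {f g : ℤ → ℂ} {a : ℂ} (h : HasSum f a) (hfg : ∀ k, g k = f k) :
    HasSum g a := by
  rwa [funext hfg]

lemma hasSum_conv {a b : ℤ → ℂ} (ha : Summable fun k => ‖a k‖) (hb : Summable fun k => ‖b k‖) :
    (∀ k, Summable fun j => a j * b (k - j)) ∧
    HasSum (fun k => ∑' j, a j * b (k - j)) ((∑' k, a k) * ∑' k, b k) := by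
  let e : ℤ × ℤ ≃ ℤ × ℤ :=
    ⟨fun p => (p.2, p.1 - p.2), fun q => (q.1 + q.2, q.1), fun p => by simp, fun q => by simp⟩
  have hs := summable_mul_of_summable_norm ha hb
  have hs' : Summable fun p : ℤ × ℤ => a p.2 * b (p.1 - p.2) := e.summable_iff.2 hs
  have ht : ∑' p : ℤ × ℤ, a p.2 * b (p.1 - p.2) = (∑' k, a k) * ∑' k, b k := by
    rw [tsum_mul_tsum_of_summable_norm ha hb]
    exact e.tsum_eq fun p : ℤ × ℤ => a p.1 * b p.2
  have hk : ∀ k, Summable fun j => a j * b (k - j) := fun k => hs'.prod_factor k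
  refine ⟨hk, ?_⟩
  rw [← ht]
  exact hs'.hasSum.prod_fiberwise fun k => (hk k).hasSum

/-- The trigonometric series with time dependent coefficients. -/
noncomputable def Fs (f : ℤ → ℝ → ℂ) (x t : ℝ) : ℂ := ∑' k, f k t * ek k x

/-- The coefficients of the space derivative. -/
noncomputable def ikm (f : ℤ → ℝ → ℂ) (k : ℤ) (t : ℝ) : ℂ := Complex.I * k * f k t

lemma SP_ik (n : ℕ) : SP n fun (k : ℤ) (_ : ℝ) => Complex.I * (k : ℂ) := by
  refine SP.of_const (C := 1) (m := 1) (fun k => ?_) n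
  rw [norm_mul, Complex.norm_I, Complex.norm_intCast, wt]
  linarith

lemma SR.ikm {n : ℕ} {f : ℤ → ℝ → ℂ} (hf : SR n f) : SR n (ikm f) := SR.sp_mul (SP_ik n) hf

lemma Rap.exists_summable {f : ℤ → ℝ → ℂ} (hf : Rap f) (T : ℝ) :
    ∃ u : ℤ → ℝ, Summable u ∧ ∀ k t, |t| ≤ T → ‖f k t‖ ≤ u k := by
  obtain ⟨C, hC⟩ := hf.2 2 T
  exact ⟨_, summable_div_wt_pow C 0, hC⟩

lemma Rap.summable_norm {f : ℤ → ℝ → ℂ} (hf : Rap f) (t : ℝ) : Summable fun k => ‖f k t‖ := by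
  obtain ⟨u, hu, h⟩ := hf.exists_summable |t|
  exact Summable.of_nonneg_of_le (fun _ => norm_nonneg _) (fun k => h k t le_rfl) hu

lemma Rap.hasSum_Fs {f : ℤ → ℝ → ℂ} (hf : Rap f) (x t : ℝ) :
    HasSum (fun k => f k t * ek k x) (Fs f x t) := by
  refine (Summable.of_norm ?_).hasSum
  simpa using hf.summable_norm t

lemma Rap.continuous_Fs {f : ℤ → ℝ → ℂ} (hf : Rap f) :
    Continuous fun p : ℝ × ℝ => Fs f p.1 p.2 := by
  refine continuous_tsum_loc (r := fun p : ℝ × ℝ => |p.2|) (by fun_prop) (fun k => ?_) fun T => ?_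
  · exact ((hf.1 k).comp continuous_snd).mul ((continuous_ek k).comp continuous_fst)
  · obtain ⟨u, hu, h⟩ := hf.exists_summable T
    exact ⟨u, hu, fun k p hp => by simpa using h k p.2 hp⟩

lemma Rap.hasDerivAt_Fs_x {f : ℤ → ℝ → ℂ} (hf : Rap f) (x t : ℝ) :
    HasDerivAt (fun y => Fs f y t) (Fs (ikm f) x t) x := by
  have hg : Rap (ikm f) := SR.ikm (n := 0) hf
  refine hasDerivAt_tsum_loc (F := fun k y => f k t * ek k y)
    (F' := fun k y => AffineFlow.ikm f k t * ek k y) (fun k y => ?_)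
    (fun y => (hf.hasSum_Fs y t).summable) (fun T => ?_) x
  · refine ((hasDerivAt_ek k y).const_mul (f k t)).congr_deriv ?_
    simp only [AffineFlow.ikm]; ring
  · exact ⟨_, hg.summable_norm t, fun k y _ => by simp⟩

lemma hasDerivAt_Fs_t {f f' : ℤ → ℝ → ℂ} (hf : Rap f) (hd : ∀ k t, HasDerivAt (f k) (f' k t) t)
    (hf' : Rap f') (x t : ℝ) : HasDerivAt (fun s => Fs f x s) (Fs f' x t) t := by
  refine hasDerivAt_tsum_loc (F := fun k s => f k s * ek k x)
    (F' := fun k s => f' k s * ek k x) (fun k s => (hd k s).mul_const _)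
    (fun s => (hf.hasSum_Fs x s).summable) (fun T => ?_) t
  obtain ⟨u, hu, h⟩ := hf'.exists_summable T
  exact ⟨u, hu, fun k s hs => by simpa using h k s hs⟩

lemma SR.contDiff_Fs {n : ℕ} : ∀ {f : ℤ → ℝ → ℂ}, SR n f →
    ContDiff ℝ n fun p : ℝ × ℝ => Fs f p.1 p.2 := by
  induction n with
  | zero => exact fun hf => contDiff_zero.2 hf.rap.continuous_Fs
  | succ n ih =>
    intro f hf
    have h := hf.of_succ.ikm
    obtain ⟨hr, f', hd, hf'⟩ := hf
    exact contDiff_succ_of_partials hr.hasDerivAt_Fs_x (hasDerivAt_Fs_t hr hd hf'.rap) (ih h)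
      (ih hf')

lemma SR.sm_Fs {f : ℤ → ℝ → ℂ} (hf : ∀ n, SR n f) : Sm (Fs f) :=
  sm_iff.2 fun n => (hf n).contDiff_Fs

lemma Fs_per (f : ℤ → ℝ → ℂ) (t : ℝ) : Per fun x => Fs f x t := fun x => by
  simp only [Fs, ek_per _ x]

lemma Fs_conj {f : ℤ → ℝ → ℂ} (h : ∀ k t, f (-k) t = starRingEnd ℂ (f k t)) (x t : ℝ) :
    ((Fs f x t).re : ℂ) = Fs f x t := by
  rw [← Complex.conj_eq_iff_re]
  unfold Fs
  rw [Complex.conj_tsum, ← (Equiv.neg ℤ).tsum_eq]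
  refine tsum_congr fun k => ?_
  simp only [Equiv.neg_apply, map_mul]
  rw [h, ek_neg, Complex.conj_conj, Complex.conj_conj]

/-- The nonlinear term of the curvature equation as a product of series. -/
lemma Fs_Bq {c : ℤ → ℝ → ℂ} (hc : Rap c) {w e : ℤ → ℝ → ℂ}
    (he : e = fun k t => if k = 0 then 0 else c k t)
    (hw : w = fun k t => c k t / (Complex.I * k)) (x t : ℝ) (hwr : Rap w) (her : Rap e) :
    Fs (fun k t => Bq (fun j => c j t) (fun j => c j t) k) x t
      = Fs c x t * Fs e x t + 1 / 2 * (Fs w x t * Fs (ikm c) x t) := by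
  have hik : Rap (ikm c) := SR.ikm (n := 0) hc
  have hn : ∀ {f : ℤ → ℝ → ℂ}, Rap f → Summable fun k => ‖f k t * ek k x‖ := fun hf => by
    simpa using hf.summable_norm t
  obtain ⟨s1, h1⟩ := hasSum_conv (hn her) (hn hc)
  obtain ⟨s2, h2⟩ := hasSum_conv (hn hwr) (hn hik)
  have h3 := h1.add (h2.mul_left (1 / 2))
  have h4 : (∑' k, e k t * ek k x) * (∑' k, c k t * ek k x) +
      1 / 2 * ((∑' k, w k t * ek k x) * ∑' k, ikm c k t * ek k x)
      = Fs c x t * Fs e x t + 1 / 2 * (Fs w x t * Fs (ikm c) x t) := by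
    simp only [Fs]; ring
  rw [← h4, ← h3.tsum_eq]
  refine tsum_congr fun k => ?_
  have hB : Bq (fun j => c j t) (fun j => c j t) k
      = ∑' j, (bco k j : ℂ) * c j t * c (k - j) t := rfl
  beta_reduce
  rw [hB, ← tsum_mul_left, ← (s1 k).tsum_add ((s2 k).mul_left _), ← tsum_mul_right]
  refine tsum_congr fun j => ?_
  have hek : ek k x = ek j x * ek (k - j) x := by rw [← ek_add]; congr 1; ring
  rw [hek]
  subst he hw
  simp only [ikm, bco]
  by_cases hj : j = 0
  · simp [hj]
  · have hj' : (j : ℂ) ≠ 0 := by exact_mod_cast hj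
    rw [if_neg hj]
    have hI := Complex.I_ne_zero
    push_cast
    field_simp
    ring

theorem exists_curvature {R : ℝ} (hR : 0 < R) {κ₀ : ℝ → ℝ} (h0 : ContDiff ℝ (⊤ : ℕ∞) κ₀)
    (hper : Per κ₀) :
    ∃ (c : ℤ → ℝ → ℂ) (κ W : ℝ → ℝ → ℝ), Rap c ∧
      (∀ k t, c k t = fc (fun x => (κ x t : ℂ)) k) ∧
      (∀ k t, HasDerivAt (c k)
        ((tcut k t : ℂ) * (-((k : ℂ) ^ 2 / 4) * c k t + Bclip R (fun j => c j t) k)) t) ∧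
      Sm κ ∧ Sm W ∧ (∀ t, Per fun x => κ x t) ∧ (∀ t, Per fun x => W x t) ∧
      (∀ x, κ x 0 = κ₀ x) ∧
      (∀ x t, dx W x t = κ x t - (2 * π)⁻¹ * ∫ y in (0 : ℝ)..2 * π, κ y t) ∧
      ∀ t, 0 ≤ t → (∀ k, ‖c k t‖ * wt k ≤ R) → ∀ x, dt κ x t = 1 / 4 * dx (dx κ) x t
        + κ x t * (κ x t - (2 * π)⁻¹ * ∫ y in (0 : ℝ)..2 * π, κ y t) + 1 / 2 * W x t * dx κ x t := by
  have h0c : ContDiff ℝ (⊤ : ℕ∞) fun x => (κ₀ x : ℂ) := Complex.ofRealCLM.contDiff.comp h0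
  have hperc : Per fun x => (κ₀ x : ℂ) := fun x => by simp only [hper x]
  have hconj : ∀ k, fc (fun x => (κ₀ x : ℂ)) (-k) = starRingEnd ℂ (fc (fun x => (κ₀ x : ℂ)) k) := by
    intro k
    have hcj : ∫ x in (0 : ℝ)..2 * π, starRingEnd ℂ ((κ₀ x : ℂ) * ek (-k) x)
        = starRingEnd ℂ (∫ x in (0 : ℝ)..2 * π, (κ₀ x : ℂ) * ek (-k) x) :=
      Complex.conjCLE.toContinuousLinearMap.intervalIntegral_comp_comm
        ((h0c.continuous.mul (continuous_ek (-k))).intervalIntegrable _ _)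
    rw [fc, fc, map_mul, ← hcj]
    simp only [map_mul, map_inv₀, Complex.conj_ofReal, ek_neg, Complex.conj_conj, neg_neg,
      Complex.conj_ofNat]
  obtain ⟨c, hSR, hcc, hc0, hcd⟩ := exists_smooth_mild hR (fc_decay h0c hperc) hconj
  have hrap : Rap c := (hSR 0).rap
  set w : ℤ → ℝ → ℂ := fun k t => c k t / (Complex.I * k) with hw
  set e : ℤ → ℝ → ℂ := fun k t => if k = 0 then 0 else c k t with he
  have hwSR : ∀ n, SR n w := fun n => by
    have h := SR.sp_mul (SP.of_const (a := fun k : ℤ => (Complex.I * (k : ℂ))⁻¹) (C := 1) (m := 0)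
      (fun k => ?_) n) (hSR n)
    · rw [hw]
      simpa only [div_eq_mul_inv, mul_comm] using h
    · rw [norm_inv, norm_mul, Complex.norm_I, one_mul, Complex.norm_intCast, pow_zero, mul_one]
      by_cases hk : k = 0
      · simp [hk]
      · refine inv_le_one_of_one_le₀ ?_
        have : 1 ≤ |k| := Int.one_le_abs hk
        exact_mod_cast this
  have heSR : ∀ n, SR n e := fun n => by
    have h := SR.sp_mul (SP.of_const (a := fun k : ℤ => if k = 0 then (0 : ℂ) else 1) (C := 1)
      (m := 0) (fun k => ?_) n) (hSR n)
    · rw [he]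
      simpa only [ite_mul, zero_mul, one_mul] using h
    · split_ifs <;> simp
  have hike : ikm w = e := by
    funext k t
    simp only [ikm, hw, he]
    split_ifs with hk
    · simp [hk]
    · have hk' : (k : ℂ) ≠ 0 := by exact_mod_cast hk
      have := Complex.I_ne_zero
      field_simp
  have hwc : ∀ k t, w (-k) t = starRingEnd ℂ (w k t) := fun k t => by
    simp only [hw, hcc, map_div₀, map_mul, Complex.conj_I, map_intCast]
    push_cast
    ring_nf
  have hκ : ∀ x t, ((Fs c x t).re : ℂ) = Fs c x t := Fs_conj hcc
  have hW : ∀ x t, ((Fs w x t).re : ℂ) = Fs w x t := Fs_conj hwc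
  have hfc : ∀ k t, c k t = fc (fun x => ((Fs c x t).re : ℂ)) k := by
    intro k t
    simp only [hκ]
    exact (fc_of_hasSum (hrap.summable_norm t) (fun x => hrap.hasSum_Fs x t) k).symm
  have hmean : ∀ t, (((2 * π)⁻¹ * ∫ y in (0 : ℝ)..2 * π, (Fs c y t).re : ℝ) : ℂ) = c 0 t := by
    intro t
    rw [hfc 0 t, fc]
    simp only [neg_zero, ek_zero, mul_one]
    rw [intervalIntegral.integral_ofReal]
    push_cast; rfl
  have hec : ∀ x t, Fs e x t = Fs c x t - c 0 t := by
    intro x t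
    have h1 := (hrap.hasSum_Fs x t).sub (hasSum_ite_eq (0 : ℤ) (c 0 t))
    refine ((heSR 0).rap.hasSum_Fs x t).unique ?_
    refine (HasSum.congr_fun' h1 fun k => ?_)
    simp only [he]
    split_ifs with hk
    · simp [hk]
    · simp
  have hre : ∀ {f : ℤ → ℝ → ℂ}, (∀ n, SR n f) → Sm fun x t => (Fs f x t).re := fun hf =>
    Complex.reCLM.contDiff.comp (SR.sm_Fs hf)
  have hrex : ∀ {f : ℤ → ℝ → ℂ}, Rap f → ∀ x t,
      HasDerivAt (fun y => (Fs f y t).re) (Fs (ikm f) x t).re x := fun hf x t =>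
    Complex.reCLM.hasFDerivAt.comp_hasDerivAt x (hf.hasDerivAt_Fs_x x t)
  have hdx : ∀ {f : ℤ → ℝ → ℂ}, Rap f → dx (fun x t => (Fs f x t).re)
      = fun x t => (Fs (ikm f) x t).re := fun hf => by
    funext x t; exact (hrex hf x t).deriv
  refine ⟨c, fun x t => (Fs c x t).re, fun x t => (Fs w x t).re, hrap, hfc, hcd, hre hSR, hre hwSR,
    fun t x => by simp only [Fs_per c t x], fun t x => by simp only [Fs_per w t x], fun x => ?_,
    fun x t => ?_, fun t ht hin x => ?_⟩
  · have h1 := hasSum_fc h0c hperc x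
    have h2 := hrap.hasSum_Fs x 0
    simp only [hc0] at h2
    simp only [h2.unique h1, Complex.ofReal_re]
  · rw [hdx (hwSR 0).rap, hike]
    have h1 := congrArg Complex.re (hec x t)
    rw [Complex.sub_re, ← hmean t, Complex.ofReal_re] at h1
    exact h1
  · obtain ⟨-, c', hd', hc'⟩ := hSR 1
    have h1 : dt (fun x t => (Fs c x t).re) x t = (Fs c' x t).re :=
      (Complex.reCLM.hasFDerivAt.comp_hasDerivAt t (hasDerivAt_Fs_t hrap hd' hc'.rap x t)).deriv
    rw [h1, hdx hrap, hdx (SR.ikm (hSR 0)).rap]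
    have hcl : ∀ k, clipC (R / wt k) (c k t) = c k t := fun k =>
      clipC_eq_self (div_pos hR (wt_pos k)) ((le_div_iff₀ (wt_pos k)).2 (hin k))
    have hc't : ∀ k, c' k t = 1 / 4 * ikm (ikm c) k t + Bq (fun j => c j t) (fun j => c j t) k := by
      intro k
      rw [(hd' k t).unique (hcd k t), tcut_eq_one k ht, Bclip]
      simp only [hcl, ikm]
      have := Complex.I_sq
      push_cast
      linear_combination (-(k : ℂ) ^ 2 / 4 * c k t) * this
    have h2 : Fs c' x t = 1 / 4 * Fs (ikm (ikm c)) x t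
        + Fs (fun k t => Bq (fun j => c j t) (fun j => c j t) k) x t := by
      have h3 := ((SR.ikm (SR.ikm (hSR 0))).rap.hasSum_Fs x t).mul_left (1 / 4)
      refine (hc'.rap.hasSum_Fs x t).unique ?_
      refine (HasSum.congr_fun' (h3.add ((hrap.Bq hrap).hasSum_Fs x t)) fun k => ?_)
      rw [hc't k]; ring
    have h4 := congrArg Complex.re (h2.trans (congrArg _
      (Fs_Bq hrap he hw x t (hwSR 0).rap (heSR 0).rap)))
    have hik : ((Fs (ikm c) x t).re : ℂ) = Fs (ikm c) x t := Fs_conj (fun k t => by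
      simp only [ikm, hcc, map_mul, Complex.conj_I, map_intCast]
      push_cast
      ring) x t
    rw [hec, ← hmean, ← hW, ← hik, ← hκ x t] at h4
    rw [h4, ← Complex.ofReal_sub, ← Complex.ofReal_mul, ← Complex.ofReal_mul]
    rw [show (1 / 4 : ℂ) = ((1 / 4 : ℝ) : ℂ) by push_cast; rfl,
      show (1 / 2 : ℂ) = ((1 / 2 : ℝ) : ℂ) by push_cast; rfl]
    rw [Complex.add_re, Complex.add_re, Complex.re_ofReal_mul, Complex.re_ofReal_mul,
      Complex.ofReal_re, Complex.ofReal_re]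
    ring

lemma exists_bound_strip {g : ℝ → ℝ → ℝ} (hg : Continuous fun p : ℝ × ℝ => g p.1 p.2)
    (hp : ∀ t, Per (g · t)) (T : ℝ) : ∃ C : ℝ, 0 ≤ C ∧ ∀ x, ∀ t ∈ Set.Icc (-T) T, |g x t| ≤ C := by
  obtain ⟨C, hC⟩ := (isCompact_Icc (a := 0) (b := 2 * π)).prod (isCompact_Icc (a := -T) (b := T))
    |>.exists_bound_of_continuousOn hg.continuousOn
  refine ⟨max C 0, le_max_right _ _, fun x t ht => ?_⟩
  obtain ⟨y, hy, hxy⟩ := (show Function.Periodic (g · t) (2 * π) from hp t).exists_mem_Ico₀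
    two_pi_pos x
  rw [hxy]
  exact (hC (y, t) ⟨⟨hy.1, hy.2.le⟩, ht⟩).trans (le_max_left _ _)

lemma Sm.per_dx {f : ℝ → ℝ → ℝ} (hf : Sm f) (hp : ∀ t, Per (f · t)) (t : ℝ) :
    Per (AffineFlow.dx f · t) := (hp t).deriv fun x => hf.hasDerivAt_x x t

lemma Sm.lipschitz_strip {f : ℝ → ℝ → ℝ} (hf : Sm f) (hp : ∀ t, Per (f · t)) (T : ℝ) :
    ∃ K : NNReal, ∀ t ∈ Set.Icc (-T) T, LipschitzWith K (fun x => f x t) := by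
  obtain ⟨C, hC0, hC⟩ := exists_bound_strip hf.dx.continuous (hf.per_dx hp) T
  refine ⟨⟨C, hC0⟩, fun t ht => ?_⟩
  refine lipschitzWith_of_nnnorm_deriv_le (fun x => (hf.hasDerivAt_x x t).differentiableAt)
    fun x => ?_
  rw [(hf.hasDerivAt_x x t).deriv]
  exact hC x t ht

lemma exists_integral_curve {f : ℝ → ℝ → ℝ} (hf : Sm f) (hp : ∀ t, Per (f · t)) (x : ℝ) :
    ∃ y : ℝ → ℝ, y 0 = x ∧ ∀ t, HasDerivAt y (f (y t) t) t := by
  have hex : ∀ n : ℕ, ∃ y : ℝ → ℝ, y 0 = x ∧ ∀ t ∈ Set.Ioo (-((n : ℝ) + 1)) (n + 1),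
      HasDerivAt y (f (y t) t) t := by
    intro n
    obtain ⟨L, hL0, hL⟩ := exists_bound_strip hf.continuous hp ((n : ℝ) + 1)
    obtain ⟨K, hK⟩ := hf.lipschitz_strip hp ((n : ℝ) + 1)
    have hn : (0 : ℝ) < n + 1 := by positivity
    have hpl : IsPicardLindelof (fun t x => f x t)
        (⟨0, by constructor <;> linarith⟩ : Set.Icc (-((n : ℝ) + 1)) (n + 1)) x
        (⟨L, hL0⟩ * ⟨n + 1, hn.le⟩) 0 ⟨L, hL0⟩ K := by
      refine ⟨fun t ht => (hK t ht).lipschitzOnWith, fun z _ => (hf.continuous_right z).continuousOn,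
        fun t ht z _ => hL z t ht, ?_⟩
      simp only [sub_zero, zero_sub, neg_neg, max_self, NNReal.coe_zero]
      exact le_rfl
    obtain ⟨y, hy0, hy⟩ := hpl.exists_eq_forall_mem_Icc_hasDerivWithinAt₀
    exact ⟨y, hy0, fun t ht => (hy t ⟨ht.1.le, ht.2.le⟩).hasDerivAt (Icc_mem_nhds ht.1 ht.2)⟩
  choose y hy0 hy using hex
  have hle : ∀ n m : ℕ, n ≤ m → ∀ t ∈ Set.Ioo (-((n : ℝ) + 1)) (n + 1), y n t = y m t := by
    intro n m hnm
    have hnm' : (n : ℝ) ≤ m := by exact_mod_cast hnm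
    have hn : (0 : ℝ) < n + 1 := by positivity
    obtain ⟨K, hK⟩ := hf.lipschitz_strip hp ((n : ℝ) + 1)
    refine ODE_solution_unique_of_mem_Ioo (v := fun t x => f x t) (s := fun _ => Set.univ) (K := K)
      (t₀ := 0) (fun t ht => (hK t ⟨ht.1.le, ht.2.le⟩).lipschitzOnWith) ⟨by linarith, hn⟩
      (fun t ht => ⟨hy n t ht, trivial⟩)
      (fun t ht => ⟨hy m t ⟨by linarith [ht.1], by linarith [ht.2]⟩, trivial⟩) ?_
    rw [hy0, hy0]
  have heq : ∀ (n : ℕ) (t : ℝ), t ∈ Set.Ioo (-((n : ℝ) + 1)) (n + 1) → y ⌈|t|⌉₊ t = y n t := by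
    intro n t ht
    rcases le_total ⌈|t|⌉₊ n with h | h
    · refine hle _ _ h t ?_
      have := Nat.le_ceil |t|
      have h1 := neg_abs_le t
      have h2 := le_abs_self t
      constructor <;> linarith
    · exact (hle _ _ h t ht).symm
  refine ⟨fun t => y ⌈|t|⌉₊ t, by simp [hy0], fun t => ?_⟩
  have ht : t ∈ Set.Ioo (-((⌈|t|⌉₊ : ℝ) + 1)) (⌈|t|⌉₊ + 1) := by
    have := Nat.le_ceil |t|
    have h1 := neg_abs_le t
    have h2 := le_abs_self t
    constructor <;> linarith
  refine (hy _ t ht).congr_of_eventuallyEq ?_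
  filter_upwards [Ioo_mem_nhds ht.1 ht.2] with s hs using heq _ s hs

lemma contDiff_primitive (n : ℕ) {h : ℝ → ℝ → ℝ}
    (hh : ContDiff ℝ n fun p : ℝ × ℝ => h p.1 p.2) :
    ContDiff ℝ n fun p : ℝ × ℝ => ∫ s in (0 : ℝ)..p.2, h p.1 s := by
  induction n generalizing h with
  | zero =>
    rw [Nat.cast_zero, contDiff_zero] at hh ⊢
    exact intervalIntegral.continuous_parametric_primitive_of_continuous hh
  | succ n ih =>
    have hd : ∀ p : ℝ × ℝ, HasFDerivAt (fun p : ℝ × ℝ => h p.1 p.2)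
        (fderiv ℝ (fun p : ℝ × ℝ => h p.1 p.2) p) p := fun p =>
      (hh.differentiable (by simp) p).hasFDerivAt
    have hx : ∀ x t, HasDerivAt (fun y => h y t)
        (fderiv ℝ (fun p : ℝ × ℝ => h p.1 p.2) (x, t) (1, 0)) x := fun x t =>
      HasFDerivAt.comp_hasDerivAt (l := fun p : ℝ × ℝ => h p.1 p.2) (f := fun y => (y, t)) x
        (hd (x, t)) ((hasDerivAt_id x).prodMk (hasDerivAt_const x t))
    have hc : ContDiff ℝ n fun p : ℝ × ℝ => fderiv ℝ (fun p : ℝ × ℝ => h p.1 p.2) p (1, 0) :=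
      (hh.fderiv_right (m := n) (by simp)).clm_apply contDiff_const
    refine contDiff_succ_of_partials (f := fun x t => ∫ s in (0 : ℝ)..t, h x s) (ft := h)
      (fx := fun x t => ∫ s in (0 : ℝ)..t, fderiv ℝ (fun p : ℝ × ℝ => h p.1 p.2) (x, s) (1, 0))
      (fun x t => ?_) (fun x t => ?_)
      (ih (h := fun x s => fderiv ℝ (fun p : ℝ × ℝ => h p.1 p.2) (x, s) (1, 0)) hc)
      (hh.of_le (by simp))
    · exact hasDerivAt_integral_param (f := fun s y => h y s)
        (f' := fun s y => fderiv ℝ (fun p : ℝ × ℝ => h p.1 p.2) (y, s) (1, 0))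
        (hh.continuous.comp continuous_swap) (hc.continuous.comp continuous_swap)
        (fun s y => hx y s) x
    · have hcs : Continuous fun s => h x s := hh.continuous.comp (Continuous.prodMk_right x)
      exact intervalIntegral.integral_hasDerivAt_right (hcs.intervalIntegrable _ _)
        (hcs.stronglyMeasurableAtFilter _ _) hcs.continuousAt

lemma Sm.primitive {h : ℝ → ℝ → ℝ} (hh : Sm h) : Sm fun x t => ∫ s in (0 : ℝ)..t, h x s :=
  sm_iff.2 fun n => contDiff_primitive n (sm_iff.1 hh n)

lemma eq_exp_of_linear {y m : ℝ → ℝ} (hm : Continuous m) (hy : ∀ t, HasDerivAt y (m t * y t) t)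
    (t : ℝ) : y t = y 0 * exp (∫ s in (0 : ℝ)..t, m s) := by
  have hP : ∀ t, HasDerivAt (fun t => ∫ s in (0 : ℝ)..t, m s) (m t) t := fun t =>
    intervalIntegral.integral_hasDerivAt_right (hm.intervalIntegrable _ _)
      (hm.stronglyMeasurableAtFilter _ _) hm.continuousAt
  have hz : ∀ t, HasDerivAt (fun t => y t * exp (-∫ s in (0 : ℝ)..t, m s)) 0 t := fun t =>
    ((hy t).mul (hP t).neg.exp).congr_deriv (by ring)
  have := is_const_of_deriv_eq_zero (fun t => (hz t).differentiableAt) (fun t => (hz t).deriv) t 0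
  simp only [intervalIntegral.integral_same, neg_zero, exp_zero, mul_one] at this
  rw [← this, mul_assoc, ← exp_add, neg_add_cancel, exp_zero, mul_one]

/-- Mean of the spatial derivative of `f` along the segment from `a` to `b`. -/
noncomputable def mslope (f : ℝ → ℝ → ℝ) (a b t : ℝ) : ℝ := ∫ s in (0 : ℝ)..1, dx f (a + s * (b - a)) t

lemma Sm.mslope_mul {f : ℝ → ℝ → ℝ} (hf : Sm f) (a b t : ℝ) :
    mslope f a b t * (b - a) = f b t - f a t := by
  have hd : ∀ s : ℝ, HasDerivAt (fun s => f (a + s * (b - a)) t)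
      (AffineFlow.dx f (a + s * (b - a)) t * (b - a)) s := fun s => by
    have h1 : HasDerivAt (fun s : ℝ => a + s * (b - a)) (b - a) s := by
      simpa using ((hasDerivAt_id s).mul_const (b - a)).const_add a
    exact (hf.hasDerivAt_x _ t).comp s h1
  have hc : Continuous fun s : ℝ => AffineFlow.dx f (a + s * (b - a)) t :=
    (hf.dx.continuous_left t).comp (by fun_prop)
  have := intervalIntegral.integral_eq_sub_of_hasDerivAt (a := 0) (b := 1) (fun s _ => hd s)
    ((hc.mul continuous_const).intervalIntegrable _ _)
  rw [intervalIntegral.integral_mul_const] at this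
  rw [mslope, this]
  simp

lemma Sm.continuous_mslope {f : ℝ → ℝ → ℝ} (hf : Sm f) :
    Continuous fun q : ℝ × ℝ × ℝ => mslope f q.1 q.2.1 q.2.2 := by
  refine intervalIntegral.continuous_parametric_intervalIntegral_of_continuous'
    (f := fun (q : ℝ × ℝ × ℝ) s => AffineFlow.dx f (q.1 + s * (q.2.1 - q.1)) q.2.2) ?_ 0 1
  exact hf.dx.continuous.comp (g := fun p : ℝ × ℝ => AffineFlow.dx f p.1 p.2)
    (f := fun r : (ℝ × ℝ × ℝ) × ℝ => (r.1.1 + r.2 * (r.1.2.1 - r.1.1), r.1.2.2)) (by fun_prop)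

lemma mslope_self (f : ℝ → ℝ → ℝ) (a t : ℝ) : mslope f a a t = dx f a t := by simp [mslope]

lemma abs_mslope_le {f : ℝ → ℝ → ℝ} {C t : ℝ} (h : ∀ x, |dx f x t| ≤ C) (a b : ℝ) :
    |mslope f a b t| ≤ C := by
  have := intervalIntegral.norm_integral_le_of_norm_le_const (a := 0) (b := 1)
    (f := fun s => dx f (a + s * (b - a)) t) (C := C) fun s _ => h _
  simpa [mslope] using this

/-- The flow of a smooth time-dependent vector field on the circle, lifted to `ℝ`. -/
theorem exists_flow {f : ℝ → ℝ → ℝ} (hf : Sm f) (hp : ∀ t, Per (f · t)) :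
    ∃ Y : ℝ → ℝ → ℝ, Sm Y ∧ (∀ x, Y x 0 = x) ∧ (∀ x t, dt Y x t = f (Y x t) t) ∧
      (∀ x t, 0 < dx Y x t) ∧ ∀ x t, Y (x + 2 * π) t = Y x t + 2 * π := by
  choose Y hY0 hY using exists_integral_curve hf hp
  have hYc : ∀ x, Continuous (Y x) := fun x => continuous_iff_continuousAt.2
    fun t => (hY x t).continuousAt
  have hmc : ∀ x z, Continuous fun t => mslope f (Y x t) (Y z t) t := fun x z =>
    hf.continuous_mslope.comp ((hYc x).prodMk ((hYc z).prodMk continuous_id))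
  have hdiff : ∀ x z t, Y z t - Y x t
      = (z - x) * exp (∫ s in (0 : ℝ)..t, mslope f (Y x s) (Y z s) s) := by
    intro x z t
    have h := eq_exp_of_linear (y := fun t => Y z t - Y x t) (hmc x z)
      (fun t => ((hY z t).sub (hY x t)).congr_deriv (hf.mslope_mul _ _ _).symm) t
    simpa only [hY0] using h
  have hlip : ∀ T : ℝ, 0 ≤ T → ∃ K : NNReal, ∀ t ∈ Set.Icc (-T) T,
      LipschitzWith K (fun x => Y x t) := by
    intro T hT
    obtain ⟨C, hC0, hC⟩ := exists_bound_strip hf.dx.continuous (hf.per_dx hp) T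
    refine ⟨⟨exp (C * T), (exp_pos _).le⟩, fun t ht => LipschitzWith.of_dist_le_mul fun z x => ?_⟩
    rw [Real.dist_eq, Real.dist_eq, hdiff, abs_mul, abs_of_pos (exp_pos _), mul_comm]
    refine mul_le_mul_of_nonneg_right (exp_le_exp.2 ?_) (abs_nonneg _)
    have h1 : ‖∫ s in (0 : ℝ)..t, mslope f (Y x s) (Y z s) s‖ ≤ C * |t - 0| := by
      refine intervalIntegral.norm_integral_le_of_norm_le_const fun s hs => ?_
      refine abs_mslope_le (fun y => hC y s ?_) _ _
      rw [Set.mem_uIoc] at hs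
      rcases hs with hs | hs <;> constructor <;> linarith [hs.1, hs.2, ht.1, ht.2]
    rw [sub_zero] at h1
    refine (le_abs_self _).trans (h1.trans (mul_le_mul_of_nonneg_left ?_ hC0))
    exact abs_le.2 ⟨ht.1, ht.2⟩
  have hcont : Continuous fun p : ℝ × ℝ => Y p.1 p.2 := by
    rw [continuous_iff_continuousAt]
    rintro ⟨x, t⟩
    obtain ⟨K, hK⟩ := hlip (|t| + 1) (by positivity)
    have hc := continuousOn_prod_of_continuousOn_lipschitzOnWith (fun p : ℝ × ℝ => Y p.1 p.2)
      (s := Set.univ) (t := Set.Icc (-(|t| + 1)) (|t| + 1)) K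
      (fun x _ => (hYc x).continuousOn) (fun t ht => (hK t ht).lipschitzOnWith)
    refine hc.continuousAt (prod_mem_nhds Filter.univ_mem (Icc_mem_nhds ?_ ?_))
    · linarith [neg_abs_le t]
    · linarith [le_abs_self t]
  have hx : ∀ x t, HasDerivAt (fun z => Y z t)
      (exp (∫ s in (0 : ℝ)..t, dx f (Y x s) s)) x := by
    intro x t
    rw [hasDerivAt_iff_tendsto_slope]
    have hφ : Continuous fun z => exp (∫ s in (0 : ℝ)..t, mslope f (Y x s) (Y z s) s) := by
      refine continuous_exp.comp
        (intervalIntegral.continuous_parametric_intervalIntegral_of_continuous'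
          (f := fun z s => mslope f (Y x s) (Y z s) s) ?_ 0 t)
      exact hf.continuous_mslope.comp (((hYc x).comp continuous_snd).prodMk
        (hcont.prodMk continuous_snd))
    have h1 := (hφ.tendsto x).mono_left (nhdsWithin_le_nhds (s := {x}ᶜ))
    simp only [mslope_self] at h1
    refine h1.congr' ?_
    filter_upwards [self_mem_nhdsWithin] with z hz
    rw [slope_def_field, hdiff, mul_comm, mul_div_assoc, div_self (sub_ne_zero.2 hz), mul_one]
  have hsm : Sm Y := by
    rw [sm_iff]
    intro n
    induction n with
    | zero => simpa using hcont
    | succ n ih =>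
      refine contDiff_succ_of_partials hx hY ?_ ?_
      · refine ContDiff.exp (contDiff_primitive n (h := fun x s => dx f (Y x s) s) ?_)
        exact (sm_iff.1 hf.dx n).comp (ih.prodMk contDiff_snd)
      · exact (sm_iff.1 hf n).comp (ih.prodMk contDiff_snd)
  refine ⟨Y, hsm, hY0, fun x t => (hY x t).deriv, fun x t => ?_, fun x t => ?_⟩
  · rw [show dx Y x t = _ from (hx x t).deriv]
    exact exp_pos _
  · have h2 : ∀ s, HasDerivAt (fun s => Y x s + 2 * π) (f (Y x s + 2 * π) s) s := fun s => by
      refine ((hY x s).add_const (2 * π)).congr_deriv (hp s (Y x s)).symm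
    obtain ⟨K, hK⟩ := hf.lipschitz_strip hp (|t| + 1)
    refine ODE_solution_unique_of_mem_Ioo (v := fun t x => f x t) (s := fun _ => Set.univ) (K := K)
      (t₀ := 0) (a := -(|t| + 1)) (b := |t| + 1) (fun t ht => (hK t ⟨ht.1.le, ht.2.le⟩).lipschitzOnWith)
      ⟨by linarith [abs_nonneg t], by linarith [abs_nonneg t]⟩
      (fun t ht => ⟨hY (x + 2 * π) t, trivial⟩)
      (fun t ht => ⟨h2 t, trivial⟩) (by simp [hY0]) ⟨?_, ?_⟩
    · linarith [neg_abs_le t]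
    · linarith [le_abs_self t]

/-- A smooth increasing lift of a circle diffeomorphism has a smooth inverse. -/
lemma exists_smooth_inverse {φ φ' : ℝ → ℝ} (hφ : ContDiff ℝ (⊤ : ℕ∞) φ)
    (hd : ∀ x, HasDerivAt φ (φ' x) x) (hpos : ∀ x, 0 < φ' x)
    (hper : ∀ x, φ (x + 2 * π) = φ x + 2 * π) :
    ∃ ψ : ℝ → ℝ, ContDiff ℝ (⊤ : ℕ∞) ψ ∧ (∀ x, ψ (φ x) = x) ∧ (∀ y, φ (ψ y) = y) ∧
      ∀ y, ψ (y + 2 * π) = ψ y + 2 * π := by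
  have hmono : StrictMono φ := strictMono_of_deriv_pos fun x => by rw [(hd x).deriv]; exact hpos x
  have hn : ∀ n : ℕ, φ (n * (2 * π)) = φ 0 + n * (2 * π) := by
    intro n
    induction n with
    | zero => simp
    | succ n ih =>
      push_cast
      rw [add_mul, one_mul, hper, ih]
      ring
  have hn' : ∀ n : ℕ, φ (-(n * (2 * π))) = φ 0 - n * (2 * π) := by
    intro n
    induction n with
    | zero => simp
    | succ n ih =>
      have := hper (-((n + 1 : ℕ) * (2 * π)))
      rw [show -((n + 1 : ℕ) * (2 * π)) + 2 * π = -(n * (2 * π)) by push_cast; ring, ih] at this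
      rw [eq_sub_of_add_eq this.symm]
      push_cast
      ring
  have hsurj : Function.Surjective φ := by
    refine hφ.continuous.surjective ?_ ?_
    · refine Filter.tendsto_atTop_mono' _ ?_
        (Filter.tendsto_atTop_add_const_right _ (φ 0 - 2 * π) Filter.tendsto_id)
      filter_upwards [Filter.eventually_ge_atTop 0] with x hx
      have h1 := Nat.floor_le (show 0 ≤ x / (2 * π) by positivity)
      have h2 := Nat.lt_floor_add_one (x / (2 * π))
      rw [le_div_iff₀ two_pi_pos] at h1
      rw [div_lt_iff₀ two_pi_pos] at h2
      have h3 := hmono.monotone h1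
      rw [hn] at h3
      simp only [id]
      linarith
    · refine Filter.tendsto_atBot_mono' _ ?_
        (Filter.tendsto_atBot_add_const_right _ (φ 0 + 2 * π) Filter.tendsto_id)
      filter_upwards [Filter.eventually_le_atBot 0] with x hx
      have h1 := Nat.floor_le (show 0 ≤ -x / (2 * π) from div_nonneg (by linarith) two_pi_pos.le)
      have h2 := Nat.lt_floor_add_one (-x / (2 * π))
      rw [le_div_iff₀ two_pi_pos] at h1
      rw [div_lt_iff₀ two_pi_pos] at h2
      have h3 := hmono.monotone (le_neg_of_le_neg h1)
      rw [hn'] at h3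
      simp only [id]
      linarith
  set e := (hmono.orderIsoOfSurjective φ hsurj).toHomeomorph with he
  have hecoe : ∀ x, e x = φ x := fun x => rfl
  refine ⟨e.symm, e.contDiff_symm_deriv (f' := φ') (fun x => (hpos x).ne') hd hφ,
    fun x => e.symm_apply_apply x, fun y => e.apply_symm_apply y, fun y => ?_⟩
  apply e.injective
  rw [e.apply_symm_apply, hecoe, hper, ← hecoe, e.apply_symm_apply]

lemma hasDerivAt_of_smooth {f : ℝ → ℝ} (hf : ContDiff ℝ (⊤ : ℕ∞) f) (x : ℝ) :
    HasDerivAt f (deriv f x) x :=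
  (hf.differentiable (by simp) x).hasDerivAt

/-- Mean over a period. -/
noncomputable def avg (κ : ℝ → ℝ → ℝ) (t : ℝ) : ℝ := (2 * π)⁻¹ * ∫ y in (0 : ℝ)..2 * π, κ y t

lemma Sm.avg {κ : ℝ → ℝ → ℝ} (h : Sm κ) : Sm fun _ t => avg κ t := by
  have h1 : Sm fun x t => κ t x := h.comp₂ (Sm.of_right contDiff_id) (Sm.of_left contDiff_id)
  have hd : ∀ t, HasDerivAt (fun t => AffineFlow.avg κ t) (AffineFlow.avg (AffineFlow.dt κ) t) t :=
    fun t => (h.hasDerivAt_integral 0 (2 * π) t).const_mul _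
  refine Sm.of_right (g := fun t => AffineFlow.avg κ t) (contDiff_infty.2 fun n => ?_)
  clear h1
  induction n generalizing κ with
  | zero =>
    rw [Nat.cast_zero, contDiff_zero]
    exact continuous_iff_continuousAt.2 fun t => (hd t).continuousAt
  | succ n ih =>
    rw [Nat.cast_succ, contDiff_succ_iff_deriv]
    refine ⟨fun t => (hd t).differentiableAt, by simp, ?_⟩
    rw [show deriv (fun t => AffineFlow.avg κ t) = AffineFlow.avg (AffineFlow.dt κ) from
      funext fun t => (hd t).deriv]
    exact ih h.dt fun t => (h.dt.hasDerivAt_integral 0 (2 * π) t).const_mul _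

/-- A family of closed convex curves with affine support data `u`, affine arclength `σ` and affine
curvature `κ` (as a function of arclength), which evolves by the normalized affine flow for times
in `[0, T]`. -/
structure Sol (T : ℝ) (κ W u σ : ℝ → ℝ → ℝ) : Prop where
  smκ : Sm κ
  smW : Sm W
  smu : Sm u
  smσ : Sm σ
  perκ : ∀ t, Per (κ · t)
  perW : ∀ t, Per (W · t)
  peru : ∀ t, Per (u · t)
  pos : ∀ θ t, 0 < u θ t
  dxW : ∀ x t, dx W x t = κ x t - avg κ t
  σper : ∀ θ t, σ (θ + 2 * π) t = σ θ t + 2 * π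
  dxσ : ∀ θ t, dx σ θ t = (u θ t ^ 2)⁻¹
  dtu : ∀ θ t, dt u θ t = 1 / 4 * (κ (σ θ t) t - avg κ t) * u θ t
  pde : ∀ t ∈ Set.Icc 0 T, ∀ x, dt κ x t =
    1 / 4 * dx (dx κ) x t + κ x t * (κ x t - avg κ t) + 1 / 2 * W x t * dx κ x t
  curv : ∀ t ∈ Set.Icc 0 T, ∀ θ, u θ t ^ 3 * (dx (dx u) θ t + u θ t) = κ (σ θ t) t
  orth : ∀ ρ : ℝ → ℝ, (ρ = cos ∨ ρ = sin) → ∀ t ∈ Set.Icc 0 T,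
    ∫ θ in (0 : ℝ)..2 * π, (u θ t ^ 3)⁻¹ * ρ θ = 0

/-- Linear ordinary differential equations propagate vanishing. -/
lemma eq_zero_of_linear {y m : ℝ → ℝ} {T : ℝ} (hm : Continuous m)
    (hy : ∀ t ∈ Set.Icc 0 T, HasDerivAt y (m t * y t) t) (h0 : y 0 = 0) :
    ∀ t ∈ Set.Icc 0 T, y t = 0 := by
  have hP : ∀ t, HasDerivAt (fun t => ∫ s in (0 : ℝ)..t, m s) (m t) t := fun t =>
    intervalIntegral.integral_hasDerivAt_right (hm.intervalIntegrable _ _)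
      (hm.stronglyMeasurableAtFilter _ _) hm.continuousAt
  have hz : ∀ t ∈ Set.Icc 0 T, HasDerivAt (fun t => y t * exp (-∫ s in (0 : ℝ)..t, m s)) 0 t :=
    fun t ht => ((hy t ht).mul (hP t).neg.exp).congr_deriv (by ring)
  intro t ht
  have := constant_of_has_deriv_right_zero (fun t ht => (hz t ht).continuousAt.continuousWithinAt)
    (fun t ht => (hz t ⟨ht.1, ht.2.le⟩).hasDerivWithinAt) t ht
  rw [h0, zero_mul] at this
  exact (mul_eq_zero.1 this).resolve_right (exp_pos _).ne'

lemma hasDerivAt_curvature_of_flow {u h : ℝ → ℝ → ℝ} (hu : Sm u) (hh : Sm h)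
    (hut : ∀ θ t, dt u θ t = 1 / 4 * h θ t * u θ t) (θ t : ℝ) :
    HasDerivAt (fun s => u θ s ^ 3 * (dx (dx u) θ s + u θ s))
      (h θ t * (u θ t ^ 3 * (dx (dx u) θ t + u θ t))
        + 1 / 4 * u θ t ^ 3 * (dx (dx h) θ t * u θ t + 2 * dx h θ t * dx u θ t)) t := by
  have h1 : dt (dx (dx u)) θ t = 1 / 4 * (dx (dx h) θ t * u θ t + 2 * dx h θ t * dx u θ t
      + h θ t * dx (dx u) θ t) := by
    have e1 : dt u = fun θ t => 1 / 4 * h θ t * u θ t := by funext x s; exact hut x s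
    have e2 : dt (dx u) = fun θ t => 1 / 4 * (dx h θ t * u θ t + h θ t * dx u θ t) := by
      funext x s
      rw [hu.dt_dx, e1]
      exact ((((hh.hasDerivAt_x x s).const_mul (1 / 4)).mul (hu.hasDerivAt_x x s)).congr_deriv
        (by ring)).deriv
    rw [hu.dx.dt_dx, e2]
    exact (((((hh.dx.hasDerivAt_x θ t).mul (hu.hasDerivAt_x θ t)).add
      ((hh.hasDerivAt_x θ t).mul (hu.dx.hasDerivAt_x θ t))).const_mul (1 / 4)).congr_deriv
        (by ring)).deriv
  have h2 := ((hu.hasDerivAt_t θ t).pow 3).mul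
    ((hu.dx.dx.hasDerivAt_t θ t).add (hu.hasDerivAt_t θ t))
  refine h2.congr_deriv ?_
  simp only [Pi.add_apply, Pi.pow_apply]
  rw [h1, hut]
  push_cast
  ring

lemma cos_or_sin_props {ρ : ℝ → ℝ} (h : ρ = cos ∨ ρ = sin) : ∃ ρ' : ℝ → ℝ, Per ρ ∧ Per ρ' ∧
    (∀ x, HasDerivAt ρ (ρ' x) x) ∧ (∀ x, HasDerivAt ρ' (-ρ x) x) ∧
    ContDiff ℝ (⊤ : ℕ∞) ρ ∧ ContDiff ℝ (⊤ : ℕ∞) ρ' := by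
  rcases h with rfl | rfl
  · exact ⟨fun x => -sin x, cos_add_two_pi, fun x => congrArg Neg.neg (sin_add_two_pi x),
      hasDerivAt_cos, fun x => (hasDerivAt_sin x).neg, contDiff_cos, contDiff_sin.neg⟩
  · exact ⟨cos, sin_add_two_pi, cos_add_two_pi, hasDerivAt_sin, hasDerivAt_cos, contDiff_sin,
      contDiff_cos⟩

lemma integral_helmholtz {v ρ : ℝ → ℝ} (hv : ContDiff ℝ (⊤ : ℕ∞) v) (hp : Per v)
    (h : ρ = cos ∨ ρ = sin) :
    ∫ θ in (0 : ℝ)..2 * π, (deriv (deriv v) θ + v θ) * ρ θ = 0 := by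
  obtain ⟨ρ', hρ, hρ', hd, hd', c, c'⟩ := cos_or_sin_props h
  have v1 := ContDiff.deriv_top hv
  have v2 := ContDiff.deriv_top v1
  have h1 := integral_parts_per hp hρ' (hasDerivAt_of_smooth hv) hd' v1.continuous
    c.continuous.neg
  have h2 := integral_parts_per (hp.deriv (hasDerivAt_of_smooth hv)) hρ (hasDerivAt_of_smooth v1) hd
    v2.continuous c'.continuous
  have c1 : Continuous fun θ => deriv (deriv v) θ * ρ θ := v2.continuous.mul c.continuous
  have c2 : Continuous fun θ => v θ * ρ θ := hv.continuous.mul c.continuous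
  simp only [add_mul]
  rw [intervalIntegral.integral_add (c1.intervalIntegrable _ _) (c2.intervalIntegrable _ _)]
  simp only [mul_neg, intervalIntegral.integral_neg] at h1
  linarith

section Construction
variable {u₀ : ℝ → ℝ} (h0 : ContDiff ℝ (⊤ : ℕ∞) u₀) (h0per : Per u₀) (h0pos : ∀ θ, 0 < u₀ θ)
  (h0norm : ∫ θ in (0:ℝ)..(2 * π), ((u₀ θ) ^ 2)⁻¹ = 2 * π)
include h0 h0per h0pos h0norm

lemma exists_initial : ∃ σ₀ κ₀ : ℝ → ℝ, ContDiff ℝ (⊤ : ℕ∞) σ₀ ∧ ContDiff ℝ (⊤ : ℕ∞) κ₀ ∧ Per κ₀ ∧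
    (∀ θ, HasDerivAt σ₀ (u₀ θ ^ 2)⁻¹ θ) ∧ (∀ θ, σ₀ (θ + 2 * π) = σ₀ θ + 2 * π) ∧
    ∀ θ, u₀ θ ^ 3 * (deriv (deriv u₀) θ + u₀ θ) = κ₀ (σ₀ θ) := by
  have hg : ContDiff ℝ (⊤ : ℕ∞) fun θ => (u₀ θ ^ 2)⁻¹ :=
    (h0.pow 2).inv fun x => (pow_pos (h0pos x) 2).ne'
  have hgper : Per fun θ => (u₀ θ ^ 2)⁻¹ := fun x => by simp only [h0per x]
  set σ₀ : ℝ → ℝ := fun θ => ∫ s in (0 : ℝ)..θ, (u₀ s ^ 2)⁻¹ with hσ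
  have hσs : ContDiff ℝ (⊤ : ℕ∞) σ₀ :=
    (Sm.primitive (h := fun _ s => (u₀ s ^ 2)⁻¹) (Sm.of_right hg)).contDiff_right 0
  have hσd : ∀ θ, HasDerivAt σ₀ (u₀ θ ^ 2)⁻¹ θ := fun θ =>
    intervalIntegral.integral_hasDerivAt_right (hg.continuous.intervalIntegrable _ _)
      (hg.continuous.stronglyMeasurableAtFilter _ _) hg.continuous.continuousAt
  have hσp : ∀ θ, σ₀ (θ + 2 * π) = σ₀ θ + 2 * π := by
    intro θ
    have h1 := (show Function.Periodic (fun θ => (u₀ θ ^ 2)⁻¹) (2 * π) from hgper).intervalIntegral_add_eq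
      θ 0
    rw [zero_add, h0norm] at h1
    have h2 := intervalIntegral.integral_add_adjacent_intervals (a := 0) (b := θ) (c := θ + 2 * π)
      (hg.continuous.intervalIntegrable (μ := volume) _ _) (hg.continuous.intervalIntegrable _ _)
    rw [h1] at h2
    exact h2.symm
  obtain ⟨ψ, hψ, h1, h2, h3⟩ := exists_smooth_inverse hσs hσd
    (fun x => inv_pos.2 (pow_pos (h0pos x) 2)) hσp
  have hd1 := h0per.deriv (hasDerivAt_of_smooth h0)
  have hd2 := hd1.deriv (hasDerivAt_of_smooth (ContDiff.deriv_top h0))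
  refine ⟨σ₀, fun x => u₀ (ψ x) ^ 3 * (deriv (deriv u₀) (ψ x) + u₀ (ψ x)), hσs, ?_, fun x => ?_,
    hσd, hσp, fun θ => by simp only [h1]⟩
  · exact ((h0.comp hψ).pow 3).mul
      (((ContDiff.deriv_top (ContDiff.deriv_top h0)).comp hψ).add (h0.comp hψ))
  · simp only [h3, h0per (ψ x), hd2 (ψ x)]

omit h0 h0per h0norm in
lemma exists_clipped_flow {σ₀ κ₀ : ℝ → ℝ} (hσs : ContDiff ℝ (⊤ : ℕ∞) σ₀)
    (hκs : ContDiff ℝ (⊤ : ℕ∞) κ₀) (hκp : Per κ₀)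
    (hσd : ∀ θ, HasDerivAt σ₀ (u₀ θ ^ 2)⁻¹ θ) (hσp : ∀ θ, σ₀ (θ + 2 * π) = σ₀ θ + 2 * π)
    (hcurv : ∀ θ, u₀ θ ^ 3 * (deriv (deriv u₀) θ + u₀ θ) = κ₀ (σ₀ θ))
    (h0orthc : ∫ θ in (0:ℝ)..(2 * π), ((u₀ θ) ^ 3)⁻¹ * Real.cos θ = 0)
    (h0orths : ∫ θ in (0:ℝ)..(2 * π), ((u₀ θ) ^ 3)⁻¹ * Real.sin θ = 0) {R : ℝ} (hR : 0 < R) :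
    ∃ (c : ℤ → ℝ → ℂ) (κ W u σ : ℝ → ℝ → ℝ), Rap c ∧
      (∀ k t, c k t = fc (fun x => (κ x t : ℂ)) k) ∧
      (∀ k t, HasDerivAt (c k)
        (tcut k t * (-((k : ℂ) ^ 2 / 4) * c k t + Bclip R (fun j => c j t) k)) t) ∧
      (∀ x, κ x 0 = κ₀ x) ∧ (∀ θ, u θ 0 = u₀ θ) ∧
      ∀ T, (∀ t ∈ Set.Icc 0 T, ∀ k, ‖c k t‖ * wt k ≤ R) → Sol T κ W u σ := by
  obtain ⟨c, κ, W, hc, hcfc, hcd, smκ, smW, perκ, perW, hκ0, hW, hpde⟩ :=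
    exists_curvature hR hκs hκp
  obtain ⟨Y, smY, hY0, hYt, hYx, hYp⟩ := exists_flow (f := fun x t => -(1 / 2) * W x t)
    ((Sm.const _).mul smW) fun t x => by simp only [perW t x]
  set σ : ℝ → ℝ → ℝ := fun θ t => Y (σ₀ θ) t with hσdef
  have smσ : Sm σ := smY.comp₂ (Sm.of_left hσs) (Sm.of_right contDiff_id)
  have hdσ : ∀ θ t, dx σ θ t = dx Y (σ₀ θ) t * (u₀ θ ^ 2)⁻¹ := fun θ t =>
    ((smY.hasDerivAt_x (σ₀ θ) t).comp θ (hσd θ)).deriv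
  have hσt : ∀ θ t, dt σ θ t = -(1 / 2) * W (σ θ t) t := fun θ t => hYt _ t
  have hσx : ∀ θ t, 0 < dx σ θ t := fun θ t => by
    rw [hdσ]; exact mul_pos (hYx _ _) (inv_pos.2 (pow_pos (h0pos θ) 2))
  have hσper : ∀ θ t, σ (θ + 2 * π) t = σ θ t + 2 * π := fun θ t => by
    simp only [hσdef, hσp, hYp]
  have smq : Sm fun θ t => √(dx σ θ t) := ContDiff.sqrt smσ.dx fun p => (hσx p.1 p.2).ne'
  have hqpos : ∀ θ t, 0 < √(dx σ θ t) := fun θ t => sqrt_pos.2 (hσx θ t)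
  set u : ℝ → ℝ → ℝ := fun θ t => (√(dx σ θ t))⁻¹ with hu
  have smu : Sm u := smq.inv fun θ t => (hqpos θ t).ne'
  have hupos : ∀ θ t, 0 < u θ t := fun θ t => inv_pos.2 (hqpos θ t)
  have hdσper : ∀ t, Per (dx σ · t) := fun t x => by
    have e : (fun y => σ y t) = fun y => σ (y + 2 * π) t - 2 * π := by
      funext y; rw [hσper]; ring
    have h1 : HasDerivAt (fun y => σ y t) (dx σ (x + 2 * π) t) x := by
      rw [e]
      exact ((smσ.hasDerivAt_x (x + 2 * π) t).comp_add_const x (2 * π)).sub_const _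
    exact h1.unique (smσ.hasDerivAt_x x t)
  have huper : ∀ t, Per (u · t) := fun t x => by
    have : dx σ (x + 2 * π) t = dx σ x t := hdσper t x
    simp only [hu]
    rw [this]
  have hu2 : ∀ θ t, dx σ θ t = (u θ t ^ 2)⁻¹ := fun θ t => by
    simp only [hu]
    rw [inv_pow, inv_inv, sq_sqrt (hσx θ t).le]
  set η : ℝ → ℝ → ℝ := fun x t => κ x t - avg κ t with hη
  have smη : Sm η := smκ.sub smκ.avg
  have hηx : dx η = dx κ := by
    funext x t
    exact ((smκ.hasDerivAt_x x t).sub_const _).deriv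
  have hut : ∀ θ t, dt u θ t = 1 / 4 * η (σ θ t) t * u θ t := by
    intro θ t
    have e1 : dt (dx σ) θ t = -(1 / 2) * η (σ θ t) t * dx σ θ t := by
      rw [smσ.dt_dx, show dt σ = fun θ t => -(1 / 2) * W (σ θ t) t by funext x s; exact hσt x s]
      refine ((((smW.hasDerivAt_x (σ θ t) t).comp θ (smσ.hasDerivAt_x θ t)).const_mul
        (-(1 / 2))).congr_deriv ?_).deriv
      simp only [hW, hη, avg]
      ring
    have e2 := ((smσ.dx.hasDerivAt_t θ t).sqrt (hσx θ t).ne').inv (hqpos θ t).ne'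
    refine (e2.congr_deriv ?_).deriv
    have hs := sq_sqrt (hσx θ t).le
    have hq := hqpos θ t
    rw [e1]
    simp only [hu]
    set q := √(dx σ θ t)
    rw [← hs]
    field_simp
    ring
  have hu0 : ∀ θ, u θ 0 = u₀ θ := by
    intro θ
    have e : dx Y (σ₀ θ) 0 = 1 := by
      have : (fun y => Y y 0) = fun y => y := funext hY0
      rw [dx, this, deriv_id'']
    simp only [hu]
    rw [hdσ, e, one_mul, sqrt_inv, inv_inv, sqrt_sq (h0pos θ).le]
  refine ⟨c, κ, W, u, σ, hc, hcfc, hcd, hκ0, hu0, fun T hT => ?_⟩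
  have hpdeT : ∀ t ∈ Set.Icc 0 T, ∀ x, dt κ x t =
      1 / 4 * dx (dx κ) x t + κ x t * (κ x t - avg κ t) + 1 / 2 * W x t * dx κ x t :=
    fun t ht x => hpde t ht.1 (hT t ht) x
  set h : ℝ → ℝ → ℝ := fun θ t => η (σ θ t) t with hh
  have smh : Sm h := smη.comp₂ smσ (Sm.of_right contDiff_id)
  have hhx : dx h = fun θ t => dx κ (σ θ t) t * dx σ θ t := by
    funext θ t
    rw [← hηx]
    exact ((smη.hasDerivAt_x (σ θ t) t).comp θ (smσ.hasDerivAt_x θ t)).deriv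
  have hhxx : ∀ θ t, dx (dx h) θ t * u θ t + 2 * dx h θ t * dx u θ t
      = dx (dx κ) (σ θ t) t * (u θ t ^ 3)⁻¹ := by
    intro θ t
    have e1 : dx (dx h) θ t = dx (dx κ) (σ θ t) t * dx σ θ t * dx σ θ t
        + dx κ (σ θ t) t * dx (dx σ) θ t := by
      rw [hhx]
      exact (((smκ.dx.hasDerivAt_x (σ θ t) t).comp θ (smσ.hasDerivAt_x θ t)).mul
        (smσ.dx.hasDerivAt_x θ t)).deriv
    have e2 : dx (dx σ) θ t = -(2 * u θ t * dx u θ t) / (u θ t ^ 2) ^ 2 := by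
      rw [show dx σ = fun θ t => (u θ t ^ 2)⁻¹ by funext x s; exact hu2 x s]
      have := ((smu.hasDerivAt_x θ t).pow 2).inv (pow_pos (hupos θ t) 2).ne'
      refine (this.congr_deriv ?_).deriv
      simp
    have hp := hupos θ t
    have e3 : dx h θ t = dx κ (σ θ t) t * dx σ θ t := by rw [hhx]
    rw [e1, e2, e3, hu2]
    field_simp
    ring
  have hcurvT : ∀ t ∈ Set.Icc 0 T, ∀ θ, u θ t ^ 3 * (dx (dx u) θ t + u θ t) = κ (σ θ t) t := by
    intro t ht θ
    have := eq_zero_of_linear (T := T) (m := fun t => h θ t)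
      (y := fun s => u θ s ^ 3 * (dx (dx u) θ s + u θ s) - κ (σ θ s) s)
      (smh.continuous_right θ) (fun s hs => ?_) ?_ t ht
    · exact sub_eq_zero.1 this
    · have e1 := hasDerivAt_curvature_of_flow smu smh hut θ s
      have e2 := smκ.hasDerivAt_comp (smσ.hasDerivAt_t θ s) (hasDerivAt_id s)
      refine (e1.sub e2).congr_deriv ?_
      simp only [smul_eq_mul, id, one_mul]
      have hp := hupos θ s
      have e3 : 1 / 4 * u θ s ^ 3 * (dx (dx κ) (σ θ s) s * (u θ s ^ 3)⁻¹)
          = 1 / 4 * dx (dx κ) (σ θ s) s := by field_simp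
      rw [hhxx, hσt, hpdeT s hs, e3]
      ring
    · have e : ∀ x, dx u x 0 = deriv u₀ x := fun x => by
        rw [dx, show (fun y => u y 0) = u₀ from funext hu0]
      have e' : dx (dx u) θ 0 = deriv (deriv u₀) θ := by
        rw [dx, show (fun y => dx u y 0) = deriv u₀ from funext e]
      rw [e', hu0, hcurv, hκ0, hσdef]
      simp only [hY0, sub_self]
  refine ⟨smκ, smW, smu, smσ, perκ, perW, huper, hupos, hW, hσper, hu2, hut, hpdeT, hcurvT, ?_⟩
  intro ρ hρ
  obtain ⟨ρ', hρp, -, -, -, smρ, -⟩ := cos_or_sin_props hρ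
  have smf : Sm fun θ t => (u θ t ^ 3)⁻¹ * ρ θ :=
    ((smu.pow 3).inv fun θ t => (pow_pos (hupos θ t) 3).ne').mul (Sm.of_left smρ)
  have hft : ∀ θ t, dt (fun θ t => (u θ t ^ 3)⁻¹ * ρ θ) θ t
      = -(3 / 4) * h θ t * ((u θ t ^ 3)⁻¹ * ρ θ) := by
    intro θ t
    have := (((smu.hasDerivAt_t θ t).pow 3).inv (pow_pos (hupos θ t) 3).ne').mul_const (ρ θ)
    refine (this.congr_deriv ?_).deriv
    have hp := hupos θ t
    simp only [hut, Pi.pow_apply]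
    push_cast
    field_simp
    simp only [hh]
    ring
  refine eq_zero_of_linear (m := fun t => 3 / 4 * avg κ t)
    (continuous_const.mul (smκ.avg.continuous_right 0)) (fun t ht => ?_) ?_
  · refine (smf.hasDerivAt_integral 0 (2 * π) t).congr_deriv ?_
    have e1 := integral_helmholtz (smu.contDiff_left t) (huper t) hρ
    have e2 : ∀ θ, dt (fun θ t => (u θ t ^ 3)⁻¹ * ρ θ) θ t = 3 / 4 * avg κ t *
        ((u θ t ^ 3)⁻¹ * ρ θ) - 3 / 4 * ((dx (dx u) θ t + u θ t) * ρ θ) := by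
      intro θ
      have hp := hupos θ t
      rw [hft, hh]
      simp only [hη]
      rw [← hcurvT t ht θ]
      field_simp
      ring
    simp only [e2]
    have c1 := smf.continuous_left t
    have c2 : Continuous fun θ => (dx (dx u) θ t + u θ t) * ρ θ :=
      ((smu.dx.dx.continuous_left t).add (smu.continuous_left t)).mul smρ.continuous
    rw [intervalIntegral.integral_sub ((c1.const_mul _).intervalIntegrable _ _)
      ((c2.const_mul _).intervalIntegrable _ _), intervalIntegral.integral_const_mul,
      intervalIntegral.integral_const_mul]
    have e3 : ∫ θ in (0 : ℝ)..2 * π, (dx (dx u) θ t + u θ t) * ρ θ = 0 := e1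
    rw [e3]
    ring
  · simp only [hu0]
    rcases hρ with rfl | rfl
    · exact h0orthc
    · exact h0orths

end Construction

lemma integral_inv_sq_abs {α β : ℝ} (hα : 0 < α) (hβ : 0 < β) :
    (∀ θ, 0 < α * |cos θ| + β * |sin θ|) ∧
    ∫ θ in (0 : ℝ)..2 * π, ((α * |cos θ| + β * |sin θ|) ^ 2)⁻¹ = 4 / (α * β) := by
  have hpos : ∀ θ, 0 < α * |cos θ| + β * |sin θ| := by
    intro θ
    rcases eq_or_ne (cos θ) 0 with h | h
    · have h2 := sin_sq_add_cos_sq θ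
      have : sin θ ≠ 0 := by rintro h3; rw [h, h3] at h2; norm_num at h2
      have := abs_pos.2 this
      have := mul_nonneg hα.le (abs_nonneg (cos θ))
      positivity
    · have := abs_pos.2 h
      have := mul_nonneg hβ.le (abs_nonneg (sin θ))
      positivity
  refine ⟨hpos, ?_⟩
  set g : ℝ → ℝ := fun θ => ((α * |cos θ| + β * |sin θ|) ^ 2)⁻¹ with hg
  have hc : Continuous g := by
    refine Continuous.inv₀ (by fun_prop) fun θ => (pow_pos (hpos θ) 2).ne'
  have hi : ∀ a b, IntervalIntegrable g volume a b := fun a b => hc.intervalIntegrable a b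
  have h1 : ∫ θ in (0 : ℝ)..π / 2, g θ = 1 / (α * β) := by
    have hd : ∀ θ ∈ Set.uIcc 0 (π / 2),
        HasDerivAt (fun θ => sin θ / (α * (α * cos θ + β * sin θ))) (g θ) θ := by
      intro θ hθ
      rw [Set.uIcc_of_le (by positivity)] at hθ
      have hs : 0 ≤ sin θ := sin_nonneg_of_nonneg_of_le_pi hθ.1 (by linarith [hθ.2, pi_pos])
      have hcs : 0 ≤ cos θ := cos_nonneg_of_neg_pi_div_two_le_of_le (by linarith [hθ.1, pi_pos]) hθ.2
      have hp := hpos θ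
      rw [abs_of_nonneg hs, abs_of_nonneg hcs] at hp
      have h1 : HasDerivAt (fun θ => α * (α * cos θ + β * sin θ))
          (α * (α * -sin θ + β * cos θ)) θ :=
        (((hasDerivAt_cos θ).const_mul α).add ((hasDerivAt_sin θ).const_mul β)).const_mul α
      refine ((hasDerivAt_sin θ).div h1 (mul_pos hα hp).ne').congr_deriv ?_
      simp only [hg, abs_of_nonneg hs, abs_of_nonneg hcs]
      have h2 := sin_sq_add_cos_sq θ
      have h3 : cos θ * (α * (α * cos θ + β * sin θ)) - sin θ * (α * (α * -sin θ + β * cos θ))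
          = α ^ 2 := by linear_combination α ^ 2 * h2
      rw [h3, mul_pow, ← div_div, div_self (pow_pos hα 2).ne', one_div]
    rw [intervalIntegral.integral_eq_sub_of_hasDerivAt hd (hi _ _)]
    simp
  have h2 : ∫ θ in (π / 2)..π, g θ = 1 / (α * β) := by
    have := intervalIntegral.integral_comp_sub_left (a := π / 2) (b := π) g π
    rw [sub_self, show π - π / 2 = π / 2 by ring, h1] at this
    rw [← this]
    simp only [hg, cos_pi_sub, sin_pi_sub, abs_neg]
  have h3 : ∫ θ in (0 : ℝ)..π, g θ = 2 / (α * β) := by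
    rw [← intervalIntegral.integral_add_adjacent_intervals (hi 0 (π / 2)) (hi _ _), h1, h2]
    ring
  have h4 : ∫ θ in π..2 * π, g θ = 2 / (α * β) := by
    have := intervalIntegral.integral_comp_add_right (a := 0) (b := π) g π
    rw [zero_add, ← two_mul] at this
    rw [← this, ← h3]
    simp only [hg, cos_add_pi, sin_add_pi, abs_neg]
  rw [← intervalIntegral.integral_add_adjacent_intervals (hi 0 π) (hi _ _), h3, h4]
  ring

lemma per_shift {f : ℝ → ℝ} (h : Per f) (φ : ℝ) :
    ∫ θ in (0 : ℝ)..2 * π, f (φ + θ) = ∫ θ in (0 : ℝ)..2 * π, f θ := by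
  rw [intervalIntegral.integral_comp_add_left, add_zero]
  have := (show Function.Periodic f (2 * π) from h).intervalIntegral_add_eq φ 0
  rwa [zero_add] at this

section
variable {v : ℝ → ℝ} (hv : ContDiff ℝ (⊤ : ℕ∞) v) (hp : Per v)
  (hc : ∫ θ in (0 : ℝ)..2 * π, v θ * cos θ = 0) (hs : ∫ θ in (0 : ℝ)..2 * π, v θ * sin θ = 0)
include hv hp hc hs

lemma orth_shift (φ : ℝ) : (∫ θ in (0 : ℝ)..2 * π, v (φ + θ) * cos θ = 0) ∧
    ∫ θ in (0 : ℝ)..2 * π, v (φ + θ) * sin θ = 0 := by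
  have cv := hv.continuous
  have i1 : IntervalIntegrable (fun θ => v θ * cos θ) volume 0 (2 * π) :=
    (by fun_prop : Continuous _).intervalIntegrable _ _
  have i2 : IntervalIntegrable (fun θ => v θ * sin θ) volume 0 (2 * π) :=
    (by fun_prop : Continuous _).intervalIntegrable _ _
  constructor
  · have h := per_shift (f := fun θ => v θ * cos (θ - φ))
      (fun x => by simp only [hp x, show x + 2 * π - φ = x - φ + 2 * π by ring, cos_add_two_pi]) φ
    simp only [add_sub_cancel_left] at h
    rw [h]
    have e : ∀ θ, v θ * cos (θ - φ) = v θ * cos θ * cos φ + v θ * sin θ * sin φ := fun θ => by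
      rw [cos_sub]; ring
    simp only [e]
    rw [intervalIntegral.integral_add (i1.mul_const _) (i2.mul_const _),
      intervalIntegral.integral_mul_const, intervalIntegral.integral_mul_const, hc, hs]
    ring
  · have h := per_shift (f := fun θ => v θ * sin (θ - φ))
      (fun x => by simp only [hp x, show x + 2 * π - φ = x - φ + 2 * π by ring, sin_add_two_pi]) φ
    simp only [add_sub_cancel_left] at h
    rw [h]
    have e : ∀ θ, v θ * sin (θ - φ) = v θ * sin θ * cos φ - v θ * cos θ * sin φ := fun θ => by
      rw [sin_sub]; ring
    simp only [e]
    rw [intervalIntegral.integral_sub (i2.mul_const _) (i1.mul_const _),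
      intervalIntegral.integral_mul_const, intervalIntegral.integral_mul_const, hc, hs]
    ring

omit hp hc in
lemma exists_balanced_shift : ∃ φ, ∫ θ in (0 : ℝ)..π, v (φ + θ) * cos θ = 0 := by
  have cv := hv.continuous
  have cv' := (ContDiff.deriv_top hv).continuous
  have hd : ∀ ψ, HasDerivAt (fun ψ => ∫ θ in (0 : ℝ)..π, v (ψ + θ) * sin θ)
      (∫ θ in (0 : ℝ)..π, deriv v (ψ + θ) * sin θ) ψ := fun ψ =>
    hasDerivAt_integral_param (f := fun θ ψ => v (ψ + θ) * sin θ)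
      (f' := fun θ ψ => deriv v (ψ + θ) * sin θ) (by fun_prop) (by fun_prop)
      (fun θ ψ => ((hasDerivAt_of_smooth hv (ψ + θ)).comp_add_const ψ θ).mul_const _) ψ
  have hpi : ∫ θ in (0 : ℝ)..π, v (π + θ) * sin θ = ∫ θ in (0 : ℝ)..π, v (0 + θ) * sin θ := by
    have h1 := intervalIntegral.integral_comp_add_left (a := 0) (b := π)
      (fun θ => v θ * sin (θ - π)) π
    simp only [add_sub_cancel_left, add_zero, sin_sub_pi, mul_neg,
      intervalIntegral.integral_neg, ← two_mul] at h1
    have h2 := intervalIntegral.integral_add_adjacent_intervals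
      (f := fun θ => v θ * sin θ) (μ := volume) (a := 0) (b := π) (c := 2 * π)
      ((by fun_prop : Continuous _).intervalIntegrable _ _)
      ((by fun_prop : Continuous _).intervalIntegrable _ _)
    simp only [zero_add]
    linarith
  obtain ⟨φ, -, hφ⟩ := exists_hasDerivAt_eq_zero pi_pos
    (fun x _ => (hd x).continuousAt.continuousWithinAt) hpi.symm (fun x _ => hd x)
  refine ⟨φ, ?_⟩
  have h3 := intervalIntegral.integral_mul_deriv_eq_deriv_mul (a := 0) (b := π)
    (u := fun θ => v (φ + θ)) (v := sin) (u' := fun θ => deriv v (φ + θ)) (v' := cos)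
    (fun θ _ => (hasDerivAt_of_smooth hv (φ + θ)).comp_const_add φ θ)
    (fun θ _ => hasDerivAt_sin θ)
    ((by fun_prop : Continuous _).intervalIntegrable _ _)
    ((by fun_prop : Continuous _).intervalIntegrable _ _)
  rw [h3, hφ]
  simp

end

section
variable {v : ℝ → ℝ} (hv : ContDiff ℝ (⊤ : ℕ∞) v) (hp : Per v) (hpos : ∀ x, 0 < v x)
  (hc : ∫ θ in (0 : ℝ)..2 * π, v θ * cos θ = 0) (hs : ∫ θ in (0 : ℝ)..2 * π, v θ * sin θ = 0)
  (hb : ∫ θ in (0 : ℝ)..π, v θ * cos θ = 0)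
include hv hp hpos hc hs hb

/-- The support function of the curve with radius of curvature `v`. -/
lemma exists_support : ∃ h h' : ℝ → ℝ, ContDiff ℝ (⊤ : ℕ∞) h ∧ (∀ x, HasDerivAt h (h' x) x) ∧
    (∀ x, HasDerivAt h' (v x - h x) x) ∧ Per h ∧
    (∫ θ in (0 : ℝ)..2 * π, |cos θ| * v θ) * (∫ θ in (0 : ℝ)..2 * π, |sin θ| * v θ)
      ≤ 4 * ∫ θ in (0 : ℝ)..2 * π, h θ * v θ := by
  have cv := hv.continuous
  have ic : ∀ a b, IntervalIntegrable (fun θ => v θ * cos θ) volume a b := fun a b =>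
    (by fun_prop : Continuous _).intervalIntegrable _ _
  have is : ∀ a b, IntervalIntegrable (fun θ => v θ * sin θ) volume a b := fun a b =>
    (by fun_prop : Continuous _).intervalIntegrable _ _
  set C : ℝ → ℝ := fun θ => ∫ s in (0 : ℝ)..θ, v s * cos s with hC
  set S : ℝ → ℝ := fun θ => ∫ s in (0 : ℝ)..θ, v s * sin s with hS
  have dC : ∀ θ, HasDerivAt C (v θ * cos θ) θ := fun θ =>
    intervalIntegral.integral_hasDerivAt_right (ic _ _)
      ((by fun_prop : Continuous fun θ => v θ * cos θ).stronglyMeasurableAtFilter _ _)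
      (by fun_prop : Continuous fun θ => v θ * cos θ).continuousAt
  have dS : ∀ θ, HasDerivAt S (v θ * sin θ) θ := fun θ =>
    intervalIntegral.integral_hasDerivAt_right (is _ _)
      ((by fun_prop : Continuous fun θ => v θ * sin θ).stronglyMeasurableAtFilter _ _)
      (by fun_prop : Continuous fun θ => v θ * sin θ).continuousAt
  have pC : Per C := fun x => by
    have h2 := intervalIntegral.integral_add_adjacent_intervals (ic 0 x) (ic x (x + 2 * π))
    have h1 := (show Function.Periodic (fun θ => v θ * cos θ) (2 * π) from fun x => by
      simp only [hp x, cos_add_two_pi]).intervalIntegral_add_eq x 0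
    rw [zero_add, hc] at h1
    rw [h1, add_zero] at h2
    exact h2.symm
  have pS : Per S := fun x => by
    have h2 := intervalIntegral.integral_add_adjacent_intervals (is 0 x) (is x (x + 2 * π))
    have h1 := (show Function.Periodic (fun θ => v θ * sin θ) (2 * π) from fun x => by
      simp only [hp x, sin_add_two_pi]).intervalIntegral_add_eq x 0
    rw [zero_add, hs] at h1
    rw [h1, add_zero] at h2
    exact h2.symm
  have smC : ContDiff ℝ (⊤ : ℕ∞) C := (Sm.primitive (h := fun _ s => v s * cos s)
    (Sm.of_right (hv.mul contDiff_cos))).contDiff_right 0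
  have smS : ContDiff ℝ (⊤ : ℕ∞) S := (Sm.primitive (h := fun _ s => v s * sin s)
    (Sm.of_right (hv.mul contDiff_sin))).contDiff_right 0
  have cC := smC.continuous
  have cS := smS.continuous
  set d := S π with hd
  have hh : ∀ a b θ, (∫ s in a..b, v s * sin (θ - s))
      = sin θ * (C b - C a) - cos θ * (S b - S a) := by
    intro a b θ
    have e : ∀ s, v s * sin (θ - s) = v s * cos s * sin θ - v s * sin s * cos θ := fun s => by
      rw [sin_sub]; ring
    simp only [e]
    rw [intervalIntegral.integral_sub ((ic a b).mul_const _) ((is a b).mul_const _),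
      intervalIntegral.integral_mul_const, intervalIntegral.integral_mul_const, hC, hS,
      intervalIntegral.integral_interval_sub_left (ic _ _) (ic _ _),
      intervalIntegral.integral_interval_sub_left (is _ _) (is _ _)]
    ring
  have C0 : C 0 = 0 := by simp [hC]
  have S0 : S 0 = 0 := by simp [hS]
  have C2 : C (2 * π) = 0 := hc
  have S2 : S (2 * π) = 0 := hs
  have Cp : C π = 0 := hb
  set h : ℝ → ℝ := fun θ => sin θ * C θ - cos θ * S θ with hhd
  have ch : Continuous h := by fun_prop
  have hnn : ∀ a b θ, a ≤ b → (∀ s ∈ Set.Icc a b, 0 ≤ sin (θ - s)) →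
      0 ≤ ∫ s in a..b, v s * sin (θ - s) := fun a b θ hab h =>
    intervalIntegral.integral_nonneg hab fun s hs => mul_nonneg (hpos s).le (h s hs)
  have hnp : ∀ a b θ, a ≤ b → (∀ s ∈ Set.Icc a b, sin (θ - s) ≤ 0) →
      ∫ s in a..b, v s * sin (θ - s) ≤ 0 := fun a b θ hab h => by
    have := intervalIntegral.integral_nonneg (μ := volume) (f := fun s => -(v s * sin (θ - s)))
      hab fun s hs => neg_nonneg.2 (mul_nonpos_of_nonneg_of_nonpos (hpos s).le (h s hs))
    rw [intervalIntegral.integral_neg] at this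
    linarith
  have key : ∀ θ ∈ Set.Icc 0 (2 * π), 0 ≤ h θ ∧ 0 ≤ h θ + d * cos θ := by
    intro θ hθ
    simp only [hhd]
    rcases le_total θ π with hle | hle
    · have h1 := hnn 0 θ θ hθ.1 fun s hs => sin_nonneg_of_nonneg_of_le_pi (by linarith [hs.2])
        (by linarith [hs.1])
      have h2 := hnp θ π θ hle fun s hs => sin_nonpos_of_nonpos_of_neg_pi_le (by linarith [hs.1])
        (by linarith [hs.2, hθ.1])
      rw [hh] at h1 h2
      rw [C0, S0] at h1
      rw [Cp] at h2
      constructor <;> linarith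
    · have h1 := hnn π θ θ hle fun s hs => sin_nonneg_of_nonneg_of_le_pi (by linarith [hs.2])
        (by linarith [hs.1, hθ.2])
      have h2 := hnp θ (2 * π) θ hθ.2 fun s hs => sin_nonpos_of_nonpos_of_neg_pi_le
        (by linarith [hs.1]) (by linarith [hs.2])
      rw [hh] at h1 h2
      rw [Cp] at h1
      rw [C2, S2] at h2
      constructor <;> linarith
  have hd2 : ∫ θ in π..2 * π, v θ * sin θ = -d := by
    have := intervalIntegral.integral_add_adjacent_intervals (is 0 π) (is π (2 * π))
    rw [hs] at this
    simp only [hd, hS]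
    linarith
  have hN2 : ∫ θ in (0 : ℝ)..2 * π, |sin θ| * v θ = 2 * d := by
    have i1 : ∀ a b, IntervalIntegrable (fun θ => |sin θ| * v θ) volume a b := fun a b =>
      (by fun_prop : Continuous _).intervalIntegrable _ _
    have e0 : ∫ θ in (0 : ℝ)..π, |sin θ| * v θ = d := by
      refine intervalIntegral.integral_congr fun θ hθ => ?_
      rw [Set.uIcc_of_le pi_pos.le] at hθ
      simp only [abs_of_nonneg (sin_nonneg_of_nonneg_of_le_pi hθ.1 hθ.2), mul_comm]
    have e : ∫ θ in π..2 * π, |sin θ| * v θ = ∫ θ in π..2 * π, -(v θ * sin θ) := by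
      refine intervalIntegral.integral_congr fun θ hθ => ?_
      rw [Set.uIcc_of_le (by linarith [pi_pos])] at hθ
      have : sin θ ≤ 0 := by
        have := sin_nonpos_of_nonpos_of_neg_pi_le (x := θ - 2 * π) (by linarith [hθ.2])
          (by linarith [hθ.1])
        rwa [sin_sub_two_pi] at this
      simp only [abs_of_nonpos this]
      ring
    rw [← intervalIntegral.integral_add_adjacent_intervals (i1 0 π) (i1 π (2 * π)), e0, e,
      intervalIntegral.integral_neg, hd2]
    ring
  have hdnn : 0 ≤ d := by
    have := hnn 0 π π pi_pos.le fun s hs => sin_nonneg_of_nonneg_of_le_pi (by linarith [hs.2])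
        (by linarith [hs.1])
    rw [hh, S0, Cp, C0, cos_pi] at this
    linarith
  refine ⟨h, fun θ => cos θ * C θ + sin θ * S θ, (contDiff_sin.mul smC).sub (contDiff_cos.mul smS),
    fun θ => ?_, fun θ => ?_, fun x => ?_, ?_⟩
  · refine (((hasDerivAt_sin θ).mul (dC θ)).sub ((hasDerivAt_cos θ).mul (dS θ))).congr_deriv ?_
    ring
  · refine (((hasDerivAt_cos θ).mul (dC θ)).add ((hasDerivAt_sin θ).mul (dS θ))).congr_deriv ?_
    have := sin_sq_add_cos_sq θ
    simp only [hhd]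
    linear_combination v θ * this
  · simp only [hhd, sin_add_two_pi, cos_add_two_pi, pC x, pS x]
  · have i1 : IntervalIntegrable (fun θ => |cos θ| * v θ) volume 0 (2 * π) :=
      (by fun_prop : Continuous _).intervalIntegrable _ _
    have h1 : ∫ θ in (0 : ℝ)..2 * π, d / 2 * (|cos θ| * v θ - v θ * cos θ)
        ≤ ∫ θ in (0 : ℝ)..2 * π, h θ * v θ := by
      refine intervalIntegral.integral_mono_on two_pi_pos.le
        ((by fun_prop : Continuous _).intervalIntegrable _ _)
        ((by fun_prop : Continuous _).intervalIntegrable _ _) fun θ hθ => ?_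
      obtain ⟨k1, k2⟩ := key θ hθ
      have : d / 2 * (|cos θ| - cos θ) ≤ h θ := by
        rcases abs_cases (cos θ) with hc | hc <;> rw [hc.1] <;> linarith
      calc d / 2 * (|cos θ| * v θ - v θ * cos θ) = d / 2 * (|cos θ| - cos θ) * v θ := by ring
        _ ≤ _ := mul_le_mul_of_nonneg_right this (hpos θ).le
    rw [intervalIntegral.integral_const_mul, intervalIntegral.integral_sub i1 (ic _ _), hc,
      sub_zero] at h1
    rw [hN2]
    linarith

end

lemma wirtinger_real {f f' : ℝ → ℝ} (hf : ContDiff ℝ (⊤ : ℕ∞) f) (hp : Per f)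
    (hd : ∀ x, HasDerivAt f (f' x) x) (h0 : ∫ x in (0 : ℝ)..2 * π, f x = 0) :
    ∫ x in (0 : ℝ)..2 * π, f x ^ 2 ≤ ∫ x in (0 : ℝ)..2 * π, f' x ^ 2 := by
  have := wirtinger (f := fun x => (f x : ℂ)) (f' := fun x => (f' x : ℂ))
    (Complex.ofRealCLM.contDiff.comp hf) (fun x => by simp only [hp x])
    (fun x => (hd x).ofReal_comp) (by rw [intervalIntegral.integral_ofReal, h0]; simp)
  simpa using this

section
variable {u : ℝ → ℝ} (hu : ContDiff ℝ (⊤ : ℕ∞) u) (hp : Per u) (hpos : ∀ x, 0 < u x)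
  (hlen : ∫ θ in (0 : ℝ)..2 * π, (u θ ^ 2)⁻¹ = 2 * π)
  (hc : ∫ θ in (0 : ℝ)..2 * π, (u θ ^ 3)⁻¹ * cos θ = 0)
  (hs : ∫ θ in (0 : ℝ)..2 * π, (u θ ^ 3)⁻¹ * sin θ = 0)
include hu hp hpos hlen hc hs

lemma energy_le_of_balanced (hb : ∫ θ in (0 : ℝ)..π, (u θ ^ 3)⁻¹ * cos θ = 0) :
    ∫ θ in (0 : ℝ)..2 * π, (u θ ^ 2 - deriv u θ ^ 2) ≤ 4 * π := by
  set v : ℝ → ℝ := fun θ => (u θ ^ 3)⁻¹ with hvd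
  have hv : ContDiff ℝ (⊤ : ℕ∞) v := (hu.pow 3).inv fun x => (pow_pos (hpos x) 3).ne'
  have hvp : Per v := fun x => by simp only [hvd, hp x]
  have hvpos : ∀ x, 0 < v x := fun x => inv_pos.2 (pow_pos (hpos x) 3)
  obtain ⟨h, h', sh, dh, dh', ph, hN⟩ := exists_support hv hvp hvpos hc hs hb
  have cu := hu.continuous
  have cu' := (ContDiff.deriv_top hu).continuous
  have cv := hv.continuous
  have chh := sh.continuous
  have ch' : Continuous h' := continuous_iff_continuousAt.2 fun x => (dh' x).continuousAt
  have du := hasDerivAt_of_smooth hu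
  have hcv : Continuous fun x => v x - h x := by fun_prop
  set N1 := ∫ θ in (0 : ℝ)..2 * π, |cos θ| * v θ with hN1
  set N2 := ∫ θ in (0 : ℝ)..2 * π, |sin θ| * v θ with hN2
  have i1 : IntervalIntegrable (fun θ => |cos θ| * v θ) volume 0 (2 * π) :=
    (by fun_prop : Continuous _).intervalIntegrable _ _
  have i2 : IntervalIntegrable (fun θ => |sin θ| * v θ) volume 0 (2 * π) :=
    (by fun_prop : Continuous _).intervalIntegrable _ _
  have hN1p : 0 < N1 := by
    refine intervalIntegral.integral_pos two_pi_pos (by fun_prop)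
      (fun x _ => mul_nonneg (abs_nonneg _) (hvpos x).le) ⟨0, ⟨le_rfl, two_pi_pos.le⟩, ?_⟩
    simpa using hvpos 0
  have hN2p : 0 < N2 := by
    refine intervalIntegral.integral_pos two_pi_pos (by fun_prop)
      (fun x _ => mul_nonneg (abs_nonneg _) (hvpos x).le) ⟨π / 2, ⟨by positivity, ?_⟩, ?_⟩
    · linarith [pi_pos]
    · simpa using hvpos (π / 2)
  have hAl : 4 * π ≤ N1 * N2 := by
    obtain ⟨hl, hlint⟩ := integral_inv_sq_abs (div_pos three_pos hN1p) (div_pos three_pos hN2p)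
    set l : ℝ → ℝ := fun θ => 3 / N1 * |cos θ| + 3 / N2 * |sin θ| with hld
    have cl : Continuous l := by fun_prop
    have cl2 : Continuous fun θ => (l θ ^ 2)⁻¹ := Continuous.inv₀ (by fun_prop)
      fun θ => (pow_pos (hl θ) 2).ne'
    have cu2 : Continuous fun θ => (u θ ^ 2)⁻¹ := Continuous.inv₀ (by fun_prop)
      fun θ => (pow_pos (hpos θ) 2).ne'
    have e1 : ∫ θ in (0 : ℝ)..2 * π, (u θ ^ 2)⁻¹ ≤ ∫ θ in (0 : ℝ)..2 * π,
        ((2 / 3 * (3 / N1) * (|cos θ| * v θ) + 2 / 3 * (3 / N2) * (|sin θ| * v θ))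
          + 1 / 3 * (l θ ^ 2)⁻¹) := by
      refine intervalIntegral.integral_mono_on two_pi_pos.le (cu2.intervalIntegrable _ _)
        ((by fun_prop : Continuous _).intervalIntegrable _ _) fun θ _ => ?_
      have hl := hl θ
      have hup := hpos θ
      have e2 : 2 / 3 * (3 / N1) * (|cos θ| * v θ) + 2 / 3 * (3 / N2) * (|sin θ| * v θ)
          + 1 / 3 * (l θ ^ 2)⁻¹ = 2 / 3 * l θ * (u θ ^ 3)⁻¹ + 1 / 3 * (l θ ^ 2)⁻¹ := by
        simp only [hld, hvd]; ring
      rw [e2]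
      change 0 < l θ at hl
      have h3 : 0 ≤ (l θ - u θ) ^ 2 * (2 * l θ + u θ) := by positivity
      have e3 : 2 / 3 * l θ * (u θ ^ 3)⁻¹ + 1 / 3 * (l θ ^ 2)⁻¹ - (u θ ^ 2)⁻¹
          = (l θ - u θ) ^ 2 * (2 * l θ + u θ) / (3 * l θ ^ 2 * u θ ^ 3) := by
        field_simp
        ring
      have : 0 ≤ (l θ - u θ) ^ 2 * (2 * l θ + u θ) / (3 * l θ ^ 2 * u θ ^ 3) := by positivity
      linarith
    rw [hlen, intervalIntegral.integral_add (((i1.const_mul _).add (i2.const_mul _)))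
      ((cl2.intervalIntegrable _ _).const_mul _),
      intervalIntegral.integral_add (i1.const_mul _) (i2.const_mul _),
      intervalIntegral.integral_const_mul, intervalIntegral.integral_const_mul,
      intervalIntegral.integral_const_mul, ← hN1, ← hN2, hlint] at e1
    have e4 : 2 / 3 * (3 / N1) * N1 + 2 / 3 * (3 / N2) * N2 + 1 / 3 * (4 / (3 / N1 * (3 / N2)))
        = 4 + 4 / 27 * (N1 * N2) := by
      field_simp
      ring
    rw [e4] at e1
    linarith [pi_gt_three]
  have hA : π ≤ ∫ θ in (0 : ℝ)..2 * π, h θ * v θ := by linarith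
  have hpos_int : 0 < ∫ θ in (0 : ℝ)..2 * π, h θ := by
    have e := integral_deriv_per (ph.deriv dh) dh' hcv
    rw [intervalIntegral.integral_sub (cv.intervalIntegrable _ _) (chh.intervalIntegrable _ _),
      sub_eq_zero] at e
    rw [← e]
    exact intervalIntegral.intervalIntegral_pos_of_pos (cv.intervalIntegrable _ _) hvpos two_pi_pos
  have q1 := integral_parts_per hp (ph.deriv dh) du dh' cu' hcv
  have q2 := integral_parts_per ph (ph.deriv dh) dh dh' ch' hcv
  have ii : ∀ {f : ℝ → ℝ}, Continuous f → IntervalIntegrable f volume 0 (2 * π) :=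
    fun hf => hf.intervalIntegrable _ _
  have q1' : ∫ θ in (0 : ℝ)..2 * π, (u θ * h θ - deriv u θ * h' θ) = 2 * π := by
    have c1 : Continuous fun θ => u θ * h θ := by fun_prop
    have c2 : Continuous fun θ => deriv u θ * h' θ := by fun_prop
    have c3 : Continuous fun θ => u θ * v θ := by fun_prop
    have e1 : ∫ θ in (0 : ℝ)..2 * π, u θ * v θ = 2 * π := by
      refine Eq.trans (intervalIntegral.integral_congr fun θ _ => ?_) hlen
      have hup := hpos θ
      simp only [hvd]
      field_simp
    have e2 : ∫ θ in (0 : ℝ)..2 * π, u θ * (v θ - h θ)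
        = (∫ θ in (0 : ℝ)..2 * π, u θ * v θ) - ∫ θ in (0 : ℝ)..2 * π, u θ * h θ := by
      rw [← intervalIntegral.integral_sub (ii c3) (ii c1)]
      exact intervalIntegral.integral_congr fun θ _ => mul_sub _ _ _
    rw [intervalIntegral.integral_sub (ii c1) (ii c2)]
    linarith
  have q2' : ∫ θ in (0 : ℝ)..2 * π, (h θ * h θ - h' θ * h' θ)
      = ∫ θ in (0 : ℝ)..2 * π, h θ * v θ := by
    have c1 : Continuous fun θ => h θ * h θ := by fun_prop
    have c2 : Continuous fun θ => h' θ * h' θ := by fun_prop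
    have c3 : Continuous fun θ => h θ * v θ := by fun_prop
    have e2 : ∫ θ in (0 : ℝ)..2 * π, h θ * (v θ - h θ)
        = (∫ θ in (0 : ℝ)..2 * π, h θ * v θ) - ∫ θ in (0 : ℝ)..2 * π, h θ * h θ := by
      rw [← intervalIntegral.integral_sub (ii c3) (ii c1)]
      exact intervalIntegral.integral_congr fun θ _ => mul_sub _ _ _
    rw [intervalIntegral.integral_sub (ii c1) (ii c2)]
    linarith
  set a := (∫ θ in (0 : ℝ)..2 * π, u θ) / ∫ θ in (0 : ℝ)..2 * π, h θ with ha
  have hw := wirtinger_real (f := fun θ => u θ - a * h θ) (f' := fun θ => deriv u θ - a * h' θ)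
    (hu.sub (contDiff_const.mul sh)) (fun x => by simp only [hp x, ph x])
    (fun x => (du x).sub ((dh x).const_mul a)) (by
      rw [intervalIntegral.integral_sub (cu.intervalIntegrable _ _)
        ((chh.intervalIntegrable _ _).const_mul _), intervalIntegral.integral_const_mul, ha,
        div_mul_cancel₀ _ hpos_int.ne', sub_self])
  have e5 : (∫ θ in (0 : ℝ)..2 * π, (u θ - a * h θ) ^ 2)
      - (∫ θ in (0 : ℝ)..2 * π, (deriv u θ - a * h' θ) ^ 2)
      = (∫ θ in (0 : ℝ)..2 * π, (u θ ^ 2 - deriv u θ ^ 2)) - 2 * a * (2 * π)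
        + a ^ 2 * ∫ θ in (0 : ℝ)..2 * π, h θ * v θ := by
    have c1 : Continuous fun θ => (u θ - a * h θ) ^ 2 := by fun_prop
    have c2 : Continuous fun θ => (deriv u θ - a * h' θ) ^ 2 := by fun_prop
    have c3 : Continuous fun θ => u θ ^ 2 - deriv u θ ^ 2 := by fun_prop
    have c4 : Continuous fun θ => u θ * h θ - deriv u θ * h' θ := by fun_prop
    have c5 : Continuous fun θ => h θ * h θ - h' θ * h' θ := by fun_prop
    have c6 : Continuous fun θ => u θ ^ 2 - deriv u θ ^ 2
        - 2 * a * (u θ * h θ - deriv u θ * h' θ) := by fun_prop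
    rw [← q2', ← intervalIntegral.integral_sub (ii c1) (ii c2)]
    refine Eq.trans ?_ (congrArg (fun z => (∫ θ in (0 : ℝ)..2 * π, (u θ ^ 2 - deriv u θ ^ 2))
      - 2 * a * z + a ^ 2 * ∫ θ in (0 : ℝ)..2 * π, (h θ * h θ - h' θ * h' θ)) q1')
    rw [← intervalIntegral.integral_const_mul, ← intervalIntegral.integral_const_mul,
      ← intervalIntegral.integral_sub (ii c3) ((ii c4).const_mul _),
      ← intervalIntegral.integral_add (ii c6) ((ii c5).const_mul _)]
    refine intervalIntegral.integral_congr fun θ _ => ?_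
    ring
  have e6 := mul_le_mul_of_nonneg_left hA (sq_nonneg a)
  have e7 : 0 ≤ π * (a - 2) ^ 2 := by positivity
  nlinarith

lemma energy_le : ∫ θ in (0 : ℝ)..2 * π, (u θ ^ 2 - deriv u θ ^ 2) ≤ 4 * π := by
  have hv : ContDiff ℝ (⊤ : ℕ∞) fun θ => (u θ ^ 3)⁻¹ :=
    (hu.pow 3).inv fun x => (pow_pos (hpos x) 3).ne'
  have hvp : Per fun θ => (u θ ^ 3)⁻¹ := fun x => by simp only [hp x]
  obtain ⟨φ, hφ⟩ := exists_balanced_shift hv hs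
  obtain ⟨h1, h2⟩ := orth_shift hv hvp hc hs φ
  have hd : ∀ x, deriv (fun θ => u (φ + θ)) x = deriv u (φ + x) := fun x =>
    ((hasDerivAt_of_smooth hu (φ + x)).comp_const_add φ x).deriv
  have hpd := hp.deriv (hasDerivAt_of_smooth hu)
  have := energy_le_of_balanced (u := fun θ => u (φ + θ)) (hu.comp (contDiff_const.add contDiff_id))
    (fun x => by simp only [← add_assoc, hp (φ + x)]) (fun x => hpos _)
    (by rw [per_shift (f := fun θ => (u θ ^ 2)⁻¹) (fun x => by simp only [hp x]), hlen]) h1 h2 hφ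
  simp only [hd] at this
  rwa [per_shift (f := fun θ => u θ ^ 2 - deriv u θ ^ 2) (fun x => by simp only [hp x, hpd x])]
    at this

end

lemma integral_eq_of_per {P f g : ℝ → ℝ} (hP : Per P) (hd : ∀ x, HasDerivAt P (f x - g x) x)
    (hf : Continuous f) (hg : Continuous g) :
    ∫ x in (0 : ℝ)..2 * π, f x = ∫ x in (0 : ℝ)..2 * π, g x := by
  have h := integral_deriv_per hP hd (hf.sub hg)
  rw [intervalIntegral.integral_sub (hf.intervalIntegrable _ _) (hg.intervalIntegrable _ _)] at h
  linarith

/-- A function with a periodic primitive is controlled by the energy of its derivative. -/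
lemma sq_le_of_per_primitive {P f f' : ℝ → ℝ} (hP : Per P) (hd : ∀ x, HasDerivAt P (f x) x)
    (hd' : ∀ x, HasDerivAt f (f' x) x) (hc : Continuous f') (hper : Per f') (x : ℝ) :
    f x ^ 2 ≤ 2 * π * ∫ y in (0 : ℝ)..2 * π, f' y ^ 2 := by
  have hpi := two_pi_pos
  obtain ⟨y, hy, hy0⟩ := exists_hasDerivAt_eq_zero (f := P) (f' := f) (a := x) (b := x + 2 * π)
    (by linarith) (fun y _ => (hd y).continuousAt.continuousWithinAt) (hP x).symm fun y _ => hd y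
  have c1 : Continuous fun s => f' s ^ 2 := by fun_prop
  have h1 : ∫ s in x..y, f' s = -f x := by
    rw [intervalIntegral.integral_eq_sub_of_hasDerivAt (fun s _ => hd' s)
      (hc.intervalIntegrable _ _), hy0, zero_sub]
  set lam := -f x / (2 * π) with hlam
  have h2 : 0 ≤ ∫ s in x..y, (f' s - lam) ^ 2 :=
    intervalIntegral.integral_nonneg hy.1.le fun s _ => sq_nonneg _
  have h3 : ∫ s in x..y, (f' s - lam) ^ 2
      = (∫ s in x..y, f' s ^ 2) - 2 * lam * (-f x) + (y - x) * lam ^ 2 := by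
    have c2 : Continuous fun s => 2 * lam * f' s := by fun_prop
    have c3 : Continuous fun s => f' s ^ 2 - 2 * lam * f' s := by fun_prop
    have c4 : Continuous fun _ : ℝ => lam ^ 2 := continuous_const
    have e : ∫ s in x..y, (f' s - lam) ^ 2
        = ∫ s in x..y, (f' s ^ 2 - 2 * lam * f' s + lam ^ 2) :=
      intervalIntegral.integral_congr fun s _ => by ring
    rw [e, intervalIntegral.integral_add (c3.intervalIntegrable _ _) (c4.intervalIntegrable _ _),
      intervalIntegral.integral_sub (c1.intervalIntegrable _ _) (c2.intervalIntegrable _ _),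
      intervalIntegral.integral_const_mul, h1, intervalIntegral.integral_const, smul_eq_mul]
  have h4 : ∫ s in x..y, f' s ^ 2 ≤ ∫ s in (0 : ℝ)..2 * π, f' s ^ 2 := by
    have e := (show Function.Periodic (fun s => f' s ^ 2) (2 * π) from
      fun s => by simp only [hper s]).intervalIntegral_add_eq 0 x
    rw [zero_add] at e
    rw [e]
    have e2 := intervalIntegral.integral_add_adjacent_intervals (μ := volume)
      (c1.intervalIntegrable x y) (c1.intervalIntegrable y (x + 2 * π))
    have e3 : 0 ≤ ∫ s in y..x + 2 * π, f' s ^ 2 :=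
      intervalIntegral.integral_nonneg hy.2.le fun s _ => sq_nonneg _
    linarith
  have h5 : (y - x) * lam ^ 2 ≤ 2 * π * lam ^ 2 := by
    nlinarith [sq_nonneg lam, hy.2]
  have h6 : f x = -(2 * π * lam) := by rw [hlam]; field_simp
  have h7 : 2 * π * lam ^ 2 ≤ ∫ s in (0 : ℝ)..2 * π, f' s ^ 2 := by
    rw [h6] at h3
    nlinarith
  calc f x ^ 2 = 2 * π * (2 * π * lam ^ 2) := by rw [h6]; ring
    _ ≤ _ := by gcongr

/-- Variance of the curvature. -/
noncomputable def vari (κ : ℝ → ℝ → ℝ) (t : ℝ) : ℝ :=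
  ∫ x in (0 : ℝ)..2 * π, (κ x t - avg κ t) ^ 2

/-- Dirichlet energy of the curvature. -/
noncomputable def diri (κ : ℝ → ℝ → ℝ) (t : ℝ) : ℝ := ∫ x in (0 : ℝ)..2 * π, dx κ x t ^ 2

lemma vari_nonneg (κ : ℝ → ℝ → ℝ) (t : ℝ) : 0 ≤ vari κ t :=
  intervalIntegral.integral_nonneg two_pi_pos.le fun _ _ => sq_nonneg _

lemma diri_nonneg (κ : ℝ → ℝ → ℝ) (t : ℝ) : 0 ≤ diri κ t :=
  intervalIntegral.integral_nonneg two_pi_pos.le fun _ _ => sq_nonneg _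

section
variable {T : ℝ} {κ W u σ : ℝ → ℝ → ℝ}

lemma Sol.hasDerivAt_W (S : Sol T κ W u σ) (x t : ℝ) :
    HasDerivAt (fun x => W x t) (κ x t - avg κ t) x :=
  (S.smW.hasDerivAt_x x t).congr_deriv (S.dxW x t)

lemma Sol.hasDerivAt_η (S : Sol T κ W u σ) (x t : ℝ) :
    HasDerivAt (fun x => κ x t - avg κ t) (dx κ x t) x :=
  (S.smκ.hasDerivAt_x x t).sub_const _

lemma Sol.integral_η (S : Sol T κ W u σ) (t : ℝ) :
    ∫ x in (0 : ℝ)..2 * π, (κ x t - avg κ t) = 0 :=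
  integral_deriv_per (S.perW t) (S.hasDerivAt_W · t) ((S.smκ.continuous_left t).sub continuous_const)

lemma Sol.η_sq_le (S : Sol T κ W u σ) (x t : ℝ) :
    (κ x t - avg κ t) ^ 2 ≤ 2 * π * diri κ t :=
  sq_le_of_per_primitive (S.perW t) (S.hasDerivAt_W · t) (S.hasDerivAt_η · t)
    (S.smκ.dx.continuous_left t) (S.smκ.per_dx S.perκ t) x

lemma Sol.hasDerivAt_avg (S : Sol T κ W u σ) {t : ℝ} (ht : t ∈ Set.Icc 0 T) :
    HasDerivAt (avg κ) ((4 * π)⁻¹ * vari κ t) t := by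
  have h := (S.smκ.hasDerivAt_integral 0 (2 * π) t).const_mul (2 * π)⁻¹
  refine h.congr_deriv ?_
  have ck := S.smκ.continuous_left t
  have c1 : Continuous fun x => (κ x t - avg κ t) ^ 2 := by fun_prop
  have e : ∫ x in (0 : ℝ)..2 * π, dt κ x t
      = ∫ x in (0 : ℝ)..2 * π, 1 / 2 * (κ x t - avg κ t) ^ 2 := by
    refine integral_eq_of_per (P := fun x => 1 / 4 * dx κ x t + 1 / 2 * (W x t * κ x t)
      + 1 / 2 * avg κ t * W x t) (fun x => ?_) (fun x => ?_) (S.smκ.dt.continuous_left t)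
      (by fun_prop)
    · simp only [S.smκ.per_dx S.perκ t x, S.perW t x, S.perκ t x]
    · refine ((((S.smκ.dx.hasDerivAt_x x t).const_mul (1 / 4)).add
        (((S.hasDerivAt_W x t).mul (S.smκ.hasDerivAt_x x t)).const_mul (1 / 2))).add
        ((S.hasDerivAt_W x t).const_mul (1 / 2 * avg κ t))).congr_deriv ?_
      rw [S.pde t ht x]
      ring
  rw [e, intervalIntegral.integral_const_mul, vari, mul_inv, mul_inv]
  ring

lemma Sol.hasDerivAt_vari (S : Sol T κ W u σ) {t : ℝ} (ht : t ∈ Set.Icc 0 T) :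
    HasDerivAt (vari κ) (-(1 / 2) * diri κ t + 2 * avg κ t * vari κ t
      + 3 / 2 * ∫ x in (0 : ℝ)..2 * π, (κ x t - avg κ t) ^ 3) t := by
  have hs : Sm fun x t => (κ x t - avg κ t) ^ 2 := (S.smκ.sub S.smκ.avg).pow 2
  refine (hs.hasDerivAt_integral 0 (2 * π) t).congr_deriv ?_
  have ck := S.smκ.continuous_left t
  have ckx := S.smκ.dx.continuous_left t
  set a' := (4 * π)⁻¹ * vari κ t
  have hdt : ∀ x, dt (fun x t => (κ x t - avg κ t) ^ 2) x t
      = 2 * (κ x t - avg κ t) * (dt κ x t - a') := fun x => by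
    have h : HasDerivAt (fun s => κ x s - avg κ s) (dt κ x t - a') t :=
      (S.smκ.hasDerivAt_t x t).sub (S.hasDerivAt_avg ht)
    refine (h.pow 2).deriv.trans ?_
    push_cast
    ring
  have c1 : Continuous fun x => -(1 / 2) * dx κ x t ^ 2 := by fun_prop
  have c2 : Continuous fun x => 2 * avg κ t * (κ x t - avg κ t) ^ 2 := by fun_prop
  have c3 : Continuous fun x => 3 / 2 * (κ x t - avg κ t) ^ 3 := by fun_prop
  have c4 : Continuous fun x => -(1 / 2) * dx κ x t ^ 2 + 2 * avg κ t * (κ x t - avg κ t) ^ 2 := by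
    fun_prop
  have e : ∫ x in (0 : ℝ)..2 * π, dt (fun x t => (κ x t - avg κ t) ^ 2) x t
      = ∫ x in (0 : ℝ)..2 * π, (-(1 / 2) * dx κ x t ^ 2 + 2 * avg κ t * (κ x t - avg κ t) ^ 2
        + 3 / 2 * (κ x t - avg κ t) ^ 3) := by
    refine integral_eq_of_per (P := fun x => 1 / 2 * ((κ x t - avg κ t) * dx κ x t)
      + 1 / 2 * (W x t * (κ x t - avg κ t) ^ 2) - 2 * a' * W x t) (fun x => ?_) (fun x => ?_)
      (hs.dt.continuous_left t) (c4.add c3)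
    · simp only [S.smκ.per_dx S.perκ t x, S.perW t x, S.perκ t x]
    · refine (((((S.hasDerivAt_η x t).mul (S.smκ.dx.hasDerivAt_x x t)).const_mul (1 / 2)).add
        (((S.hasDerivAt_W x t).mul ((S.hasDerivAt_η x t).pow 2)).const_mul (1 / 2))).sub
        ((S.hasDerivAt_W x t).const_mul (2 * a'))).congr_deriv ?_
      rw [hdt, S.pde t ht x]
      simp only [Pi.pow_apply]
      push_cast
      ring
  rw [e, intervalIntegral.integral_add (c4.intervalIntegrable _ _) (c3.intervalIntegrable _ _),
    intervalIntegral.integral_add (c1.intervalIntegrable _ _) (c2.intervalIntegrable _ _),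
    intervalIntegral.integral_const_mul, intervalIntegral.integral_const_mul,
    intervalIntegral.integral_const_mul]
  rfl

lemma Sol.cubic_le (S : Sol T κ W u σ) {t s : ℝ} (hs : ∀ x, |κ x t - avg κ t| ≤ s) :
    ∫ x in (0 : ℝ)..2 * π, (κ x t - avg κ t) ^ 3 ≤ s * vari κ t := by
  have ck := S.smκ.continuous_left t
  have c1 : Continuous fun x => (κ x t - avg κ t) ^ 3 := by fun_prop
  have c2 : Continuous fun x => s * (κ x t - avg κ t) ^ 2 := by fun_prop
  rw [vari, ← intervalIntegral.integral_const_mul]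
  refine intervalIntegral.integral_mono_on two_pi_pos.le (c1.intervalIntegrable _ _)
    (c2.intervalIntegrable _ _) fun x _ => ?_
  have := (le_abs_self _).trans (hs x)
  nlinarith [sq_nonneg (κ x t - avg κ t)]

lemma Sol.abs_η_le (S : Sol T κ W u σ) (x t : ℝ) :
    |κ x t - avg κ t| ≤ √(2 * π * diri κ t) := abs_le_sqrt (S.η_sq_le x t)

lemma Sol.integral_comp (S : Sol T κ W u σ) {g : ℝ → ℝ} (hg : Continuous g) (hp : Per g) (t : ℝ) :
    ∫ θ in (0 : ℝ)..2 * π, g (σ θ t) * (u θ t ^ 2)⁻¹ = ∫ x in (0 : ℝ)..2 * π, g x := by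
  have cu := S.smu.continuous_left t
  have h := intervalIntegral.integral_comp_mul_deriv (a := 0) (b := 2 * π) (f := fun θ => σ θ t)
    (f' := fun θ => (u θ t ^ 2)⁻¹) (g := g)
    (fun x _ => (S.smσ.hasDerivAt_x x t).congr_deriv (S.dxσ x t))
    (Continuous.continuousOn (cu.pow 2 |>.inv₀ fun θ => (pow_pos (S.pos θ t) 2).ne')) hg
  have e := S.σper 0 t
  rw [zero_add] at e
  rw [e] at h
  refine h.trans ?_
  have := (show Function.Periodic g (2 * π) from hp).intervalIntegral_add_eq (σ 0 t) 0
  rwa [zero_add] at this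

lemma Sol.avg_le_two (S : Sol T κ W u σ) {t : ℝ} (ht : t ∈ Set.Icc 0 T) : avg κ t ≤ 2 := by
  have hu := S.smu.contDiff_left t
  have cu := S.smu.continuous_left t
  have cux := S.smu.dx.continuous_left t
  have cuxx := S.smu.dx.dx.continuous_left t
  have hlen : ∫ θ in (0 : ℝ)..2 * π, (u θ t ^ 2)⁻¹ = 2 * π := by
    have := S.integral_comp (g := fun _ => 1) continuous_const (fun _ => rfl) t
    simpa using this
  have h1 := energy_le hu (S.peru t) (S.pos · t) hlen (S.orth cos (.inl rfl) t ht)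
    (S.orth sin (.inr rfl) t ht)
  have h2 : ∫ x in (0 : ℝ)..2 * π, κ x t
      = ∫ θ in (0 : ℝ)..2 * π, (u θ t ^ 2 - dx u θ t ^ 2) := by
    rw [← S.integral_comp (S.smκ.continuous_left t) (S.perκ t) t]
    have e : ∫ θ in (0 : ℝ)..2 * π, κ (σ θ t) t * (u θ t ^ 2)⁻¹
        = ∫ θ in (0 : ℝ)..2 * π, u θ t * (dx (dx u) θ t + u θ t) := by
      refine intervalIntegral.integral_congr fun θ _ => ?_
      have := (S.pos θ t).ne'
      simp only [← S.curv t ht θ]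
      field_simp
    rw [e]
    refine integral_eq_of_per (P := fun θ => u θ t * dx u θ t) (fun θ => ?_) (fun θ => ?_)
      (by fun_prop) (by fun_prop)
    · simp only [S.peru t θ, S.smu.per_dx S.peru t θ]
    · refine ((S.smu.hasDerivAt_x θ t).mul (S.smu.dx.hasDerivAt_x θ t)).congr_deriv ?_
      ring
  have h3 : ∫ x in (0 : ℝ)..2 * π, κ x t ≤ 4 * π := h2.trans_le h1
  rw [avg, inv_mul_le_iff₀ two_pi_pos]
  linarith

/-- The a priori bound for the growth of the variance. -/
lemma Sol.vari_deriv_le (S : Sol T κ W u σ) {t : ℝ} (ht : t ∈ Set.Icc 0 T) :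
    -(1 / 2) * diri κ t + 2 * avg κ t * vari κ t
      + 3 / 2 * (∫ x in (0 : ℝ)..2 * π, (κ x t - avg κ t) ^ 3)
      ≤ 4 * vari κ t + 8 * vari κ t ^ 2 := by
  have h1 := S.avg_le_two ht
  have h2 := S.cubic_le (S.abs_η_le · t)
  set s := √(2 * π * diri κ t)
  have hs : s ^ 2 = 2 * π * diri κ t := sq_sqrt (by have := diri_nonneg κ t; positivity)
  have hF := vari_nonneg κ t
  set F := vari κ t
  set D := diri κ t
  have h3 : 2 * avg κ t * F ≤ 4 * F := by nlinarith
  have h4 : π * (-(1 / 2) * D + 3 / 2 * (s * F)) ≤ π * (8 * F ^ 2) := by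
    have : π ^ 2 ≤ 10 := by nlinarith [pi_lt_d2, pi_pos]
    nlinarith [sq_nonneg (s - 3 * π * F),
      mul_le_mul_of_nonneg_right pi_lt_d2.le (mul_nonneg pi_pos.le (sq_nonneg F))]
  have h5 := le_of_mul_le_mul_left h4 pi_pos
  linarith

lemma Sol.avg_mono (S : Sol T κ W u σ) {s t : ℝ} (hs : 0 ≤ s) (hst : s ≤ t) (ht : t ≤ T) :
    avg κ s ≤ avg κ t := by
  refine monotoneOn_of_deriv_nonneg (convex_Icc 0 T) (fun x hx =>
    (S.hasDerivAt_avg hx).continuousAt.continuousWithinAt) (fun x hx =>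
    (S.hasDerivAt_avg (interior_subset hx)).differentiableAt.differentiableWithinAt) (fun x hx => ?_)
    ⟨hs, hst.trans ht⟩ ⟨hs.trans hst, ht⟩ hst
  rw [(S.hasDerivAt_avg (interior_subset hx)).deriv]
  have := vari_nonneg κ x
  positivity

lemma Sol.vari_growth (S : Sol T κ W u σ) {s t : ℝ} (hs : 0 ≤ s) (hst : s ≤ t) (ht : t ≤ T) :
    vari κ t ≤ exp (4 * (t - s) + 32 * π * (avg κ t - avg κ s)) * vari κ s := by
  have hd : ∀ x ∈ Set.Icc 0 T, HasDerivAt (fun r => vari κ r * exp (-(4 * r + 32 * π * avg κ r)))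
      (((-(1 / 2) * diri κ x + 2 * avg κ x * vari κ x
        + 3 / 2 * (∫ y in (0 : ℝ)..2 * π, (κ y x - avg κ x) ^ 3)) - 4 * vari κ x - 8 * vari κ x ^ 2)
        * exp (-(4 * x + 32 * π * avg κ x))) x := fun x hx => by
    refine ((S.hasDerivAt_vari hx).mul ((((hasDerivAt_id x).const_mul 4).add
      ((S.hasDerivAt_avg hx).const_mul (32 * π))).neg.exp)).congr_deriv ?_
    simp only [id, Pi.add_apply, Pi.neg_apply]
    field_simp
    ring
  have h := antitoneOn_of_deriv_nonpos (convex_Icc 0 T) (fun x hx =>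
    (hd x hx).continuousAt.continuousWithinAt) (fun x hx =>
    (hd x (interior_subset hx)).differentiableAt.differentiableWithinAt) (fun x hx => by
      rw [(hd x (interior_subset hx)).deriv]
      refine mul_nonpos_of_nonpos_of_nonneg ?_ (exp_pos _).le
      linarith [S.vari_deriv_le (interior_subset hx)])
    ⟨hs, hst.trans ht⟩ ⟨hs.trans hst, ht⟩ hst
  have e := mul_le_mul_of_nonneg_right h (exp_pos (4 * t + 32 * π * avg κ t)).le
  simp only [mul_assoc, ← exp_add] at e
  rw [neg_add_cancel, exp_zero, mul_one] at e
  refine e.trans_eq ?_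
  rw [mul_comm]
  congr 2
  ring

lemma Sol.vari_le_increment (S : Sol T κ W u σ) {t : ℝ} (h1 : 1 ≤ t) (ht : t ≤ T) :
    vari κ t ≤ exp (4 + 32 * π * (avg κ t - avg κ (t - 1))) * (4 * π * (avg κ t - avg κ (t - 1))) := by
  obtain ⟨s, hs, he⟩ := exists_hasDerivAt_eq_slope (avg κ) (fun s => (4 * π)⁻¹ * vari κ s)
    (show t - 1 < t by linarith) (fun s hs => (S.hasDerivAt_avg
      ⟨by linarith [hs.1], hs.2.trans ht⟩).continuousAt.continuousWithinAt) fun s hs =>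
      S.hasDerivAt_avg ⟨by linarith [hs.1], hs.2.le.trans ht⟩
  rw [show t - (t - 1) = 1 by ring, div_one] at he
  have e1 : vari κ s = 4 * π * (avg κ t - avg κ (t - 1)) := by
    rw [← he]
    field_simp
  rw [← e1]
  have e2 := S.avg_mono (show 0 ≤ t - 1 by linarith) hs.1.le (hs.2.le.trans ht)
  refine (S.vari_growth (by linarith [hs.1]) hs.2.le ht).trans ?_
  refine mul_le_mul_of_nonneg_right (exp_le_exp.2 ?_) (vari_nonneg κ s)
  have := mul_le_mul_of_nonneg_left (sub_le_sub_left e2 (avg κ t)) (show 0 ≤ 32 * π by positivity)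
  linarith [hs.1]

lemma Sol.vari_le (S : Sol T κ W u σ) {t : ℝ} (ht : t ∈ Set.Icc 0 T) :
    vari κ t ≤ exp (4 + 32 * π * (2 - avg κ 0)) * (vari κ 0 + 4 * π * (2 - avg κ 0)) := by
  have h0 := S.avg_le_two (t := 0) ⟨le_rfl, ht.1.trans ht.2⟩
  have h1 := S.avg_le_two ht
  have hF := vari_nonneg κ 0
  have hp := pi_pos
  rcases le_total t 1 with h | h
  · refine (S.vari_growth le_rfl ht.1 ht.2).trans ?_
    refine mul_le_mul (exp_le_exp.2 ?_) (by nlinarith) hF (exp_pos _).le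
    nlinarith
  · have h2 := S.avg_mono le_rfl (show 0 ≤ t - 1 by linarith) (by linarith [ht.2])
    refine (S.vari_le_increment h ht.2).trans ?_
    have h3 := S.avg_mono (show 0 ≤ t - 1 by linarith) (by linarith : t - 1 ≤ t) ht.2
    refine mul_le_mul (exp_le_exp.2 ?_) ?_ ?_ (exp_pos _).le
    · nlinarith
    · nlinarith
    · nlinarith

end

lemma norm_le_of_damped {y b : ℝ → ℂ} {lam B T : ℝ} (hlam : 0 < lam)
    (hd : ∀ t ∈ Set.Icc 0 T, HasDerivAt y (-(lam : ℂ) * y t + b t) t)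
    (hb : ∀ t ∈ Set.Icc 0 T, ‖b t‖ ≤ B) : ∀ t ∈ Set.Icc 0 T, ‖y t‖ ≤ ‖y 0‖ + B / lam := by
  have he : ∀ t : ℝ, HasDerivAt (fun t => exp (lam * t)) (exp (lam * t) * lam) t := fun t => by
    simpa using ((hasDerivAt_id t).const_mul lam).exp
  have hf : ∀ t ∈ Set.Icc 0 T, HasDerivAt (fun t => exp (lam * t) • y t) (exp (lam * t) • b t) t :=
    fun t ht => by
      refine ((he t).smul (hd t ht)).congr_deriv ?_
      simp only [Complex.real_smul]
      push_cast
      ring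
  have hB : ∀ t, HasDerivAt (fun t => ‖y 0‖ + B / lam * (exp (lam * t) - 1)) (exp (lam * t) * B) t :=
    fun t => by
      refine ((((he t).sub_const 1).const_mul (B / lam)).const_add ‖y 0‖).congr_deriv ?_
      field_simp
  intro t ht
  have h := image_norm_le_of_norm_deriv_right_le_deriv_boundary
    (fun x hx => (hf x hx).continuousAt.continuousWithinAt)
    (fun x hx => (hf x ⟨hx.1, hx.2.le⟩).hasDerivWithinAt) (by simp) hB (fun x hx => by
      rw [norm_smul, norm_of_nonneg (exp_pos _).le]
      exact mul_le_mul_of_nonneg_left (hb x ⟨hx.1, hx.2.le⟩) (exp_pos _).le) ht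
  rw [norm_smul, norm_of_nonneg (exp_pos _).le] at h
  have hB0 : 0 ≤ B := (norm_nonneg _).trans (hb t ht)
  have h1 : 1 ≤ exp (lam * t) := one_le_exp (mul_nonneg hlam.le ht.1)
  have h2 : exp (lam * t) * ‖y t‖ ≤ exp (lam * t) * (‖y 0‖ + B / lam) := by
    have h3 : 0 ≤ B / lam := by positivity
    nlinarith [norm_nonneg (y 0)]
  exact le_of_mul_le_mul_left h2 (exp_pos _)

lemma contDiff_ofReal {f : ℝ → ℝ} (hf : ContDiff ℝ (⊤ : ℕ∞) f) :
    ContDiff ℝ (⊤ : ℕ∞) fun x => (f x : ℂ) := Complex.ofRealCLM.contDiff.comp hf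

section
variable {T : ℝ} {κ W u σ : ℝ → ℝ → ℝ}

lemma Sol.hasSum_fc_sq (S : Sol T κ W u σ) (t : ℝ) :
    HasSum (fun k => ‖fc (fun x => (κ x t : ℂ)) k‖ ^ 2) (avg κ t ^ 2 + (2 * π)⁻¹ * vari κ t) := by
  have h := hasSum_parseval (contDiff_ofReal (S.smκ.contDiff_left t))
    (fun x => by simp only [S.perκ t x])
  have ck := S.smκ.continuous_left t
  have e : ∫ x in (0 : ℝ)..2 * π, ‖(κ x t : ℂ)‖ ^ 2
      = vari κ t + 2 * π * avg κ t ^ 2 := by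
    have c1 : Continuous fun x => (κ x t - avg κ t) ^ 2 := by fun_prop
    have c2 : Continuous fun x => 2 * avg κ t * (κ x t - avg κ t) := by fun_prop
    have c3 : Continuous fun x => (κ x t - avg κ t) ^ 2 + 2 * avg κ t * (κ x t - avg κ t) := by
      fun_prop
    have c4 : Continuous fun _ : ℝ => avg κ t ^ 2 := continuous_const
    have e1 : ∫ x in (0 : ℝ)..2 * π, ‖(κ x t : ℂ)‖ ^ 2 = ∫ x in (0 : ℝ)..2 * π,
        ((κ x t - avg κ t) ^ 2 + 2 * avg κ t * (κ x t - avg κ t) + avg κ t ^ 2) := by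
      refine intervalIntegral.integral_congr fun x _ => ?_
      simp only [Complex.norm_real, Real.norm_eq_abs, sq_abs]
      ring
    rw [e1, intervalIntegral.integral_add (c3.intervalIntegrable _ _) (c4.intervalIntegrable _ _),
      intervalIntegral.integral_add (c1.intervalIntegrable _ _) (c2.intervalIntegrable _ _),
      intervalIntegral.integral_const_mul, S.integral_η t, intervalIntegral.integral_const,
      smul_eq_mul, vari]
    ring
  rw [e] at h
  convert h using 1
  have := pi_pos.ne'
  field_simp
  ring

lemma Sol.mode_bound (S : Sol T κ W u σ) {R C0 R2 : ℝ} (hR : 0 < R) {c : ℤ → ℝ → ℂ}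
    (hc : ∀ k t, c k t = fc (fun x => (κ x t : ℂ)) k)
    (hcd : ∀ k t, HasDerivAt (c k)
      (↑(tcut k t) * (-(↑k ^ 2 / 4) * c k t + Bclip R (fun j => c j t) k)) t)
    (hgood : ∀ t ∈ Set.Icc 0 T, ∀ k, ‖c k t‖ * wt k ≤ R)
    (hR2 : ∀ t ∈ Set.Icc 0 T, avg κ t ^ 2 + (2 * π)⁻¹ * vari κ t ≤ R2)
    (hC0 : ∀ k, ‖c k 0‖ * wt k ≤ C0) :
    ∀ t ∈ Set.Icc 0 T, ∀ k, ‖c k t‖ * wt k ≤ C0 + 16 * R2 + 1 := by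
  intro t ht k
  have hsum : ∀ t, HasSum (fun k => ‖c k t‖ ^ 2) (avg κ t ^ 2 + (2 * π)⁻¹ * vari κ t) := fun t => by
    simpa only [hc] using S.hasSum_fc_sq t
  have hC00 : 0 ≤ C0 := le_trans (mul_nonneg (norm_nonneg _) (wt_pos 0).le) (hC0 0)
  have hnn : 0 ≤ avg κ t ^ 2 + (2 * π)⁻¹ * vari κ t := by
    have := vari_nonneg κ t
    positivity
  have hR20 : 0 ≤ R2 := hnn.trans (hR2 t ht)
  by_cases hk : k = 0
  · subst hk
    have h1 := le_hasSum (hsum t) 0 fun j _ => sq_nonneg _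
    have h2 := h1.trans (hR2 t ht)
    simp only [wt, Int.cast_zero, abs_zero, add_zero, mul_one]
    nlinarith [norm_nonneg (c 0 t)]
  · have hk1 : (1 : ℝ) ≤ |(k : ℝ)| := by exact_mod_cast Int.one_le_abs hk
    have hk2 : (0 : ℝ) < (k : ℝ) ^ 2 / 4 := by
      have : (k : ℝ) ^ 2 = |(k : ℝ)| ^ 2 := (sq_abs _).symm
      rw [this]; positivity
    have h := norm_le_of_damped (y := c k) (b := fun t => Bclip R (fun j => c j t) k)
      (B := wt k * R2) (T := T) hk2 (fun s hs => by
        refine (hcd k s).congr_deriv ?_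
        rw [tcut_eq_one k hs.1]
        push_cast
        ring) (fun s hs => by
        have e : Bclip R (fun j => c j s) k = Bq (fun j => c j s) (fun j => c j s) k := by
          simp only [Bclip]
          congr 1 <;>
          · funext j
            exact clipC_eq_self (div_pos hR (wt_pos j)) ((le_div_iff₀ (wt_pos j)).2 (hgood s hs j))
        rw [e]
        refine (norm_Bq_le_of_summable_sq (hsum s).summable k).trans ?_
        rw [(hsum s).tsum_eq]
        exact mul_le_mul_of_nonneg_left (hR2 s hs) (wt_pos k).le) t ht
    have hw := wt_pos k
    have h1 := mul_le_mul_of_nonneg_right h hw.le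
    have h2 : wt k * R2 / ((k : ℝ) ^ 2 / 4) * wt k ≤ 16 * R2 := by
      rw [div_mul_eq_mul_div, div_le_iff₀ hk2]
      have h3 : wt k ^ 2 ≤ 4 * (k : ℝ) ^ 2 := by
        rw [← sq_abs (k : ℝ), wt]
        nlinarith
      nlinarith
    have h4 := hC0 k
    nlinarith

end

lemma good_times {c : ℤ → ℝ → ℂ} (hrap : Rap c) {R : ℝ} (hR : 0 < R)
    (h0 : ∀ k, ‖c k 0‖ * wt k < R)
    (hstep : ∀ T, 0 ≤ T → (∀ t ∈ Set.Icc 0 T, ∀ k, ‖c k t‖ * wt k ≤ R) →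
      ∀ k, ‖c k T‖ * wt k < R) (b : ℝ) :
    ∀ t ∈ Set.Icc 0 b, ∀ k, ‖c k t‖ * wt k ≤ R := by
  have hcont : ∀ k, Continuous fun t => ‖c k t‖ * wt k := fun k =>
    (hrap.1 k).norm.mul continuous_const
  rcases lt_or_ge b 0 with hb | hb
  · intro t ht
    linarith [ht.1, ht.2]
  have key : Set.Icc 0 b ⊆ {T | ∀ t ∈ Set.Icc 0 T, ∀ k, ‖c k t‖ * wt k ≤ R} := by
    refine IsClosed.Icc_subset_of_forall_exists_gt ?_ ?_ ?_
    · refine IsClosed.inter (isOpen_compl_iff.1 ?_) isClosed_Icc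
      refine isOpen_iff_mem_nhds.2 fun T hT => ?_
      simp only [Set.mem_compl_iff, Set.mem_ofPred_eq, not_forall, not_le] at hT
      obtain ⟨t, ht, k, hk⟩ := hT
      have htpos : 0 < t := by
        rcases ht.1.eq_or_lt with h | h
        · rw [← h] at hk
          linarith [h0 k]
        · exact h
      have hev : ∀ᶠ s in nhds t, R < ‖c k s‖ * wt k ∧ 0 < s :=
        ((hcont k).continuousAt.eventually (lt_mem_nhds hk)).and (lt_mem_nhds htpos)
      obtain ⟨ε, hε, hball⟩ := Metric.eventually_nhds_iff.1 hev
      have h1 := hball (y := t - ε / 2) (by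
        rw [Real.dist_eq, sub_sub_cancel_left, abs_neg, abs_of_pos (by positivity)]
        linarith)
      filter_upwards [lt_mem_nhds (show t - ε / 2 < T by linarith [ht.2])] with s hs hbad
      exact absurd (hbad _ ⟨h1.2.le, hs.le⟩ k) (not_le.2 h1.1)
    · intro t ht k
      rw [le_antisymm ht.2 ht.1]
      exact (h0 k).le
    · intro T hT y hy
      have hT0 := hT.2.1
      have hlt := hstep T hT0 hT.1
      obtain ⟨C, hC⟩ := hrap.2 2 (T + 1)
      obtain ⟨N, hN⟩ := exists_nat_gt (C / R)
      have hev : ∀ᶠ s in nhds T, ∀ k ∈ Finset.Icc (-(N : ℤ)) N, ‖c k s‖ * wt k < R :=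
        (Filter.eventually_all_finset _).2 fun k _ =>
          (hcont k).continuousAt.eventually (gt_mem_nhds (hlt k))
      obtain ⟨ε, hε, hball⟩ := Metric.eventually_nhds_iff.1 hev
      set δ := min (min (ε / 2) 1) (y - T)
      have hy' : T < y := hy
      have hδ : 0 < δ := lt_min (lt_min (by positivity) one_pos) (by linarith)
      have hδ1 : δ ≤ ε / 2 := (min_le_left _ _).trans (min_le_left _ _)
      have hδ2 : δ ≤ 1 := (min_le_left _ _).trans (min_le_right _ _)
      have hδ3 : δ ≤ y - T := min_le_right _ _
      refine ⟨T + δ, fun t ht k => ?_, by linarith, by linarith⟩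
      rcases le_total t T with h | h
      · exact hT.1 t ⟨ht.1, h⟩ k
      by_cases hk : k ∈ Finset.Icc (-(N : ℤ)) N
      · refine (hball ?_ k hk).le
        rw [Real.dist_eq, abs_of_nonneg (by linarith)]
        linarith [ht.2]
      · have h1 := hC k t (by rw [abs_of_nonneg ht.1]; linarith [ht.2])
        have hw := wt_pos k
        have hkN : (N : ℝ) ≤ wt k := by
          have : (N : ℤ) ≤ |k| := by
            rw [Finset.mem_Icc, ← abs_le] at hk
            exact (not_le.1 hk).le
          have h2 : (N : ℝ) ≤ |(k : ℝ)| := by exact_mod_cast this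
          rw [wt]; linarith
        have h3 : C ≤ R * wt k := by
          rw [mul_comm]
          exact (div_le_iff₀ hR).1 (hN.le.trans hkN)
        calc ‖c k t‖ * wt k ≤ C / wt k ^ 2 * wt k := by gcongr
          _ = C / wt k := by field_simp
          _ ≤ R := (div_le_iff₀ hw).2 h3
  exact key (Set.right_mem_Icc.2 hb)

theorem exists_global {u₀ : ℝ → ℝ} (h0 : ContDiff ℝ (⊤ : ℕ∞) u₀) (h0per : Per u₀)
    (h0pos : ∀ θ, 0 < u₀ θ) (h0norm : ∫ θ in (0 : ℝ)..2 * π, (u₀ θ ^ 2)⁻¹ = 2 * π)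
    (h0orthc : ∫ θ in (0 : ℝ)..2 * π, (u₀ θ ^ 3)⁻¹ * cos θ = 0)
    (h0orths : ∫ θ in (0 : ℝ)..2 * π, (u₀ θ ^ 3)⁻¹ * sin θ = 0) :
    ∃ κ W u σ : ℝ → ℝ → ℝ, (∀ θ, u θ 0 = u₀ θ) ∧ ∀ T, Sol T κ W u σ := by
  obtain ⟨σ₀, κ₀, hσs, hκs, hκp, hσd, hσp, hcurv⟩ := exists_initial h0 h0per h0pos h0norm
  set A0 := avg (fun x _ => κ₀ x) 0 with hA0
  set F0 := vari (fun x _ => κ₀ x) 0 with hF0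
  obtain ⟨C, hC⟩ := fc_decay (contDiff_ofReal hκs) (fun x => by simp only [hκp x]) 1
  set R2 := A0 ^ 2 + 4 + (2 * π)⁻¹ * (exp (4 + 32 * π * (2 - A0)) * (F0 + 4 * π * (2 - A0))) with hR2
  set R := C + 16 * R2 + 2 with hRd
  have hC0 : 0 ≤ C := by
    have h := hC 0
    rw [pow_one] at h
    have := (le_div_iff₀ (wt_pos 0)).1 h
    exact (mul_nonneg (norm_nonneg _) (wt_pos 0).le).trans this
  by_cases hR20 : 0 ≤ R2
  swap
  · exfalso
    obtain ⟨c, κ, W, u, σ, hrap, hc, hcd, hκ0, hu0, hS⟩ := exists_clipped_flow h0pos hσs hκs hκp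
      hσd hσp hcurv h0orthc h0orths (R := C + 1) (by linarith)
    have S := hS 0 fun t ht k => by
      rw [le_antisymm ht.2 ht.1, hc]
      simp only [hκ0]
      have h := hC k
      rw [pow_one] at h
      linarith [(le_div_iff₀ (wt_pos k)).1 h]
    have h1 := S.vari_le (t := 0) ⟨le_rfl, le_rfl⟩
    have e1 : avg κ 0 = A0 := by simp only [hA0, avg, hκ0]
    have e2 : vari κ 0 = F0 := by simp only [hF0, vari, e1, hκ0]; rfl
    rw [e1, e2] at h1
    have h2 : 0 ≤ F0 := vari_nonneg _ _
    refine hR20 (add_nonneg (by positivity) (mul_nonneg (by positivity) (h2.trans h1)))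
  have hRpos : 0 < R := by linarith
  obtain ⟨c, κ, W, u, σ, hrap, hc, hcd, hκ0, hu0, hS⟩ := exists_clipped_flow h0pos hσs hκs hκp
    hσd hσp hcurv h0orthc h0orths hRpos
  have e1 : avg κ 0 = A0 := by simp only [hA0, avg, hκ0]
  have e2 : vari κ 0 = F0 := by simp only [hF0, vari, e1, hκ0]; rfl
  have hci : ∀ k, ‖c k 0‖ * wt k ≤ C := fun k => by
    rw [hc]
    simp only [hκ0]
    have h := hC k
    rw [pow_one] at h
    exact (le_div_iff₀ (wt_pos k)).1 h
  refine ⟨κ, W, u, σ, hu0, fun T => hS T ?_⟩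
  refine good_times hrap hRpos (fun k => by linarith [hci k]) (fun T hT hgood k => ?_) T
  have S := hS T hgood
  have := S.mode_bound hRpos hc hcd hgood (C0 := C) (R2 := R2) (fun t ht => ?_) hci T ⟨hT, le_rfl⟩ k
  · linarith
  · have h1 := S.vari_le ht
    have h2 := S.avg_le_two ht
    have h3 := S.avg_mono le_rfl ht.1 ht.2
    rw [e1, e2] at h1
    rw [e1] at h3
    have h4 : avg κ t ^ 2 ≤ A0 ^ 2 + 4 := by
      rcases le_total 0 (avg κ t) with h | h
      · nlinarith [sq_nonneg A0]
      · nlinarith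
    exact add_le_add h4 (mul_le_mul_of_nonneg_left h1 (by positivity))

lemma norm_fc_le_of_le {f : ℝ → ℂ} {g : ℝ → ℝ} (hf : Continuous f) (hg : Continuous g)
    (h : ∀ x, ‖f x‖ ≤ g x) (k : ℤ) : ‖fc f k‖ ≤ (2 * π)⁻¹ * ∫ x in (0 : ℝ)..2 * π, g x := by
  have hp := two_pi_pos
  have e : ‖(2 * π : ℂ)⁻¹‖ = (2 * π)⁻¹ := by
    rw [norm_inv]
    norm_cast
    rw [norm_of_nonneg hp.le]
  rw [fc, norm_mul, e]
  refine mul_le_mul_of_nonneg_left ?_ (by positivity)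
  refine (intervalIntegral.norm_integral_le_integral_norm hp.le).trans ?_
  have c1 : Continuous fun x => ‖f x * ek (-k) x‖ := (hf.mul (continuous_ek _)).norm
  refine intervalIntegral.integral_mono_on hp.le (c1.intervalIntegrable _ _)
    (hg.intervalIntegrable _ _) fun x _ => ?_
  rw [norm_mul, norm_ek, mul_one]
  exact h x

lemma mean_abs_le {f : ℝ → ℝ} (hf : Continuous f) :
    (2 * π)⁻¹ * ∫ x in (0 : ℝ)..2 * π, |f x| ≤ √((2 * π)⁻¹ * ∫ x in (0 : ℝ)..2 * π, f x ^ 2) := by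
  have hp := two_pi_pos
  set μ := (2 * π)⁻¹ * ∫ x in (0 : ℝ)..2 * π, |f x| with hμ
  refine le_sqrt_of_sq_le ?_
  have h0 : 0 ≤ ∫ x in (0 : ℝ)..2 * π, (|f x| - μ) ^ 2 :=
    intervalIntegral.integral_nonneg hp.le fun _ _ => sq_nonneg _
  have c1 : Continuous fun x => f x ^ 2 := by fun_prop
  have c2 : Continuous fun x => 2 * μ * |f x| := by fun_prop
  have c3 : Continuous fun x => f x ^ 2 - 2 * μ * |f x| := by fun_prop
  have c4 : Continuous fun _ : ℝ => μ ^ 2 := continuous_const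
  have e : ∫ x in (0 : ℝ)..2 * π, (|f x| - μ) ^ 2
      = ∫ x in (0 : ℝ)..2 * π, (f x ^ 2 - 2 * μ * |f x| + μ ^ 2) :=
    intervalIntegral.integral_congr fun x _ => by
      simp only [sub_sq, sq_abs]
      ring
  rw [e, intervalIntegral.integral_add (c3.intervalIntegrable _ _) (c4.intervalIntegrable _ _),
    intervalIntegral.integral_sub (c1.intervalIntegrable _ _) (c2.intervalIntegrable _ _),
    intervalIntegral.integral_const_mul, intervalIntegral.integral_const, smul_eq_mul] at h0
  have e2 : ∫ x in (0 : ℝ)..2 * π, |f x| = 2 * π * μ := by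
    rw [hμ, mul_inv_cancel_left₀ hp.ne']
  rw [e2] at h0
  rw [inv_mul_eq_div, le_div_iff₀ hp]
  nlinarith

lemma hasSum_int_inv_sq : HasSum (fun k : ℤ => 1 / (k : ℝ) ^ 2) (π ^ 2 / 3) := by
  have h := HasSum.of_nat_of_neg (f := fun k : ℤ => 1 / (k : ℝ) ^ 2) (by simpa using hasSum_zeta_two)
    (by simpa using hasSum_zeta_two)
  refine (show _ = π ^ 2 / 3 from ?_) ▸ h
  norm_num
  ring

lemma Per.exists_max {f : ℝ → ℝ} (h : Per f) (hc : Continuous f) : ∃ y, ∀ x, f x ≤ f y := by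
  obtain ⟨y, -, hy⟩ := (isCompact_Icc (a := (0 : ℝ)) (b := 2 * π)).exists_isMaxOn
    (Set.nonempty_Icc.2 two_pi_pos.le) hc.continuousOn
  refine ⟨y, fun x => ?_⟩
  obtain ⟨z, hz, hxz⟩ := (show Function.Periodic f (2 * π) from h).exists_mem_Ico₀ two_pi_pos x
  rw [hxz]
  exact hy ⟨hz.1, hz.2.le⟩

section
variable {κ : ℝ → ℝ} {S S' : ℝ → ℂ} (hκ : Continuous κ) (hS : ContDiff ℝ (⊤ : ℕ∞) S) (hSp : Per S)
  (hd : ∀ x, HasDerivAt S (S' x) x) (hd' : ∀ x, HasDerivAt S' (-(κ x * S x)) x)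
include hκ hS hSp hd hd'

lemma hill_modes (k : ℤ) (a : ℝ) :
    ((k : ℂ) ^ 2 - a) * fc S k = fc (fun x => ((κ x - a : ℝ) : ℂ) * S x) k := by
  have cS := hS.continuous
  have cS' : Continuous S' := continuous_iff_continuousAt.2 fun x => (hd' x).continuousAt
  have cκ : Continuous fun x => (κ x : ℂ) := Complex.continuous_ofReal.comp hκ
  have c1 : Continuous fun x => -((κ x : ℂ) * S x) := (cκ.mul cS).neg
  have h1 := fc_deriv (hSp.deriv hd) hd' c1 k
  rw [fc_deriv hSp hd cS' k] at h1
  have h2 : fc (fun x => ((κ x - a : ℝ) : ℂ) * S x) k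
      = -fc (fun x => -((κ x : ℂ) * S x)) k - a * fc S k := by
    have c2 : Continuous fun x => -((κ x : ℂ) * S x) * ek (-k) x := c1.mul (continuous_ek _)
    have c3 : Continuous fun x => S x * ek (-k) x := cS.mul (continuous_ek _)
    have e : ∫ x in (0 : ℝ)..2 * π, ((κ x - a : ℝ) : ℂ) * S x * ek (-k) x
        = ∫ x in (0 : ℝ)..2 * π, (-(-((κ x : ℂ) * S x) * ek (-k) x) - a * (S x * ek (-k) x)) :=
      intervalIntegral.integral_congr fun x _ => by
        push_cast
        ring
    have c2' : Continuous fun x => -(-((κ x : ℂ) * S x) * ek (-k) x) := c2.neg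
    have c3' : Continuous fun x => (a : ℂ) * (S x * ek (-k) x) := continuous_const.mul c3
    rw [fc, fc, fc, e, intervalIntegral.integral_sub (c2'.intervalIntegrable _ _)
      (c3'.intervalIntegrable _ _), intervalIntegral.integral_neg,
      intervalIntegral.integral_const_mul]
    ring
  rw [h2, h1]
  linear_combination ((k : ℂ) ^ 2 * fc S k) * Complex.I_sq

/-- If the potential of Hill's equation is nearly constant, a periodic solution without modes
`0` and `-1` is close to a multiple of `e^{ix}`. -/
lemma hill_close {a ε : ℝ} (ha : a ≤ 2) (hε : (2 * π)⁻¹ * ∫ x in (0 : ℝ)..2 * π, |κ x - a| ≤ ε)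
    (hε1 : ε ≤ 1 / 84) (h0 : fc S 0 = 0) (h1 : fc S (-1) = 0) (hne : ∃ x, S x ≠ 0) :
    fc S 1 ≠ 0 ∧ |a - 1| ≤ 2 * ε ∧ ∀ x, ‖S x / fc S 1 - ek 1 x‖ ≤ 8 * ε := by
  have cS := hS.continuous
  obtain ⟨y, hy⟩ := Per.exists_max (f := fun x => ‖S x‖) (fun x => by simp only [hSp x]) cS.norm
  set m := ‖S y‖ with hm
  have hmpos : 0 < m := by
    obtain ⟨x, hx⟩ := hne
    exact (norm_pos_iff.2 hx).trans_le (hy x)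
  have cη : Continuous fun x => κ x - a := by fun_prop
  have cη' : Continuous fun x => ((κ x - a : ℝ) : ℂ) := Complex.continuous_ofReal.comp cη
  have hε0 : 0 ≤ ε := le_trans (mul_nonneg (inv_nonneg.2 two_pi_pos.le)
    (intervalIntegral.integral_nonneg two_pi_pos.le fun _ _ => abs_nonneg _)) hε
  have hmode : ∀ k : ℤ, |(k : ℝ) ^ 2 - a| * ‖fc S k‖ ≤ ε * m := fun k => by
    have e : |(k : ℝ) ^ 2 - a| = ‖(k : ℂ) ^ 2 - a‖ := by
      rw [← Real.norm_eq_abs, ← Complex.norm_real]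
      push_cast
      rfl
    rw [e, ← norm_mul, hill_modes hκ hS hSp hd hd']
    refine (norm_fc_le_of_le (f := fun x => ((κ x - a : ℝ) : ℂ) * S x)
      (g := fun x => |κ x - a| * m) (cη'.mul cS) (by fun_prop) (fun x => ?_)
      k).trans ?_
    · rw [norm_mul, Complex.norm_real, Real.norm_eq_abs]
      exact mul_le_mul_of_nonneg_left (hy x) (abs_nonneg _)
    · rw [intervalIntegral.integral_mul_const, ← mul_assoc]
      exact mul_le_mul_of_nonneg_right hε hmpos.le
  have hrem : ∀ x, ‖S x - fc S 1 * ek 1 x‖ ≤ 7 * ε * m := fun x => by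
    have hs := hasSum_ite_sub_hasSum (hasSum_fc hS hSp x) 1
    have hb := hasSum_int_inv_sq.mul_left (2 * ε * m)
    refine (hs.norm_le_of_bounded hb fun k => ?_).trans ?_
    · have hnn : 0 ≤ 2 * ε * m * (1 / (k : ℝ) ^ 2) := by positivity
      split_ifs with hk
      · rwa [norm_zero]
      rw [norm_mul, norm_ek, mul_one]
      by_cases hk0 : k = 0
      · rw [hk0, h0, norm_zero]; simp
      by_cases hk1 : k = -1
      · rw [hk1, h1, norm_zero]; simp only [hk1] at hnn; exact hnn
      have hk2 : (2 : ℤ) ≤ |k| := by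
        rcases abs_cases k with h | h <;> omega
      have hk3 : (4 : ℝ) ≤ (k : ℝ) ^ 2 := by
        have : (2 : ℝ) ≤ |(k : ℝ)| := by exact_mod_cast hk2
        rw [← sq_abs]
        nlinarith
      have h2 := hmode k
      rw [abs_of_nonneg (by linarith)] at h2
      rw [mul_one_div, le_div_iff₀ (by linarith)]
      nlinarith [norm_nonneg (fc S k)]
    · have hp : π ^ 2 / 3 ≤ 7 / 2 := by nlinarith [pi_lt_d2, pi_pos]
      nlinarith [mul_nonneg hε0 hmpos.le]
  have hS1 : 11 / 12 * m ≤ ‖fc S 1‖ := by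
    have h2 := hrem y
    have h3 := norm_sub_norm_le (S y) (fc S 1 * ek 1 y)
    rw [norm_mul, norm_ek, mul_one, ← hm] at h3
    nlinarith
  have hS1pos : 0 < ‖fc S 1‖ := lt_of_lt_of_le (by positivity) hS1
  refine ⟨norm_pos_iff.1 hS1pos, ?_, fun x => ?_⟩
  · have h2 := hmode 1
    rw [Int.cast_one, one_pow, abs_sub_comm] at h2
    have h3 := mul_le_mul_of_nonneg_left hS1 (abs_nonneg (a - 1))
    have h4 : |a - 1| * (11 / 12) ≤ ε := le_of_mul_le_mul_right (by linarith) hmpos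
    linarith
  · have e : S x / fc S 1 - ek 1 x = (S x - fc S 1 * ek 1 x) / fc S 1 := by
      rw [sub_div, mul_div_cancel_left₀ _ (norm_pos_iff.1 hS1pos)]
    rw [e, norm_div, div_le_iff₀ hS1pos]
    have h2 := hrem x
    nlinarith

end

/-- Spectral gap: a function which is nearly orthogonal to the modes `0, ±1, ±2`. -/
lemma gap_of_modes {f f' : ℝ → ℝ} (hf : ContDiff ℝ (⊤ : ℕ∞) f) (hf' : ContDiff ℝ (⊤ : ℕ∞) f')
    (hp : Per f) (hd : ∀ x, HasDerivAt f (f' x) x) {F D B1 B2 : ℝ}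
    (hF : F = ∫ x in (0 : ℝ)..2 * π, f x ^ 2) (hD : D = ∫ x in (0 : ℝ)..2 * π, f' x ^ 2)
    (h0 : fc (fun x => (f x : ℂ)) 0 = 0)
    (h1 : ∀ k : ℤ, |k| = 1 → ‖fc (fun x => (f x : ℂ)) k‖ ^ 2 ≤ B1)
    (h2 : ∀ k : ℤ, |k| = 2 → ‖fc (fun x => (f' x : ℂ)) k‖ ^ 2 ≤ B2) :
    9 * F - D ≤ 2 * π * (16 * B1 + 5 / 2 * B2) := by
  have hp' : Per f' := hp.deriv hd
  have s1 := hasSum_parseval (contDiff_ofReal hf) (fun x => by simp only [hp x])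
  have s2 := hasSum_parseval (contDiff_ofReal hf') (fun x => by simp only [hp' x])
  have hder : ∀ k : ℤ, ‖fc (fun x => (f' x : ℂ)) k‖ ^ 2
      = (k : ℝ) ^ 2 * ‖fc (fun x => (f x : ℂ)) k‖ ^ 2 := fun k => by
    rw [fc_deriv (f := fun x => (f x : ℂ)) (fun x => by simp only [hp x])
      (fun x => (hd x).ofReal_comp) (Complex.continuous_ofReal.comp hf'.continuous), norm_mul,
      norm_mul, Complex.norm_I, one_mul, mul_pow]
    congr 1
    rw [← Complex.ofReal_intCast, Complex.norm_real, Real.norm_eq_abs, sq_abs]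
  have s3 := (s1.mul_left 9).sub s2
  set g : ℤ → ℝ := fun k => 9 * ‖fc (fun x => (f x : ℂ)) k‖ ^ 2 - ‖fc (fun x => (f' x : ℂ)) k‖ ^ 2
    with hg
  have s4 : HasSum (fun k => if k ∈ Finset.Icc (-2 : ℤ) 2 then g k else 0)
      (∑ k ∈ Finset.Icc (-2 : ℤ) 2, g k) := by
    have := hasSum_sum_of_ne_finset_zero (L := .unconditional ℤ)
      (f := fun k => if k ∈ Finset.Icc (-2 : ℤ) 2 then g k else 0)
      (s := Finset.Icc (-2 : ℤ) 2) fun b hb => if_neg hb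
    rwa [Finset.sum_congr rfl fun k hk => if_pos hk] at this
  suffices hle : ∀ k : ℤ, g k ≤ if k ∈ Finset.Icc (-2 : ℤ) 2 then g k else 0 by
    have h3 := hasSum_le hle s3 s4
    have e : ∑ k ∈ Finset.Icc (-2 : ℤ) 2, g k = g (-2) + g (-1) + g 0 + g 1 + g 2 := by
      rw [show Finset.Icc (-2 : ℤ) 2 = {-2, -1, 0, 1, 2} by decide]
      simp [Finset.sum_insert]
      ring
    have g2 : ∀ k : ℤ, |k| = 2 → g k ≤ 5 / 4 * B2 := fun k hk => by
      have h4 := h2 k hk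
      have h5 := hder k
      have h6 : (k : ℝ) ^ 2 = 4 := by
        have : |(k : ℝ)| = 2 := by exact_mod_cast hk
        rw [← sq_abs, this]; norm_num
      rw [h6] at h5
      simp only [hg]
      linarith
    have g1 : ∀ k : ℤ, |k| = 1 → g k ≤ 8 * B1 := fun k hk => by
      have h4 := h1 k hk
      have h5 := hder k
      have h6 : (k : ℝ) ^ 2 = 1 := by
        have : |(k : ℝ)| = 1 := by exact_mod_cast hk
        rw [← sq_abs, this]; norm_num
      rw [h6] at h5
      simp only [hg]
      linarith
    have g0 : g 0 ≤ 0 := by simp [hg, h0]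
    rw [e] at h3
    have h7 := g2 (-2) (by decide)
    have h8 := g2 2 (by decide)
    have h9 := g1 (-1) (by decide)
    have h10 := g1 1 (by decide)
    simp only [Complex.norm_real, Real.norm_eq_abs, sq_abs, ← hF, ← hD] at h3
    have h11 : (2 * π)⁻¹ * (9 * F - D) ≤ 16 * B1 + 5 / 2 * B2 := by linarith
    rwa [inv_mul_le_iff₀ two_pi_pos] at h11
  · intro k
    split_ifs with hk
    · exact le_rfl
    · have hk2 : (3 : ℤ) ≤ |k| := by
        rw [Finset.mem_Icc, ← abs_le] at hk
        exact not_le.1 hk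
      have hk3 : (9 : ℝ) ≤ (k : ℝ) ^ 2 := by
        have : (3 : ℝ) ≤ |(k : ℝ)| := by exact_mod_cast hk2
        rw [← sq_abs]
        nlinarith
      change 9 * ‖fc (fun x => (f x : ℂ)) k‖ ^ 2 - ‖fc (fun x => (f' x : ℂ)) k‖ ^ 2 ≤ 0
      rw [hder k]
      nlinarith [sq_nonneg ‖fc (fun x => (f x : ℂ)) k‖]

section
lemma norm_fc_neg {f : ℝ → ℝ} (k : ℤ) :
    ‖fc (fun x => (f x : ℂ)) (-k)‖ = ‖fc (fun x => (f x : ℂ)) k‖ := by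
  have e : fc (fun x => (f x : ℂ)) (-k) = (starRingEnd ℂ) (fc (fun x => (f x : ℂ)) k) := by
    rw [fc, fc, map_mul, intervalIntegral.integral_of_le two_pi_pos.le,
      intervalIntegral.integral_of_le two_pi_pos.le, ← integral_conj]
    congr 1
    · rw [map_inv₀, map_mul, Complex.conj_ofReal, map_ofNat]
    · refine integral_congr_ae (Filter.Eventually.of_forall fun x => ?_)
      simp only [map_mul, Complex.conj_ofReal, ek_neg, Complex.conj_conj]
  rw [e, RCLike.norm_conj]

lemma fc_linear {f g : ℝ → ℂ} (hf : Continuous f) (hg : Continuous g) (α β : ℂ) (k : ℤ) :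
    fc (fun x => α * f x + β * g x) k = α * fc f k + β * fc g k := by
  have c1 : Continuous fun x => α * (f x * ek (-k) x) :=
    continuous_const.mul (hf.mul (continuous_ek _))
  have c2 : Continuous fun x => β * (g x * ek (-k) x) :=
    continuous_const.mul (hg.mul (continuous_ek _))
  have e : ∫ x in (0 : ℝ)..2 * π, (α * f x + β * g x) * ek (-k) x
      = ∫ x in (0 : ℝ)..2 * π, (α * (f x * ek (-k) x) + β * (g x * ek (-k) x)) :=
    intervalIntegral.integral_congr fun x _ => by ring
  rw [fc, fc, fc, e, intervalIntegral.integral_add (c1.intervalIntegrable _ _)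
    (c2.intervalIntegrable _ _), intervalIntegral.integral_const_mul,
    intervalIntegral.integral_const_mul]
  ring

lemma fc_zero_ofReal (f : ℝ → ℝ) :
    fc (fun x => (f x : ℂ)) 0 = (((2 * π)⁻¹ * ∫ x in (0 : ℝ)..2 * π, f x : ℝ) : ℂ) := by
  rw [fc, Complex.ofReal_mul, ← intervalIntegral.integral_ofReal]
  simp [ek_zero]

/-- Spectral gap for the potential of a Hill equation with a suitable periodic solution. -/
lemma gap_of_hill {κ κ' : ℝ → ℝ} {S S' : ℝ → ℂ} {a : ℝ} (hκ : ContDiff ℝ (⊤ : ℕ∞) κ)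
    (hκ' : ContDiff ℝ (⊤ : ℕ∞) κ') (hκp : Per κ) (hκd : ∀ x, HasDerivAt κ (κ' x) x)
    (hS : ContDiff ℝ (⊤ : ℕ∞) S) (hSp : Per S)
    (hd : ∀ x, HasDerivAt S (S' x) x) (hd' : ∀ x, HasDerivAt S' (-(κ x * S x)) x)
    (ha : a ≤ 2) (haη : ∫ x in (0 : ℝ)..2 * π, (κ x - a) = 0)
    (h0 : fc S 0 = 0) (h1 : fc S (-1) = 0) (hne : ∃ x, S x ≠ 0) {F D : ℝ}
    (hF : F = ∫ x in (0 : ℝ)..2 * π, (κ x - a) ^ 2) (hD : D = ∫ x in (0 : ℝ)..2 * π, κ' x ^ 2)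
    (hF1 : F ≤ 1 / 2000) :
    8 * F ≤ D ∧ |a - 1| ≤ 2 * √((2 * π)⁻¹ * F) := by
  have hp := two_pi_pos
  have cS := hS.continuous
  have cS' : Continuous S' := continuous_iff_continuousAt.2 fun x => (hd' x).continuousAt
  have cκ := hκ.continuous
  have cκ' := hκ'.continuous
  have cη : Continuous fun x => κ x - a := by fun_prop
  have sη : ContDiff ℝ (⊤ : ℕ∞) fun x => κ x - a := hκ.sub contDiff_const
  have hF0 : 0 ≤ F := hF ▸ intervalIntegral.integral_nonneg hp.le fun _ _ => sq_nonneg _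
  have hD0 : 0 ≤ D := hD ▸ intervalIntegral.integral_nonneg hp.le fun _ _ => sq_nonneg _
  set ε := √((2 * π)⁻¹ * F) with hε
  have hε0 : 0 ≤ ε := sqrt_nonneg _
  have hε2 : 2 * π * ε ^ 2 = F := by
    rw [hε, sq_sqrt (by positivity), mul_inv_cancel_left₀ hp.ne']
  have hεsq : ε ^ 2 ≤ 1 / 12560 := by nlinarith [pi_gt_d2, sq_nonneg ε]
  have hε84 : ε ≤ 1 / 84 := by nlinarith
  have hmean : (2 * π)⁻¹ * ∫ x in (0 : ℝ)..2 * π, |κ x - a| ≤ ε := by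
    rw [hε, hF]
    exact mean_abs_le cη
  have hmean' : (2 * π)⁻¹ * ∫ x in (0 : ℝ)..2 * π, |κ' x| ≤ √((2 * π)⁻¹ * D) := by
    rw [hD]
    exact mean_abs_le cκ'
  obtain ⟨hS1, ha1, hr⟩ := hill_close cκ hS hSp hd hd' ha hmean hε84 h0 h1 hne
  refine ⟨?_, ha1⟩
  have hm0 := hill_modes cκ hS hSp hd hd' 0 a
  rw [h0, mul_zero] at hm0
  have c1 : Continuous fun x => ((κ x - a : ℝ) : ℂ) := Complex.continuous_ofReal.comp cη
  have c2 : Continuous fun x => ((κ' x : ℝ) : ℂ) := Complex.continuous_ofReal.comp cκ'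
  have b1 : ‖fc (fun x => ((κ x - a : ℝ) : ℂ)) (-1)‖ ≤ 8 * ε ^ 2 := by
    have e : fc (fun x => ((κ x - a : ℝ) : ℂ)) (-1)
        = fc (fun x => ((κ x - a : ℝ) : ℂ) * (ek 1 x - S x / fc S 1)) 0 := by
      have h2 := fc_linear (f := fun x => ((κ x - a : ℝ) : ℂ) * ek 1 x)
        (g := fun x => ((κ x - a : ℝ) : ℂ) * S x) (c1.mul (continuous_ek 1)) (c1.mul cS) 1
        (-(fc S 1)⁻¹) 0
      rw [← hm0, mul_zero, add_zero, one_mul] at h2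
      have h3 : fc (fun x => ((κ x - a : ℝ) : ℂ) * ek 1 x) 0
          = fc (fun x => ((κ x - a : ℝ) : ℂ)) (-1) := by
        simp [fc, ek_zero]
      rw [← h3, ← h2]
      congr 1
      ext x
      ring
    rw [e]
    have c3 : Continuous fun x => ((κ x - a : ℝ) : ℂ) * (ek 1 x - S x / fc S 1) :=
      c1.mul ((continuous_ek 1).sub (cS.div_const _))
    refine (norm_fc_le_of_le (g := fun x => |κ x - a| * (8 * ε)) c3 (by fun_prop)
      (fun x => ?_) 0).trans ?_
    · rw [norm_mul, Complex.norm_real, Real.norm_eq_abs, norm_sub_rev]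
      exact mul_le_mul_of_nonneg_left (hr x) (abs_nonneg _)
    · rw [intervalIntegral.integral_mul_const, ← mul_assoc]
      nlinarith
  have hm2 : fc (fun x => ((κ' x : ℝ) : ℂ) * S x ^ 2) 0 = 0 := by
    have h2 : ∀ x, HasDerivAt (fun x => S' x ^ 2 + (κ x : ℂ) * S x ^ 2)
        (((κ' x : ℝ) : ℂ) * S x ^ 2) x := fun x => by
      have h3 := ((hd' x).pow 2).add ((hκd x).ofReal_comp.mul ((hd x).pow 2))
      refine h3.congr_deriv ?_
      simp only [Pi.pow_apply]
      push_cast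
      ring
    have h3 : Per fun x => S' x ^ 2 + (κ x : ℂ) * S x ^ 2 := fun x => by
      have h4 : Per S' := hSp.deriv hd
      simp only [h4 x, hκp x, hSp x]
    have h4 := integral_deriv_per h3 h2 (c2.mul (cS.pow 2))
    simp only [fc, neg_zero, ek_zero, mul_one]
    rw [h4, mul_zero]
  have b2 : ‖fc (fun x => ((κ' x : ℝ) : ℂ)) (-2)‖ ≤ 17 * ε * √((2 * π)⁻¹ * D) := by
    have e : fc (fun x => ((κ' x : ℝ) : ℂ)) (-2)
        = fc (fun x => ((κ' x : ℝ) : ℂ) * (ek 2 x - (S x / fc S 1) ^ 2)) 0 := by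
      have h2 := fc_linear (f := fun x => ((κ' x : ℝ) : ℂ) * ek 2 x)
        (g := fun x => ((κ' x : ℝ) : ℂ) * S x ^ 2) (c2.mul (continuous_ek 2)) (c2.mul (cS.pow 2)) 1
        (-((fc S 1) ^ 2)⁻¹) 0
      rw [hm2, mul_zero, add_zero, one_mul] at h2
      have h3 : fc (fun x => ((κ' x : ℝ) : ℂ) * ek 2 x) 0
          = fc (fun x => ((κ' x : ℝ) : ℂ)) (-2) := by
        simp [fc, ek_zero]
      rw [← h3, ← h2]
      congr 1
      ext x
      rw [div_pow]
      ring
    rw [e]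
    have c3 : Continuous fun x => ((κ' x : ℝ) : ℂ) * (ek 2 x - (S x / fc S 1) ^ 2) :=
      c2.mul ((continuous_ek 2).sub ((cS.div_const _).pow 2))
    refine (norm_fc_le_of_le (g := fun x => |κ' x| * (17 * ε)) c3 (by fun_prop)
      (fun x => ?_) 0).trans ?_
    · rw [norm_mul, Complex.norm_real, Real.norm_eq_abs, norm_sub_rev]
      refine mul_le_mul_of_nonneg_left ?_ (abs_nonneg _)
      have e2 : (S x / fc S 1) ^ 2 - ek 2 x
          = (S x / fc S 1 - ek 1 x) * ((S x / fc S 1 - ek 1 x) + 2 * ek 1 x) := by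
        rw [show (2 : ℤ) = 1 + 1 from rfl, ek_add]
        ring
      have h5 := hr x
      have h6 : ‖(S x / fc S 1 - ek 1 x) + 2 * ek 1 x‖ ≤ 8 * ε + 2 := by
        refine (norm_add_le _ _).trans (add_le_add h5 ?_)
        rw [norm_mul, norm_ek, mul_one]
        simp
      rw [e2, norm_mul]
      calc _ ≤ (8 * ε) * (8 * ε + 2) := mul_le_mul h5 h6 (norm_nonneg _) (by positivity)
        _ ≤ 17 * ε := by nlinarith
    · rw [intervalIntegral.integral_mul_const, ← mul_assoc]
      nlinarith
  have key := gap_of_modes (f := fun x => κ x - a) (f' := κ') (B1 := 64 * ε ^ 4)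
    (B2 := 289 * ε ^ 2 * ((2 * π)⁻¹ * D)) sη hκ' (fun x => by simp only [hκp x])
    (fun x => (hκd x).sub_const a) hF hD ?_ ?_ ?_
  · have e1 : 2 * π * (16 * (64 * ε ^ 4) + 5 / 2 * (289 * ε ^ 2 * ((2 * π)⁻¹ * D)))
        = 1024 * ε ^ 2 * (2 * π * ε ^ 2) + 5 / 2 * 289 * ε ^ 2 * D := by
      field_simp
      ring
    rw [e1, hε2] at key
    nlinarith [mul_le_mul_of_nonneg_right hεsq hF0, mul_le_mul_of_nonneg_right hεsq hD0]
  · rw [fc_zero_ofReal, haη]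
    simp
  · intro k hk
    have h2 : ‖fc (fun x => ((κ x - a : ℝ) : ℂ)) k‖ ≤ 8 * ε ^ 2 := by
      rcases (abs_eq (by norm_num)).1 hk with rfl | rfl
      · rw [← norm_fc_neg]
        exact b1
      · exact b1
    calc _ ≤ (8 * ε ^ 2) ^ 2 := pow_le_pow_left₀ (norm_nonneg _) h2 2
      _ = 64 * ε ^ 4 := by ring
  · intro k hk
    have h2 : ‖fc (fun x => ((κ' x : ℝ) : ℂ)) k‖ ≤ 17 * ε * √((2 * π)⁻¹ * D) := by
      rcases (abs_eq (by norm_num)).1 hk with rfl | rfl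
      · rw [← norm_fc_neg]
        exact b2
      · exact b2
    calc _ ≤ (17 * ε * √((2 * π)⁻¹ * D)) ^ 2 := pow_le_pow_left₀ (norm_nonneg _) h2 2
      _ = 289 * ε ^ 2 * ((2 * π)⁻¹ * D) := by
        rw [mul_pow, sq_sqrt (by positivity)]
        ring

variable {T : ℝ} {κ W u σ : ℝ → ℝ → ℝ}

lemma Sol.exists_inverse (S : Sol T κ W u σ) (t : ℝ) : ∃ ϑ : ℝ → ℝ, ContDiff ℝ (⊤ : ℕ∞) ϑ ∧
    (∀ θ, ϑ (σ θ t) = θ) ∧ (∀ x, σ (ϑ x) t = x) ∧ (∀ x, ϑ (x + 2 * π) = ϑ x + 2 * π) ∧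
    ∀ x, HasDerivAt ϑ (u (ϑ x) t ^ 2) x := by
  have hd : ∀ x, HasDerivAt (fun θ => σ θ t) ((u x t ^ 2)⁻¹) x := fun x =>
    (S.smσ.hasDerivAt_x x t).congr_deriv (S.dxσ x t)
  obtain ⟨ϑ, h1, h2, h3, h4⟩ := exists_smooth_inverse (S.smσ.contDiff_left t) hd
    (fun x => inv_pos.2 (pow_pos (S.pos x t) 2)) (fun x => S.σper x t)
  refine ⟨ϑ, h1, h2, h3, h4, fun x => ?_⟩
  have h5 := hasDerivAt_of_smooth h1 x
  have h6 := (hd (ϑ x)).comp x h5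
  have h7 : HasDerivAt (fun x => x) (1 : ℝ) x := hasDerivAt_id x
  have h8 : (fun θ => σ θ t) ∘ ϑ = fun x => x := funext h3
  rw [h8] at h6
  have h9 := h6.unique h7
  have h10 : (0 : ℝ) < u (ϑ x) t ^ 2 := pow_pos (S.pos _ t) 2
  rw [inv_mul_eq_iff_eq_mul₀ h10.ne', mul_one] at h9
  rwa [h9] at h5

lemma Sol.hill_real (S : Sol T κ W u σ) {t : ℝ} (ht : t ∈ Set.Icc 0 T) {ϑ ρ ρ' : ℝ → ℝ}
    (hϑ : ContDiff ℝ (⊤ : ℕ∞) ϑ) (hϑσ : ∀ θ, ϑ (σ θ t) = θ) (hσϑ : ∀ x, σ (ϑ x) t = x)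
    (hϑp : ∀ x, ϑ (x + 2 * π) = ϑ x + 2 * π) (hϑd : ∀ x, HasDerivAt ϑ (u (ϑ x) t ^ 2) x)
    (hρ : ContDiff ℝ (⊤ : ℕ∞) ρ) (hρp : Per ρ) (hρd : ∀ x, HasDerivAt ρ (ρ' x) x)
    (hρd' : ∀ x, HasDerivAt ρ' (-ρ x) x)
    (ho : ∫ θ in (0 : ℝ)..2 * π, (u θ t ^ 3)⁻¹ * ρ θ = 0) :
    ∃ f f' : ℝ → ℝ, (∀ x, f x = ρ (ϑ x) * (u (ϑ x) t)⁻¹) ∧ ContDiff ℝ (⊤ : ℕ∞) f ∧ Per f ∧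
      (∀ x, HasDerivAt f (f' x) x) ∧ (∀ x, HasDerivAt f' (-(κ x t * f x)) x) ∧
      ∫ x in (0 : ℝ)..2 * π, f x = 0 := by
  have hu0 : ∀ θ, u θ t ≠ 0 := fun θ => (S.pos θ t).ne'
  have sf : ContDiff ℝ (⊤ : ℕ∞) fun x => ρ (ϑ x) * (u (ϑ x) t)⁻¹ :=
    (hρ.comp hϑ).mul (((S.smu.contDiff_left t).comp hϑ).inv fun x => hu0 _)
  have pf : Per fun x => ρ (ϑ x) * (u (ϑ x) t)⁻¹ := fun x => by
    have := S.peru t (ϑ x)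
    simp only [hϑp x, hρp (ϑ x), this]
  refine ⟨fun x => ρ (ϑ x) * (u (ϑ x) t)⁻¹,
    fun x => ρ' (ϑ x) * u (ϑ x) t - dx u (ϑ x) t * ρ (ϑ x), fun _ => rfl, sf, pf,
    fun x => ?_, fun x => ?_, ?_⟩
  · have h1 := (hρd (ϑ x)).comp x (hϑd x)
    have h2 := (S.smu.hasDerivAt_x (ϑ x) t).comp x (hϑd x)
    refine (h1.mul (h2.inv (hu0 _))).congr_deriv ?_
    simp only [Function.comp_apply, Pi.inv_apply]
    have := hu0 (ϑ x)
    field_simp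
    ring
  · have h1 := (hρd (ϑ x)).comp x (hϑd x)
    have h1' := (hρd' (ϑ x)).comp x (hϑd x)
    have h2 := (S.smu.hasDerivAt_x (ϑ x) t).comp x (hϑd x)
    have h3 := (S.smu.dx.hasDerivAt_x (ϑ x) t).comp x (hϑd x)
    refine ((h1'.mul h2).sub (h3.mul h1)).congr_deriv ?_
    simp only [Function.comp_apply]
    have h4 := S.curv t ht (ϑ x)
    rw [hσϑ] at h4
    rw [← h4]
    have := hu0 (ϑ x)
    field_simp
    ring
  · rw [← S.integral_comp sf.continuous pf t]
    refine Eq.trans ?_ ho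
    refine intervalIntegral.integral_congr fun θ _ => ?_
    simp only [hϑσ]
    have := hu0 θ
    field_simp

lemma Sol.gap (S : Sol T κ W u σ) {t : ℝ} (ht : t ∈ Set.Icc 0 T) (hF : vari κ t ≤ 1 / 2000) :
    8 * vari κ t ≤ diri κ t ∧ |avg κ t - 1| ≤ 2 * √((2 * π)⁻¹ * vari κ t) := by
  obtain ⟨ϑ, hϑ, hϑσ, hσϑ, hϑp, hϑd⟩ := S.exists_inverse t
  obtain ⟨f, f', hf, sf, pf, df, df', if0⟩ := S.hill_real ht hϑ hϑσ hσϑ hϑp hϑd contDiff_cos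
    (fun x => cos_add_two_pi x) (fun x => hasDerivAt_cos x)
    (fun x => (hasDerivAt_sin x).neg) (S.orth cos (Or.inl rfl) t ht)
  obtain ⟨g, g', hg, sg, pg, dg, dg', ig0⟩ := S.hill_real ht hϑ hϑσ hσϑ hϑp hϑd contDiff_sin
    (fun x => sin_add_two_pi x) (fun x => hasDerivAt_sin x)
    (fun x => hasDerivAt_cos x) (S.orth sin (Or.inr rfl) t ht)
  have cf : Continuous fun x => (f x : ℂ) := Complex.continuous_ofReal.comp sf.continuous
  have cg : Continuous fun x => (g x : ℂ) := Complex.continuous_ofReal.comp sg.continuous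
  have hind : ∀ α β : ℂ, (∀ x, α * (f x : ℂ) + β * (g x : ℂ) = 0) → α = 0 ∧ β = 0 := by
    intro α β h
    have h2 : ∀ θ, α * (cos θ : ℂ) + β * (sin θ : ℂ) = 0 := fun θ => by
      have h3 := h (σ θ t)
      rw [hf, hg, hϑσ, Complex.ofReal_mul, Complex.ofReal_mul, ← mul_assoc, ← mul_assoc,
        ← add_mul] at h3
      exact (mul_eq_zero.1 h3).resolve_right
        (Complex.ofReal_ne_zero.2 (inv_ne_zero (S.pos θ t).ne'))
    constructor
    · simpa using h2 0
    · have := h2 (π / 2)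
      rw [Real.cos_pi_div_two, Real.sin_pi_div_two] at this
      simpa using this
  obtain ⟨α, β, hαβ, hne⟩ : ∃ α β : ℂ, α * fc (fun x => (f x : ℂ)) (-1)
      + β * fc (fun x => (g x : ℂ)) (-1) = 0 ∧ ¬ (α = 0 ∧ β = 0) := by
    by_cases h : fc (fun x => (f x : ℂ)) (-1) = 0
    · exact ⟨1, 0, by rw [h]; ring, by simp⟩
    · exact ⟨fc (fun x => (g x : ℂ)) (-1), -fc (fun x => (f x : ℂ)) (-1), by ring, by simp [h]⟩
  refine gap_of_hill (κ := fun x => κ x t) (κ' := fun x => dx κ x t)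
    (S := fun x => α * (f x : ℂ) + β * (g x : ℂ)) (S' := fun x => α * (f' x : ℂ) + β * (g' x : ℂ))
    (S.smκ.contDiff_left t) (S.smκ.dx.contDiff_left t) (S.perκ t)
    (fun x => S.smκ.hasDerivAt_x x t)
    ((contDiff_const.mul (contDiff_ofReal sf)).add (contDiff_const.mul (contDiff_ofReal sg)))
    (fun x => by simp only [pf x, pg x])
    (fun x => ((df x).ofReal_comp.const_mul α).add ((dg x).ofReal_comp.const_mul β))
    (fun x => ?_) (S.avg_le_two ht) (S.integral_η t) ?_ ?_ ?_ rfl rfl hF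
  · refine (((df' x).ofReal_comp.const_mul α).add ((dg' x).ofReal_comp.const_mul β)).congr_deriv ?_
    push_cast
    ring
  · rw [fc_linear cf cg, fc_zero_ofReal, fc_zero_ofReal, if0, ig0]
    simp
  · rw [fc_linear cf cg, hαβ]
  · by_contra! h
    exact hne (hind α β h)

/-- Near a stationary curve the variance of the curvature decays exponentially. -/
lemma Sol.stable (S : Sol T κ W u σ) {t : ℝ} (ht : t ∈ Set.Icc 0 T) (hF : vari κ t ≤ 1 / 2000) :
    -(1 / 2) * diri κ t + 2 * avg κ t * vari κ t
      + 3 / 2 * ∫ x in (0 : ℝ)..2 * π, (κ x t - avg κ t) ^ 3 ≤ -vari κ t - diri κ t / 32 := by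
  obtain ⟨h1, h2⟩ := S.gap ht hF
  have hF0 := vari_nonneg κ t
  have hD0 := diri_nonneg κ t
  set F := vari κ t
  set D := diri κ t
  have h3 := S.cubic_le (S.abs_η_le · t)
  have hp := two_pi_pos
  set ε := √((2 * π)⁻¹ * F) with hε
  have hε0 : 0 ≤ ε := sqrt_nonneg _
  have hε2 : 2 * π * ε ^ 2 = F := by
    rw [hε, sq_sqrt (by positivity), mul_inv_cancel_left₀ hp.ne']
  have hεsq : ε ^ 2 ≤ 1 / 12560 := by nlinarith [pi_gt_d2, sq_nonneg ε]
  have hε84 : ε ≤ 1 / 84 := by nlinarith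
  set s := √(2 * π * D) with hs
  have hs0 : 0 ≤ s := sqrt_nonneg _
  have hs2 : s ^ 2 = 2 * π * D := sq_sqrt (by positivity)
  have h4 := le_abs_self (avg κ t - 1)
  have h5 : 2 * avg κ t * F ≤ (2 + 4 / 84 * 1) * F := by nlinarith
  have h6 : s * F ≤ s ^ 2 / 400 + 100 * F ^ 2 := by nlinarith [sq_nonneg (s / 20 - 10 * F)]
  have h7 : s ^ 2 ≤ 6.3 * D := by nlinarith [pi_lt_d2]
  nlinarith

end

section
lemma antitone_of_hasDerivAt_Ici {f f' : ℝ → ℝ} {a : ℝ} (hd : ∀ t, a ≤ t → HasDerivAt f (f' t) t)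
    (h : ∀ t, a ≤ t → f' t ≤ 0) {s t : ℝ} (hs : a ≤ s) (hst : s ≤ t) : f t ≤ f s :=
  antitoneOn_of_deriv_nonpos (convex_Ici a) (fun x hx => (hd x hx).continuousAt.continuousWithinAt)
    (fun x hx => (hd x (interior_subset hx)).differentiableAt.differentiableWithinAt) (fun x hx => by
      rw [(hd x (interior_subset hx)).deriv]
      exact h x (interior_subset hx)) (Set.mem_Ici.2 hs) (Set.mem_Ici.2 (hs.trans hst)) hst

lemma Per.deriv_le {f f' f'' : ℝ → ℝ} (hp : Per f) (hd : ∀ x, HasDerivAt f (f' x) x)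
    (hd' : ∀ x, HasDerivAt f' (f'' x) x) {ε : ℝ} (h : ∀ x, |f'' x| ≤ ε) (x : ℝ) :
    |f' x| ≤ 2 * π * ε := by
  obtain ⟨c, hc, hc0⟩ := exists_hasDerivAt_eq_zero (f := f) (f' := f')
    (show x < x + 2 * π by linarith [two_pi_pos])
    (fun y _ => (hd y).continuousAt.continuousWithinAt) (hp x).symm fun y _ => hd y
  have h1 := convex_univ.norm_image_sub_le_of_norm_hasDerivWithin_le (C := ε) (f := f')
    (fun y _ => (hd' y).hasDerivWithinAt) (fun y _ => h y) (Set.mem_univ c) (Set.mem_univ x)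
  rw [hc0, sub_zero, Real.norm_eq_abs, Real.norm_eq_abs] at h1
  have hε : 0 ≤ ε := (abs_nonneg _).trans (h x)
  have h2 : |x - c| ≤ 2 * π := by
    rw [abs_le]
    constructor <;> linarith [hc.1, hc.2, two_pi_pos]
  rw [mul_comm (2 * π)]
  exact h1.trans (mul_le_mul_of_nonneg_left h2 hε)

lemma limit_second_deriv {w w' w'' : ℕ → ℝ → ℝ} {v G : ℝ → ℝ} (hw : ∀ n, Per (w n))
    (hd : ∀ n x, HasDerivAt (w n) (w' n x) x) (hd' : ∀ n x, HasDerivAt (w' n) (w'' n x) x)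
    (hlim : ∀ x, Filter.Tendsto (fun n => w n x) Filter.atTop (nhds (v x)))
    (hG : TendstoUniformly w'' G Filter.atTop) :
    ∃ P : ℝ → ℝ, (∀ x, HasDerivAt v (P x) x) ∧ ∀ x, HasDerivAt P (G x) x := by
  have hp := two_pi_pos
  have hc : UniformCauchySeqOn w' Filter.atTop Set.univ := by
    rw [Metric.uniformCauchySeqOn_iff]
    intro ε hε
    obtain ⟨N, hN⟩ := Filter.eventually_atTop.1
      (Metric.tendstoUniformly_iff.1 hG (ε / (6 * π)) (by positivity))
    refine ⟨N, fun m hm n hn x _ => ?_⟩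
    have h1 := Per.deriv_le (f := fun x => w m x - w n x) (f' := fun x => w' m x - w' n x)
      (f'' := fun x => w'' m x - w'' n x) (ε := 2 * (ε / (6 * π)))
      (fun x => by simp only [hw m x, hw n x]) (fun x => (hd m x).sub (hd n x))
      (fun x => (hd' m x).sub (hd' n x)) (fun x => by
        have h2 := hN m hm x
        have h3 := hN n hn x
        rw [Real.dist_eq] at h2 h3
        have h4 := abs_sub_le (w'' m x) (G x) (w'' n x)
        rw [abs_sub_comm (w'' m x) (G x)] at h4
        linarith) x
    rw [Real.dist_eq]
    refine h1.trans_lt ?_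
    have : 2 * π * (2 * (ε / (6 * π))) = 2 / 3 * ε := by
      field_simp
      norm_num
    linarith
  choose P hP using fun x => cauchySeq_tendsto_of_complete (hc.cauchySeq (Set.mem_univ x))
  have hu := hc.tendstoUniformlyOn_of_tendsto fun x _ => hP x
  rw [tendstoUniformlyOn_univ] at hu
  exact ⟨P, fun x => hasDerivAt_of_tendstoUniformly hu
    (Filter.Eventually.of_forall fun n => hd n) hlim x,
    fun x => hasDerivAt_of_tendstoUniformly hG (Filter.Eventually.of_forall fun n => hd' n) hP x⟩

lemma smooth_of_ode {v P : ℝ → ℝ} (hv : ∀ x, 0 < v x) (hd : ∀ x, HasDerivAt v (P x) x)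
    (hd' : ∀ x, HasDerivAt P (-v x + (v x ^ 3)⁻¹) x) : ContDiff ℝ (⊤ : ℕ∞) v := by
  have key : ∀ n : ℕ, ContDiff ℝ n v ∧ ContDiff ℝ n P := by
    intro n
    induction n with
    | zero =>
      simp only [Nat.cast_zero, contDiff_zero]
      exact ⟨continuous_iff_continuousAt.2 fun x => (hd x).continuousAt,
        continuous_iff_continuousAt.2 fun x => (hd' x).continuousAt⟩
    | succ n ih =>
      have e1 : deriv v = P := funext fun x => (hd x).deriv
      have e2 : deriv P = fun x => -v x + (v x ^ 3)⁻¹ := funext fun x => (hd' x).deriv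
      push_cast
      rw [contDiff_succ_iff_deriv, contDiff_succ_iff_deriv, e1, e2]
      exact ⟨⟨fun x => (hd x).differentiableAt, by simp, ih.2⟩,
        fun x => (hd' x).differentiableAt, by simp,
        ih.1.neg.add ((ih.1.pow 3).inv fun x => (pow_pos (hv x) 3).ne')⟩
  exact contDiff_infty.2 fun n => (key n).1

variable {κ W u σ : ℝ → ℝ → ℝ} (hS : ∀ T, Sol T κ W u σ)
include hS

lemma exists_small_vari : ∃ t, 0 ≤ t ∧ vari κ t ≤ 1 / 2000 := by
  have hmono : Monotone fun n : ℕ => avg κ n := fun m n hmn =>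
    (hS n).avg_mono (Nat.cast_nonneg m) (Nat.cast_le.2 hmn) le_rfl
  have hbdd : BddAbove (Set.range fun n : ℕ => avg κ n) := ⟨2, by
    rintro _ ⟨n, rfl⟩
    exact (hS n).avg_le_two ⟨Nat.cast_nonneg n, le_rfl⟩⟩
  have hlim := tendsto_atTop_ciSup hmono hbdd
  have hδ : Filter.Tendsto (fun n : ℕ => avg κ ((n + 1 : ℕ) : ℝ) - avg κ n) Filter.atTop (nhds 0) := by
    have := (hlim.comp (Filter.tendsto_add_atTop_nat 1)).sub hlim
    rwa [sub_self] at this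
  have hg : Continuous fun δ : ℝ => exp (4 + 32 * π * δ) * (4 * π * δ) := by fun_prop
  have h1 := (hg.tendsto 0).comp hδ
  simp only [mul_zero] at h1
  obtain ⟨n, hn⟩ := (h1.eventually (gt_mem_nhds (show (0 : ℝ) < 1 / 2000 by norm_num))).exists
  refine ⟨((n + 1 : ℕ) : ℝ), Nat.cast_nonneg _, ?_⟩
  have h2 := (hS ((n + 1 : ℕ) : ℝ)).vari_le_increment (t := ((n + 1 : ℕ) : ℝ)) (by simp) le_rfl
  rw [show (((n + 1 : ℕ) : ℝ) - 1) = n by push_cast; ring] at h2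
  exact h2.trans hn.le

lemma vari_small {a : ℝ} (ha : 0 ≤ a) (hF : vari κ a ≤ 1 / 2000) {t : ℝ} (ht : a ≤ t) :
    vari κ t ≤ 1 / 2000 := by
  have hd : ∀ x ∈ Set.Icc a t, HasDerivAt (vari κ) (-(1 / 2) * diri κ x + 2 * avg κ x * vari κ x
      + 3 / 2 * ∫ y in (0 : ℝ)..2 * π, (κ y x - avg κ x) ^ 3) x := fun x hx =>
    (hS t).hasDerivAt_vari ⟨ha.trans hx.1, hx.2⟩
  refine image_le_of_deriv_right_lt_deriv_boundary' (a := a) (b := t)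
    (fun x hx => (hd x hx).continuousAt.continuousWithinAt)
    (fun x hx => (hd x ⟨hx.1, hx.2.le⟩).hasDerivWithinAt) hF continuousOn_const
    (fun x _ => hasDerivWithinAt_const x _ _) (fun x hx he => ?_) ⟨ht, le_rfl⟩
  have h1 := (hS t).stable ⟨ha.trans hx.1, hx.2.le⟩ he.le
  have h2 := diri_nonneg κ x
  rw [he] at h1 ⊢
  linarith

lemma vari_decay {a : ℝ} (ha : 0 ≤ a) (hF : vari κ a ≤ 1 / 2000) {t : ℝ} (ht : a ≤ t) :
    vari κ t ≤ exp (-(t - a)) := by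
  have h := antitone_of_hasDerivAt_Ici (f := fun t => vari κ t * exp t) (a := a)
    (fun x hx => ((hS x).hasDerivAt_vari ⟨ha.trans hx, le_rfl⟩).mul (hasDerivAt_exp x))
    (fun x hx => by
      have h1 := (hS x).stable ⟨ha.trans hx, le_rfl⟩ (vari_small hS ha hF hx)
      have h2 := diri_nonneg κ x
      rw [← add_mul]
      exact mul_nonpos_of_nonpos_of_nonneg (by linarith) (exp_pos _).le) le_rfl ht
  rw [neg_sub, exp_sub, le_div_iff₀ (exp_pos t)]
  nlinarith [exp_pos a]

/-- Times at which the Dirichlet energy is small. -/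
lemma exists_diri_le {a : ℝ} (ha : 0 ≤ a) (hF : vari κ a ≤ 1 / 2000) {s q : ℝ} (hs : a ≤ s)
    (hq : 0 < q) (hsq : vari κ s ≤ q) : ∃ t ∈ Set.Icc s (s + 1), diri κ t ≤ 64 * q := by
  by_contra! h
  have hd : ∀ x ∈ Set.Icc s (s + 1), HasDerivAt (fun t => vari κ t + 2 * q * t)
      ((-(1 / 2) * diri κ x + 2 * avg κ x * vari κ x
      + 3 / 2 * ∫ y in (0 : ℝ)..2 * π, (κ y x - avg κ x) ^ 3) + 2 * q) x := fun x hx =>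
    (((hS x).hasDerivAt_vari ⟨ha.trans (hs.trans hx.1), le_rfl⟩).add
      ((hasDerivAt_id x).const_mul (2 * q))).congr_deriv (by ring)
  have h1 := antitoneOn_of_deriv_nonpos (convex_Icc s (s + 1))
    (fun x hx => (hd x hx).continuousAt.continuousWithinAt)
    (fun x hx => (hd x (interior_subset hx)).differentiableAt.differentiableWithinAt)
    (fun x hx => by
      have hx' := interior_subset hx
      rw [(hd x hx').deriv]
      have h1 := (hS x).stable ⟨ha.trans (hs.trans hx'.1), le_rfl⟩
        (vari_small hS ha hF (hs.trans hx'.1))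
      have h2 := h x hx'
      have h3 := vari_nonneg κ x
      linarith) (Set.left_mem_Icc.2 (by linarith)) (Set.right_mem_Icc.2 (by linarith))
    (by linarith : s ≤ s + 1)
  have h2 := vari_nonneg κ (s + 1)
  simp only at h1
  linarith

lemma hasDerivAt_log_u (θ t : ℝ) : HasDerivAt (fun t => log (u θ t))
    (1 / 4 * (κ (σ θ t) t - avg κ t)) t := by
  have S := hS 0
  have hu := (S.pos θ t).ne'
  refine ((S.smu.hasDerivAt_t θ t).log hu).congr_deriv ?_
  rw [S.dtu]
  field_simp

/-- Exponentially decaying modulus of continuity in time for `log u`. -/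
lemma log_u_cauchy {a : ℝ} (ha : 0 ≤ a) (hF : vari κ a ≤ 1 / 2000) (θ : ℝ) {s t : ℝ} (hs : a ≤ s)
    (hst : s ≤ t) : |log (u θ t) - log (u θ s)| ≤ (4 + 4 * exp a) * exp (-(s / 4)) := by
  set M : ℝ → ℝ := fun t => 4 * exp (-(t / 4)) + 4 * (exp (t / 4) * vari κ t) with hM
  set M' : ℝ → ℝ := fun x => -exp (-(x / 4)) + (exp (x / 4) * vari κ x + 4 * (exp (x / 4) *
    (-(1 / 2) * diri κ x + 2 * avg κ x * vari κ x
      + 3 / 2 * ∫ y in (0 : ℝ)..2 * π, (κ y x - avg κ x) ^ 3))) with hM'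
  have hd : ∀ x, a ≤ x → HasDerivAt M (M' x) x := fun x hx => by
    have h1 := (hasDerivAt_id x).div_const 4
    refine ((h1.neg.exp.const_mul 4).add ((h1.exp.mul
      ((hS x).hasDerivAt_vari ⟨ha.trans hx, le_rfl⟩)).const_mul 4)).congr_deriv ?_
    simp only [hM', id, Pi.neg_apply]
    ring
  have hb : ∀ x, a ≤ x → ∀ y, 1 / 4 * |κ y x - avg κ x| ≤ -M' x := fun x hx y => by
    have h1 := (hS x).stable ⟨ha.trans hx, le_rfl⟩ (vari_small hS ha hF hx)
    have h2 := (hS x).abs_η_le y x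
    have h3 := vari_nonneg κ x
    have h4 := diri_nonneg κ x
    set r := √(2 * π * diri κ x) with hr
    have hr0 : 0 ≤ r := sqrt_nonneg _
    have hr2 : r ^ 2 = 2 * π * diri κ x := sq_sqrt (by positivity)
    have hr3 : r ^ 2 ≤ 8 * diri κ x := by nlinarith [pi_lt_d2]
    have e1 : exp (x / 4) * exp (-(x / 4)) = 1 := by rw [← exp_add]; simp
    simp only [hM']
    set p := exp (x / 4)
    set q := exp (-(x / 4))
    have hp : 0 < p := exp_pos _
    have h5 : 0 ≤ p * (q - r / 8) ^ 2 := mul_nonneg hp.le (sq_nonneg _)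
    have h6 : p * (q - r / 8) ^ 2 = q - r / 4 + p * (r ^ 2 / 64) := by
      linear_combination (q - r / 4) * e1
    have h7 := mul_le_mul_of_nonneg_left h1 hp.le
    have h8 := mul_le_mul_of_nonneg_left hr3 hp.le
    have h9 := mul_nonneg hp.le h3
    nlinarith
  have h1 : log (u θ t) + M t ≤ log (u θ s) + M s :=
    antitone_of_hasDerivAt_Ici (f := fun t => log (u θ t) + M t) (a := a)
      (fun x hx => (hasDerivAt_log_u hS θ x).add (hd x hx)) (fun x hx => by
        have h2 := hb x hx (σ θ x)
        have h3 := le_abs_self (κ (σ θ x) x - avg κ x)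
        linarith) hs hst
  have h2 : -log (u θ t) + M t ≤ -log (u θ s) + M s :=
    antitone_of_hasDerivAt_Ici (f := fun t => -log (u θ t) + M t) (a := a)
      (fun x hx => (hasDerivAt_log_u hS θ x).neg.add (hd x hx)) (fun x hx => by
        have h2 := hb x hx (σ θ x)
        have h3 := neg_abs_le (κ (σ θ x) x - avg κ x)
        linarith) hs hst
  have h3 : 0 ≤ M t := by
    have := vari_nonneg κ t
    simp only [hM]
    positivity
  have h4 : M s ≤ (4 + 4 * exp a) * exp (-(s / 4)) := by
    have h5 := mul_le_mul_of_nonneg_left (vari_decay hS ha hF hs) (exp_pos (s / 4)).le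
    rw [← exp_add] at h5
    have h6 : exp (s / 4 + -(s - a)) ≤ exp a * exp (-(s / 4)) := by
      rw [← exp_add]
      exact exp_le_exp.2 (by linarith)
    simp only [hM]
    linarith
  rw [abs_le]
  constructor <;> linarith

/-- Pointwise exponential convergence of `log u`. -/
lemma exists_log_limit {a : ℝ} (ha : 0 ≤ a) (hF : vari κ a ≤ 1 / 2000) (θ : ℝ) : ∃ l : ℝ,
    ∀ t, a ≤ t → |log (u θ t) - l| ≤ (4 + 4 * exp a) * exp (-(t / 4)) := by
  have hlin : Filter.Tendsto (fun n : ℕ => a + (n : ℝ)) Filter.atTop Filter.atTop :=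
    Filter.tendsto_atTop_add_const_left _ _ tendsto_natCast_atTop_atTop
  have hexp : Filter.Tendsto (fun n : ℕ => (4 + 4 * exp a) * exp (-((a + (n : ℝ)) / 4)))
      Filter.atTop (nhds 0) := by
    rw [← mul_zero (4 + 4 * exp a)]
    exact (tendsto_exp_neg_atTop_nhds_zero.comp
      (hlin.atTop_div_const (by norm_num : (0 : ℝ) < 4))).const_mul _
  have hN : ∀ N n : ℕ, N ≤ n → |log (u θ (a + n)) - log (u θ (a + N))|
      ≤ (4 + 4 * exp a) * exp (-((a + (N : ℝ)) / 4)) := fun N n h =>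
    log_u_cauchy hS ha hF θ (by simp) (by simpa using h)
  have hc : CauchySeq fun n : ℕ => log (u θ (a + n)) := by
    refine cauchySeq_of_le_tendsto_0' (fun n => (4 + 4 * exp a) * exp (-((a + (n : ℝ)) / 4)))
      (fun n m h => ?_) hexp
    rw [dist_comm, Real.dist_eq]
    exact hN n m h
  obtain ⟨l, hl⟩ := cauchySeq_tendsto_of_complete hc
  refine ⟨l, fun t ht => ?_⟩
  rw [abs_sub_comm]
  refine le_of_tendsto ((hl.sub_const (log (u θ t))).abs) ?_
  filter_upwards [hlin.eventually_ge_atTop t] with n hn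
  exact log_u_cauchy hS ha hF θ ht hn

end

section
lemma abs_exp_sub_exp_le {x y K : ℝ} (hx : x ≤ K) (hy : y ≤ K) :
    |exp x - exp y| ≤ exp K * |x - y| := by
  wlog h : y ≤ x generalizing x y
  · rw [abs_sub_comm, abs_sub_comm x]
    exact this hy hx (le_of_not_ge h)
  rw [abs_of_nonneg (sub_nonneg.2 (exp_le_exp.2 h)), abs_of_nonneg (sub_nonneg.2 h)]
  have h1 := add_one_le_exp (y - x)
  have h2 : exp y = exp x * exp (y - x) := by rw [← exp_add]; ring_nf
  have h3 : exp x - exp y ≤ exp x * (x - y) := by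
    rw [h2]
    nlinarith [exp_pos x]
  exact h3.trans (mul_le_mul_of_nonneg_right (exp_le_exp.2 hx) (sub_nonneg.2 h))

lemma inv_cube_eq_exp {x : ℝ} (hx : 0 < x) : (x ^ 3)⁻¹ = exp (-3 * log x) := by
  rw [neg_mul, exp_neg, mul_comm, exp_mul, exp_log hx]
  norm_cast

variable {κ W u σ : ℝ → ℝ → ℝ} (hS : ∀ T, Sol T κ W u σ)
include hS

theorem exists_limit : ∃ v : ℝ → ℝ, ContDiff ℝ (⊤ : ℕ∞) v ∧ Per v ∧ (∀ θ, 0 < v θ) ∧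
    (∃ C, 0 < C ∧ ∀ t, 0 ≤ t → ∀ θ, |u θ t - v θ| ≤ C * exp (-(t / 4))) ∧
    ∀ θ, v θ ^ 3 * (deriv (deriv v) θ + v θ) = 1 := by
  obtain ⟨a, ha, hF⟩ := exists_small_vari hS
  have S := hS 0
  choose l hl using exists_log_limit hS ha hF
  set B := 4 + 4 * exp a with hB
  have hBpos : 0 < B := by positivity
  have hexp1 : ∀ t, a ≤ t → exp (-(t / 4)) ≤ 1 := fun t ht => exp_le_one_iff.2 (by linarith)
  obtain ⟨K, hK0, hK⟩ := exists_bound_strip (g := fun θ t => log (u θ t))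
    (S.smu.continuous.log fun p => (S.pos _ _).ne') (fun t θ => by
      have := S.peru t θ
      simp only [this]) a
  set L := K + B with hL
  have hLpos : 0 ≤ L := by positivity
  have hul : ∀ θ t, a ≤ t → |log (u θ t)| ≤ L := fun θ t ht => by
    have h1 := log_u_cauchy hS ha hF θ le_rfl ht
    have h2 := hK θ a ⟨by linarith, le_rfl⟩
    have h3 := mul_le_mul_of_nonneg_left (hexp1 a le_rfl) hBpos.le
    have h4 := abs_sub_abs_le_abs_sub (log (u θ t)) (log (u θ a))
    linarith
  have hll : ∀ θ, |l θ| ≤ L := fun θ => by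
    have h1 := hl θ a le_rfl
    have h2 := hK θ a ⟨by linarith, le_rfl⟩
    have h3 := mul_le_mul_of_nonneg_left (hexp1 a le_rfl) hBpos.le
    have h4 := abs_sub_abs_le_abs_sub (l θ) (log (u θ a))
    rw [abs_sub_comm (l θ)] at h4
    linarith
  have hdecay : Filter.Tendsto (fun t : ℝ => B * exp (-(t / 4))) Filter.atTop (nhds 0) := by
    rw [← mul_zero B]
    exact (tendsto_exp_neg_atTop_nhds_zero.comp
      (Filter.tendsto_id.atTop_div_const (by norm_num : (0 : ℝ) < 4))).const_mul _
  have hlt : ∀ θ, Filter.Tendsto (fun t => log (u θ t)) Filter.atTop (nhds (l θ)) := fun θ => by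
    rw [tendsto_iff_dist_tendsto_zero]
    refine squeeze_zero' (Filter.Eventually.of_forall fun _ => dist_nonneg) ?_ hdecay
    filter_upwards [Filter.eventually_ge_atTop a] with t ht
    exact hl θ t ht
  have hlp : Per l := fun θ => by
    have h1 := hlt (θ + 2 * π)
    have h2 : ∀ t, u (θ + 2 * π) t = u θ t := fun t => S.peru t θ
    simp only [h2] at h1
    exact tendsto_nhds_unique h1 (hlt θ)
  have hclose : ∀ θ t, a ≤ t → |u θ t - exp (l θ)| ≤ exp L * (B * exp (-(t / 4))) :=
    fun θ t ht => by
    have h1 := abs_exp_sub_exp_le ((le_abs_self _).trans (hul θ t ht))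
      ((le_abs_self _).trans (hll θ))
    rw [exp_log (S.pos θ t)] at h1
    exact h1.trans (mul_le_mul_of_nonneg_left (hl θ t ht) (exp_pos L).le)
  have hvn : ∀ n : ℕ, vari κ (a + n) ≤ exp (-(n : ℝ)) := fun n => by
    have := vari_decay hS ha hF (t := a + n) (by simp)
    simpa using this
  choose τ hτ hτD using fun n : ℕ => exists_diri_le hS ha hF (s := a + n) (by simp)
    (exp_pos (-(n : ℝ))) (hvn n)
  have hτa : ∀ n, a ≤ τ n := fun n => le_trans (by simp) (hτ n).1
  have hτn : ∀ n : ℕ, (n : ℝ) ≤ τ n := fun n => le_trans (by simpa using ha) (hτ n).1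
  set z : ℕ → ℝ := fun n => exp (-((n : ℝ) / 4)) with hz
  have hz4 : ∀ n : ℕ, exp (-(n : ℝ)) = z n ^ 4 := fun n => by
    simp only [hz]
    rw [← exp_nat_mul]
    congr 1
    push_cast
    ring
  have hz0 : Filter.Tendsto z Filter.atTop (nhds 0) :=
    tendsto_exp_neg_atTop_nhds_zero.comp
      (tendsto_natCast_atTop_atTop.atTop_div_const (by norm_num : (0 : ℝ) < 4))
  have hκ1 : ∀ n y, |κ y (τ n) - 1|
      ≤ √(2 * π * (64 * z n ^ 4)) + 2 * √((2 * π)⁻¹ * z n ^ 4) := fun n y => by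
    have ht : τ n ∈ Set.Icc 0 (τ n) := ⟨ha.trans (hτa n), le_rfl⟩
    have hv : vari κ (τ n) ≤ z n ^ 4 := by
      rw [← hz4]
      exact (vari_decay hS ha hF (hτa n)).trans (exp_le_exp.2 (by linarith [(hτ n).1]))
    have hD := hτD n
    rw [hz4] at hD
    have h1 := (hS (τ n)).abs_η_le y (τ n)
    have h2 := ((hS (τ n)).gap ht (vari_small hS ha hF (hτa n))).2
    have h3 : √(2 * π * diri κ (τ n)) ≤ √(2 * π * (64 * z n ^ 4)) :=
      sqrt_le_sqrt (mul_le_mul_of_nonneg_left hD two_pi_pos.le)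
    have h4 : √((2 * π)⁻¹ * vari κ (τ n)) ≤ √((2 * π)⁻¹ * z n ^ 4) :=
      sqrt_le_sqrt (mul_le_mul_of_nonneg_left hv (inv_nonneg.2 two_pi_pos.le))
    have h5 := abs_sub_le (κ y (τ n)) (avg κ (τ n)) 1
    linarith
  set Φ : ℝ → ℝ := fun z => exp L * (B * z)
    + (√(2 * π * (64 * z ^ 4)) + 2 * √((2 * π)⁻¹ * z ^ 4)) * exp (3 * L)
    + exp (3 * L) * (3 * (B * z)) with hΦ
  have hΦ0 : Filter.Tendsto (fun n => Φ (z n)) Filter.atTop (nhds 0) := by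
    have hc : Continuous Φ := by
      simp only [hΦ]
      fun_prop
    have h1 := (hc.tendsto 0).comp hz0
    have h2 : Φ 0 = 0 := by simp [hΦ]
    rwa [h2] at h1
  have hunif : TendstoUniformly (fun n θ => dx (dx u) θ (τ n))
      (fun θ => -exp (l θ) + (exp (l θ) ^ 3)⁻¹) Filter.atTop := by
    rw [Metric.tendstoUniformly_iff]
    intro ε hε
    filter_upwards [hΦ0.eventually (gt_mem_nhds hε)] with n hn θ
    refine lt_of_le_of_lt ?_ hn
    rw [dist_comm, Real.dist_eq]
    have hup := S.pos θ (τ n)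
    have hc := (hS (τ n)).curv (τ n) ⟨ha.trans (hτa n), le_rfl⟩ θ
    have e1 : dx (dx u) θ (τ n) = -u θ (τ n) + κ (σ θ (τ n)) (τ n) * (u θ (τ n) ^ 3)⁻¹ := by
      rw [← hc]
      field_simp
      ring
    have hm : B * exp (-(τ n / 4)) ≤ B * z n :=
      mul_le_mul_of_nonneg_left (exp_le_exp.2 (by linarith [hτn n])) hBpos.le
    have b1 := (hclose θ (τ n) (hτa n)).trans (mul_le_mul_of_nonneg_left hm (exp_pos L).le)
    have b2 : |(u θ (τ n) ^ 3)⁻¹ - (exp (l θ) ^ 3)⁻¹| ≤ exp (3 * L) * (3 * (B * z n)) := by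
      rw [inv_cube_eq_exp hup, inv_cube_eq_exp (exp_pos _), log_exp]
      have h2 := neg_abs_le (log (u θ (τ n)))
      have h3 := neg_abs_le (l θ)
      refine (abs_exp_sub_exp_le (K := 3 * L) (by linarith [hul θ (τ n) (hτa n)])
        (by linarith [hll θ])).trans (mul_le_mul_of_nonneg_left ?_ (exp_pos _).le)
      rw [← mul_sub, abs_mul]
      have h4 := (hl θ (τ n) (hτa n)).trans hm
      norm_num
      exact h4
    have b3 : |(κ (σ θ (τ n)) (τ n) - 1) * (u θ (τ n) ^ 3)⁻¹|
        ≤ (√(2 * π * (64 * z n ^ 4)) + 2 * √((2 * π)⁻¹ * z n ^ 4)) * exp (3 * L) := by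
      rw [abs_mul]
      refine mul_le_mul (hκ1 n _) ?_ (abs_nonneg _) (by positivity)
      rw [inv_cube_eq_exp hup, abs_of_pos (exp_pos _)]
      exact exp_le_exp.2 (by linarith [neg_abs_le (log (u θ (τ n))), hul θ (τ n) (hτa n)])
    rw [e1]
    rw [abs_le] at b1 b2 b3 ⊢
    simp only [hΦ]
    constructor <;> linarith [b1.1, b1.2, b2.1, b2.2, b3.1, b3.2]
  have hτtop : Filter.Tendsto τ Filter.atTop Filter.atTop :=
    Filter.tendsto_atTop_mono hτn tendsto_natCast_atTop_atTop
  have hlim : ∀ θ, Filter.Tendsto (fun n => u θ (τ n)) Filter.atTop (nhds (exp (l θ))) :=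
    fun θ => by
    have h1 := ((continuous_exp.tendsto _).comp (hlt θ)).comp hτtop
    refine h1.congr fun n => ?_
    simp only [Function.comp_apply]
    rw [exp_log (S.pos θ (τ n))]
  obtain ⟨P, hP, hP'⟩ := limit_second_deriv (w := fun n θ => u θ (τ n))
    (w' := fun n θ => dx u θ (τ n)) (fun n => S.peru (τ n))
    (fun n x => S.smu.hasDerivAt_x x (τ n)) (fun n x => S.smu.dx.hasDerivAt_x x (τ n)) hlim hunif
  refine ⟨fun θ => exp (l θ), smooth_of_ode (fun θ => exp_pos _) hP hP',
    fun θ => by simp only [hlp θ], fun θ => exp_pos _, ?_, fun θ => ?_⟩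
  · obtain ⟨K1, hK10, hK1⟩ := exists_bound_strip S.smu.continuous S.peru a
    refine ⟨exp L * B + (K1 + exp L) * exp (a / 4), by positivity, fun t ht θ => ?_⟩
    have hE := exp_pos (-(t / 4))
    rcases le_total a t with h | h
    · refine (hclose θ t h).trans ?_
      rw [← mul_assoc]
      refine mul_le_mul_of_nonneg_right ?_ hE.le
      have : 0 ≤ (K1 + exp L) * exp (a / 4) := by positivity
      linarith
    · have h1 := hK1 θ t ⟨by linarith, h⟩
      have h2 : |u θ t - exp (l θ)| ≤ K1 + exp L := by
        refine (abs_sub _ _).trans (add_le_add h1 ?_)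
        rw [abs_of_pos (exp_pos _)]
        exact exp_le_exp.2 ((le_abs_self _).trans (hll θ))
      have h3 : 1 ≤ exp (a / 4) * exp (-(t / 4)) := by
        rw [← exp_add]
        exact one_le_exp (by linarith)
      have h4 : 0 ≤ K1 + exp L := by positivity
      have h5 := mul_le_mul_of_nonneg_left h3 h4
      have h6 : 0 ≤ exp L * B * exp (-(t / 4)) := by positivity
      linarith
  · have e1 : deriv (fun θ => exp (l θ)) = P := funext fun x => (hP x).deriv
    rw [e1, (hP' θ).deriv]
    have := exp_pos (l θ)
    field_simp
    ring

end

lemma Sol.integral_inv_sq {T : ℝ} {κ W u σ : ℝ → ℝ → ℝ} (S : Sol T κ W u σ) (t : ℝ) :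
    ∫ θ in (0 : ℝ)..2 * π, (u θ t ^ 2)⁻¹ = 2 * π := by
  have := S.integral_comp (g := fun _ => 1) continuous_const (fun _ => rfl) t
  simpa using this

lemma isNormalizedFlow_of_sol {u₀ : ℝ → ℝ} {κ W u σ : ℝ → ℝ → ℝ} (h0 : ∀ θ, u θ 0 = u₀ θ)
    (hS : ∀ T, Sol T κ W u σ) : IsNormalizedFlow 1 u₀ u := by
  refine ⟨(hS 0).smu, fun θ t => (hS 0).peru t θ, (hS 0).pos, h0, fun θ t ht => ?_⟩
  have S := hS t
  have e1 : ∀ θ, scalCurv 1 u θ t = κ (σ θ t) t := fun θ => by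
    rw [← S.curv t ⟨ht, le_rfl⟩ θ, scalCurv, one_mul]
    rfl
  have e2 : scalCurvAvg 1 u t = avg κ t := by
    rw [scalCurvAvg, S.integral_inv_sq t]
    simp only [e1]
    rw [S.integral_comp (g := fun x => κ x t) (S.smκ.continuous_left t) (S.perκ t) t, avg,
      div_eq_inv_mul]
  rw [e1, e2]
  exact S.dtu θ t

/-- Mean of the affine curvature in terms of the angle. -/
noncomputable def meanCurv (u : ℝ → ℝ → ℝ) : ℝ → ℝ :=
  avg fun θ t => u θ t * (dx (dx u) θ t + u θ t)

lemma sm_curvDensity {u : ℝ → ℝ → ℝ} (hu : Sm u) :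
    Sm fun θ t => u θ t * (dx (dx u) θ t + u θ t) := hu.mul (hu.dx.dx.add hu)

lemma continuous_meanCurv {u : ℝ → ℝ → ℝ} (hu : Sm u) : Continuous (meanCurv u) :=
  (sm_curvDensity hu).avg.continuous_right 0

lemma scalCurv_mul_inv {u : ℝ → ℝ → ℝ} {θ t : ℝ} (h : 0 < u θ t) :
    scalCurv 1 u θ t * (u θ t ^ 2)⁻¹ = u θ t * (dx (dx u) θ t + u θ t) := by
  rw [scalCurv, one_mul, show deriv (deriv fun x => u x t) θ = dx (dx u) θ t from rfl]
  field_simp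

lemma integral_inv_sq_of_flow {u₀ : ℝ → ℝ} {u : ℝ → ℝ → ℝ} (h : IsNormalizedFlow 1 u₀ u)
    (hn : ∫ θ in (0 : ℝ)..2 * π, (u₀ θ ^ 2)⁻¹ = 2 * π) {t : ℝ} (ht : 0 ≤ t) :
    ∫ θ in (0 : ℝ)..2 * π, (u θ t ^ 2)⁻¹ = 2 * π := by
  obtain ⟨hu, hper, hpos, hini, hflow⟩ := h
  change Sm u at hu
  have hp := two_pi_pos
  have smi : Sm fun θ t => (u θ t ^ 2)⁻¹ := (hu.pow 2).inv fun x t => (pow_pos (hpos x t) 2).ne'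
  have hd : ∀ s ∈ Set.Icc 0 t, HasDerivAt (fun s => ∫ θ in (0 : ℝ)..2 * π, (u θ s ^ 2)⁻¹) 0 s := by
    intro s hs
    refine (smi.hasDerivAt_integral 0 (2 * π) s).congr_deriv ?_
    have e : ∀ θ, dt (fun θ t => (u θ t ^ 2)⁻¹) θ s =
        1 / 2 * (scalCurvAvg 1 u s * (u θ s ^ 2)⁻¹) - 1 / 2 * (scalCurv 1 u θ s * (u θ s ^ 2)⁻¹) := by
      intro θ
      have h1 := (((hu.hasDerivAt_t θ s).fun_pow 2).fun_inv (pow_pos (hpos θ s) 2).ne')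
      have h2 : dt u θ s = _ := hflow θ s hs.1
      rw [dt, h1.deriv, h2]
      have := (hpos θ s).ne'
      field_simp
      ring
    simp only [e]
    have ci := smi.continuous_left s
    have cR : Continuous fun θ => scalCurv 1 u θ s * (u θ s ^ 2)⁻¹ := by
      simp only [scalCurv_mul_inv (hpos _ s)]
      exact (sm_curvDensity hu).continuous_left s
    have c1 : Continuous fun θ => 1 / 2 * (scalCurvAvg 1 u s * (u θ s ^ 2)⁻¹) := by fun_prop
    have c2 : Continuous fun θ => 1 / 2 * (scalCurv 1 u θ s * (u θ s ^ 2)⁻¹) := by fun_prop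
    rw [intervalIntegral.integral_sub (c1.intervalIntegrable _ _) (c2.intervalIntegrable _ _),
      intervalIntegral.integral_const_mul,
      intervalIntegral.integral_const_mul, intervalIntegral.integral_const_mul, scalCurvAvg]
    have hl : 0 < ∫ θ in (0 : ℝ)..2 * π, (u θ s ^ 2)⁻¹ :=
      intervalIntegral.intervalIntegral_pos_of_pos (ci.intervalIntegrable _ _)
        (fun θ => inv_pos.2 (pow_pos (hpos θ s) 2)) hp
    rw [div_mul_cancel₀ _ hl.ne', sub_self]
  have := constant_of_has_deriv_right_zero (fun s hs => (hd s hs).continuousAt.continuousWithinAt)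
    (fun s hs => (hd s ⟨hs.1, hs.2.le⟩).hasDerivWithinAt) t ⟨ht, le_rfl⟩
  rw [this]
  simp only [hini]
  exact hn

lemma dt_of_flow {u₀ : ℝ → ℝ} {u : ℝ → ℝ → ℝ} (h : IsNormalizedFlow 1 u₀ u)
    (hn : ∫ θ in (0 : ℝ)..2 * π, (u₀ θ ^ 2)⁻¹ = 2 * π) {t : ℝ} (ht : 0 ≤ t) (θ : ℝ) :
    dt u θ t = 1 / 4 * (u θ t ^ 3 * (dx (dx u) θ t + u θ t) - meanCurv u t) * u θ t := by
  have e : scalCurvAvg 1 u t = meanCurv u t := by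
    rw [scalCurvAvg, integral_inv_sq_of_flow h hn ht, meanCurv, avg, div_eq_inv_mul]
    simp only [scalCurv_mul_inv (h.2.2.1 _ t)]
  have := h.2.2.2.2 θ t ht
  rw [e, scalCurv, one_mul] at this
  exact this

lemma sq_integral_le {f : ℝ → ℝ} (hf : Continuous f) :
    ((2 * π)⁻¹ * ∫ x in (0 : ℝ)..2 * π, f x) ^ 2 ≤ (2 * π)⁻¹ * ∫ x in (0 : ℝ)..2 * π, f x ^ 2 := by
  have hp := two_pi_pos
  set m := (2 * π)⁻¹ * ∫ x in (0 : ℝ)..2 * π, f x with hm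
  have h : ∫ x in (0 : ℝ)..2 * π, (m ^ 2 + 2 * m * (f x - m)) ≤ ∫ x in (0 : ℝ)..2 * π, f x ^ 2 :=
    intervalIntegral.integral_mono_on hp.le
      (Continuous.intervalIntegrable (by fun_prop) _ _) (Continuous.intervalIntegrable (by fun_prop) _ _)
      fun x _ => by nlinarith [sq_nonneg (f x - m)]
  have c1 : Continuous fun x => 2 * m * (f x - m) := by fun_prop
  rw [intervalIntegral.integral_add (continuous_const.intervalIntegrable _ _)
    (c1.intervalIntegrable _ _), intervalIntegral.integral_const_mul,
    intervalIntegral.integral_sub (hf.intervalIntegrable _ _) (continuous_const.intervalIntegrable _ _),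
    intervalIntegral.integral_const, intervalIntegral.integral_const, smul_eq_mul, smul_eq_mul,
    sub_zero] at h
  have e : ∫ x in (0 : ℝ)..2 * π, f x = 2 * π * m := by rw [hm]; field_simp
  rw [e, sub_self, mul_zero, add_zero] at h
  rw [inv_mul_eq_div, le_div_iff₀ hp]
  linarith

lemma meanCurv_sub {u v : ℝ → ℝ → ℝ} (hu : Sm u) (hv : Sm v) (pu : ∀ t, Per (u · t))
    (pv : ∀ t, Per (v · t)) (t : ℝ) : meanCurv u t - meanCurv v t = (2 * π)⁻¹ *
      ∫ θ in (0 : ℝ)..2 * π, (u θ t - v θ t) * (dx (dx u) θ t + dx (dx v) θ t + u θ t + v θ t) := by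
  have cu := hu.continuous_left t
  have cv := hv.continuous_left t
  have cuu := hu.dx.dx.continuous_left t
  have cvv := hv.dx.dx.continuous_left t
  have c1 := (sm_curvDensity hu).continuous_left t
  have c2 := (sm_curvDensity hv).continuous_left t
  rw [meanCurv, meanCurv, avg, avg, ← mul_sub,
    ← intervalIntegral.integral_sub (c1.intervalIntegrable _ _) (c2.intervalIntegrable _ _)]
  congr 1
  refine integral_eq_of_per (P := fun θ => v θ t * dx u θ t - u θ t * dx v θ t) (fun x => ?_)
    (fun x => ?_) (by fun_prop) (by fun_prop)
  · simp only [pu t x, pv t x, hu.per_dx pu t x, hv.per_dx pv t x]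
  · refine (((hv.hasDerivAt_x x t).fun_mul (hu.dx.hasDerivAt_x x t)).fun_sub
      ((hu.hasDerivAt_x x t).fun_mul (hv.dx.hasDerivAt_x x t))).congr_deriv ?_
    ring

lemma flow_energy_deriv {u v : ℝ → ℝ → ℝ} (hu : Sm u) (hv : Sm v) (pu : ∀ t, Per (u · t))
    (pv : ∀ t, Per (v · t)) {t : ℝ}
    (du : ∀ θ, dt u θ t = 1 / 4 * (u θ t ^ 3 * (dx (dx u) θ t + u θ t) - meanCurv u t) * u θ t)
    (dv : ∀ θ, dt v θ t = 1 / 4 * (v θ t ^ 3 * (dx (dx v) θ t + v θ t) - meanCurv v t) * v θ t)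
    {A B : ℝ}
    (hA : ∀ θ, 2 * u θ t ^ 2 * dx u θ t ^ 2 + 1 / 2 * ((u θ t + v θ t) * (u θ t ^ 2 + v θ t ^ 2)
      * dx (dx v) θ t + (u θ t ^ 4 + u θ t ^ 3 * v θ t + u θ t ^ 2 * v θ t ^ 2 + u θ t * v θ t ^ 3
      + v θ t ^ 4) - meanCurv u t) + 1 / 4 * v θ t ^ 2 ≤ A)
    (hB : ∀ θ, (dx (dx u) θ t + dx (dx v) θ t + u θ t + v θ t) ^ 2 ≤ B) :
    HasDerivAt (fun t => ∫ θ in (0 : ℝ)..2 * π, (u θ t - v θ t) ^ 2)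
      (∫ θ in (0 : ℝ)..2 * π, dt (fun θ t => (u θ t - v θ t) ^ 2) θ t) t ∧
    ∫ θ in (0 : ℝ)..2 * π, dt (fun θ t => (u θ t - v θ t) ^ 2) θ t
      ≤ (A + 1 / 4 * B) * ∫ θ in (0 : ℝ)..2 * π, (u θ t - v θ t) ^ 2 := by
  have hp := two_pi_pos
  have smw : Sm fun θ t => (u θ t - v θ t) ^ 2 := (hu.sub hv).pow 2
  refine ⟨smw.hasDerivAt_integral 0 (2 * π) t, ?_⟩
  have cu := hu.continuous_left t
  have cv := hv.continuous_left t
  have cux := hu.dx.continuous_left t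
  have cvx := hv.dx.continuous_left t
  have cuu := hu.dx.dx.continuous_left t
  have cvv := hv.dx.dx.continuous_left t
  have hr := meanCurv_sub hu hv pu pv t
  set r := meanCurv u t - meanCurv v t with hrdef
  set g : ℝ → ℝ := fun θ => -2 * u θ t ^ 3 * dx u θ t * (u θ t - v θ t) * (dx u θ t - dx v θ t)
    - 1 / 2 * u θ t ^ 4 * (dx u θ t - dx v θ t) ^ 2
    + 1 / 2 * ((u θ t + v θ t) * (u θ t ^ 2 + v θ t ^ 2)
      * dx (dx v) θ t + (u θ t ^ 4 + u θ t ^ 3 * v θ t + u θ t ^ 2 * v θ t ^ 2 + u θ t * v θ t ^ 3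
      + v θ t ^ 4) - meanCurv u t) * (u θ t - v θ t) ^ 2
    - 1 / 2 * r * v θ t * (u θ t - v θ t) with hg
  have cg : Continuous g := by rw [hg]; fun_prop
  have e1 : ∫ θ in (0 : ℝ)..2 * π, dt (fun θ t => (u θ t - v θ t) ^ 2) θ t
      = ∫ θ in (0 : ℝ)..2 * π, g θ := by
    refine integral_eq_of_per
      (P := fun θ => 1 / 2 * u θ t ^ 4 * ((u θ t - v θ t) * (dx u θ t - dx v θ t))) (fun x => ?_)
      (fun x => ?_) (smw.dt.continuous_left t) cg
    · simp only [pu t x, pv t x, hu.per_dx pu t x, hv.per_dx pv t x]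
    · refine ((((hu.hasDerivAt_x x t).fun_pow 4).const_mul (1 / 2)).fun_mul
        (((hu.hasDerivAt_x x t).fun_sub (hv.hasDerivAt_x x t)).fun_mul
        ((hu.dx.hasDerivAt_x x t).fun_sub (hv.dx.hasDerivAt_x x t)))).congr_deriv ?_
      have e : dt (fun θ t => (u θ t - v θ t) ^ 2) x t
          = 2 * (u x t - v x t) * (dt u x t - dt v x t) := by
        have := ((hu.hasDerivAt_t x t).fun_sub (hv.hasDerivAt_t x t)).fun_pow 2
        rw [dt, this.deriv]
        push_cast
        ring
      rw [e, du, dv, hg, hrdef]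
      push_cast
      ring
  have cw : Continuous fun θ => A * (u θ t - v θ t) ^ 2 := by fun_prop
  have e2 : ∫ θ in (0 : ℝ)..2 * π, g θ
      ≤ ∫ θ in (0 : ℝ)..2 * π, (A * (u θ t - v θ t) ^ 2 + 1 / 4 * r ^ 2) := by
    refine intervalIntegral.integral_mono_on hp.le (cg.intervalIntegrable _ _)
      ((cw.add continuous_const).intervalIntegrable _ _) fun θ _ => ?_
    have h1 := mul_le_mul_of_nonneg_right (hA θ) (sq_nonneg (u θ t - v θ t))
    have h2 := sq_nonneg (u θ t ^ 2 * (dx u θ t - dx v θ t) + 2 * u θ t * dx u θ t * (u θ t - v θ t))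
    have h3 := sq_nonneg (r + v θ t * (u θ t - v θ t))
    rw [hg]
    simp only
    linarith
  rw [intervalIntegral.integral_add (cw.intervalIntegrable _ _)
    (continuous_const.intervalIntegrable _ _), intervalIntegral.integral_const_mul,
    intervalIntegral.integral_const, smul_eq_mul, sub_zero] at e2
  have cf : Continuous fun θ => (u θ t - v θ t) * (dx (dx u) θ t + dx (dx v) θ t + u θ t + v θ t) := by
    fun_prop
  have e3 := sq_integral_le cf
  rw [← hr] at e3
  have e4 : ∫ θ in (0 : ℝ)..2 * π,
      ((u θ t - v θ t) * (dx (dx u) θ t + dx (dx v) θ t + u θ t + v θ t)) ^ 2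
      ≤ ∫ θ in (0 : ℝ)..2 * π, B * (u θ t - v θ t) ^ 2 := by
    refine intervalIntegral.integral_mono_on hp.le ((cf.pow 2).intervalIntegrable _ _)
      (Continuous.intervalIntegrable (by fun_prop) _ _) fun θ _ => ?_
    rw [mul_pow, mul_comm]
    exact mul_le_mul_of_nonneg_right (hB θ) (sq_nonneg _)
  rw [intervalIntegral.integral_const_mul] at e4
  rw [inv_mul_eq_div, le_div_iff₀ hp] at e3
  rw [e1]
  linarith

lemma eq_zero_of_integral_sq {f : ℝ → ℝ} (hf : Continuous f) (hp : Per f)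
    (h : ∫ x in (0 : ℝ)..2 * π, f x ^ 2 ≤ 0) (x : ℝ) : f x = 0 := by
  obtain ⟨y, hy, hxy⟩ := (show Function.Periodic f (2 * π) from hp).exists_mem_Ico₀ two_pi_pos x
  rw [hxy]
  by_contra hne
  refine h.not_gt (intervalIntegral.integral_pos two_pi_pos (hf.pow 2).continuousOn
    (fun z _ => sq_nonneg _) ⟨y, ⟨hy.1, hy.2.le⟩, by positivity⟩)

theorem flow_unique {u₀ : ℝ → ℝ} {u v : ℝ → ℝ → ℝ} (h : IsNormalizedFlow 1 u₀ u)
    (h' : IsNormalizedFlow 1 u₀ v) (hn : ∫ θ in (0 : ℝ)..2 * π, (u₀ θ ^ 2)⁻¹ = 2 * π)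
    (θ : ℝ) {T : ℝ} (hT : 0 ≤ T) : u θ T = v θ T := by
  have hu : Sm u := h.1
  have hv : Sm v := h'.1
  have pu : ∀ t, Per (u · t) := fun t x => h.2.1 x t
  have pv : ∀ t, Per (v · t) := fun t x => h'.2.1 x t
  have cu := hu.continuous
  have cv := hv.continuous
  have cux := hu.dx.continuous
  have cuu := hu.dx.dx.continuous
  have cvv := hv.dx.dx.continuous
  have cm : Continuous fun p : ℝ × ℝ => meanCurv u p.2 := (continuous_meanCurv hu).comp continuous_snd
  obtain ⟨A, -, hA⟩ := exists_bound_strip (g := fun θ t => 2 * u θ t ^ 2 * dx u θ t ^ 2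
      + 1 / 2 * ((u θ t + v θ t) * (u θ t ^ 2 + v θ t ^ 2)
      * dx (dx v) θ t + (u θ t ^ 4 + u θ t ^ 3 * v θ t + u θ t ^ 2 * v θ t ^ 2 + u θ t * v θ t ^ 3
      + v θ t ^ 4) - meanCurv u t) + 1 / 4 * v θ t ^ 2) (by fun_prop) (fun t x => by
        simp only [pu t x, pv t x, hu.per_dx pu t x, hv.dx.per_dx (hv.per_dx pv) t x]) T
  obtain ⟨B, -, hB⟩ := exists_bound_strip
    (g := fun θ t => (dx (dx u) θ t + dx (dx v) θ t + u θ t + v θ t) ^ 2) (by fun_prop) (fun t x => by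
        simp only [pu t x, pv t x, hu.dx.per_dx (hu.per_dx pu) t x,
          hv.dx.per_dx (hv.per_dx pv) t x]) T
  have key : ∀ t ∈ Set.Icc 0 T, _ := fun t ht => flow_energy_deriv hu hv pu pv (t := t) (A := A)
    (B := B) (dt_of_flow h hn ht.1) (dt_of_flow h' hn ht.1)
    (fun θ => (le_abs_self _).trans (hA θ t ⟨by linarith [ht.1], ht.2⟩))
    (fun θ => (le_abs_self _).trans (hB θ t ⟨by linarith [ht.1], ht.2⟩))
  set K := A + 1 / 4 * B
  set G : ℝ → ℝ := fun t => ∫ θ in (0 : ℝ)..2 * π, (u θ t - v θ t) ^ 2 with hG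
  set G' : ℝ → ℝ := fun t => ∫ θ in (0 : ℝ)..2 * π, dt (fun θ t => (u θ t - v θ t) ^ 2) θ t
  have hd : ∀ t ∈ Set.Icc 0 T, HasDerivAt (fun t => G t * exp (-(K * t)))
      ((G' t - K * G t) * exp (-(K * t))) t := fun t ht =>
    ((key t ht).1.fun_mul (((hasDerivAt_id t).const_mul K).fun_neg.exp)).congr_deriv (by
      simp only [id]
      ring)
  have hmono := antitoneOn_of_deriv_nonpos (convex_Icc 0 T)
    (fun t ht => (hd t ht).continuousAt.continuousWithinAt)
    (fun t ht => (hd t (interior_subset ht)).differentiableAt.differentiableWithinAt) (fun t ht => by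
      rw [(hd t (interior_subset ht)).deriv]
      exact mul_nonpos_of_nonpos_of_nonneg (sub_nonpos.2 (key t (interior_subset ht)).2)
        (exp_pos _).le) (Set.left_mem_Icc.2 hT) (Set.right_mem_Icc.2 hT) hT
  have h0 : G 0 = 0 := by
    simp only [hG, h.2.2.2.1, h'.2.2.2.1, sub_self]
    simp
  simp only [h0, zero_mul] at hmono
  have hGT : G T ≤ 0 := nonpos_of_mul_nonpos_left hmono (exp_pos _)
  exact sub_eq_zero.1 (eq_zero_of_integral_sq (f := fun θ => u θ T - v θ T)
    ((hu.continuous_left T).sub (hv.continuous_left T))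
    (fun x => by simp only [pu T x, pv T x]) hGT θ)

end AffineFlow

/-- Global existence, uniqueness and exponential convergence for the
one-dimensional normalized affine flow (α = 1), under the initial
orthogonality condition. -/
theorem affine_flow_global_existence_convergence
    (u₀ : ℝ → ℝ)
    (h0 : ContDiff ℝ (⊤ : ℕ∞) u₀)
    (h0per : ∀ θ, u₀ (θ + 2 * π) = u₀ θ)
    (h0pos : ∀ θ, 0 < u₀ θ)
    (h0norm : ∫ θ in (0:ℝ)..(2 * π), ((u₀ θ) ^ 2)⁻¹ = 2 * π)
    (h0orthc : ∫ θ in (0:ℝ)..(2 * π), ((u₀ θ) ^ 3)⁻¹ * Real.cos θ = 0)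
    (h0orths : ∫ θ in (0:ℝ)..(2 * π), ((u₀ θ) ^ 3)⁻¹ * Real.sin θ = 0) :
    ∃ u : ℝ → ℝ → ℝ,
      IsNormalizedFlow 1 u₀ u
      ∧ (∀ u' : ℝ → ℝ → ℝ, IsNormalizedFlow 1 u₀ u' →
          ∀ θ t, 0 ≤ t → u' θ t = u θ t)
      ∧ ∃ (uinf : ℝ → ℝ) (C a : ℝ), 0 < C ∧ 0 < a
          ∧ ContDiff ℝ (⊤ : ℕ∞) uinf
          ∧ (∀ θ, uinf (θ + 2 * π) = uinf θ)
          ∧ (∀ θ, 0 < uinf θ)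
          ∧ (∀ t, 0 ≤ t → (⨆ θ : ℝ, |u θ t - uinf θ|) ≤ C * Real.exp (-a * t))
          ∧ ∃ c : ℝ, ∀ θ, (uinf θ) ^ 3 * (deriv (deriv uinf) θ + uinf θ) = c := by
  obtain ⟨κ, W, u, σ, hini, hS⟩ :=
    AffineFlow.exists_global h0 h0per h0pos h0norm h0orthc h0orths
  obtain ⟨v, hv, hvper, hvpos, ⟨C, hC, hlim⟩, hcurv⟩ := AffineFlow.exists_limit hS
  have hflow := AffineFlow.isNormalizedFlow_of_sol hini hS
  refine ⟨u, hflow, fun u' h' θ t ht => AffineFlow.flow_unique h' hflow h0norm θ ht,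
    v, C, 1 / 4, hC, by norm_num, hv, hvper, hvpos, fun t ht => ciSup_le fun θ => ?_, 1, hcurv⟩
  rw [show -(1 / 4 : ℝ) * t = -(t / 4) by ring]
  exact hlim t ht θ
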